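/- arXiv:math-ph/0610046 — 2 statements merged into one kernel-verified Lean document; each statement's English description precedes it below -/
import Mathlib

section
/- Let a ≥ 1 be a real number and let Z(s) = ∑_{n=1}^∞ (n(n+1))^{-s} + 2·∑_{m=1}^∞ ∑_{n=0}^∞ ((a m + n)(a m + n + 1))^{-s}, which converges absolutely for Re(s) > 2. Then every analytic continuation f of this series to the point 0 satisfies f'(0) = −(a/3 + 1/(3a))·log a − 2·log(2π) + logΓ(1 + 1/a) + a/3 + 1 + 1/(2a) − 2a·ζ'(−1) − 2a·ζ_H'(−1, 1 + 1/a) + 2i·∫_0^∞ [ logΓ(1 + iy/a) + logΓ(1 + 1/a + iy/a) − logΓ(1 − iy/a) − logΓ(1 + 1/a − iy/a) ]·(e^{2πy} − 1)^{-1} dy. -/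
/-- `f` is an analytic continuation to `s₀` of the function `F` given (by an absolutely
convergent series) on the half-plane `{s : Re s > c}`. -/
def IsContinuationAt (F : ℂ → ℂ) (c : ℝ) (s₀ : ℂ) (f : ℂ → ℂ) : Prop :=
  ∃ U : Set ℂ, IsOpen U ∧ IsConnected U ∧ s₀ ∈ U ∧ {s : ℂ | c < s.re} ⊆ U ∧
    AnalyticOnNhd ℂ f U ∧ ∀ s : ℂ, c < s.re → f s = F s

/-- The spectral zeta function of the Laplacian on the 2-dimensional deformed sphere
`S²_{1/a}`: `Z(s) = ∑_{n≥1} (n(n+1))^{-s} + 2·∑_{m≥1} ∑_{n≥0} ((am+n)(am+n+1))^{-s}`. -/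
noncomputable def zetaS2 (a : ℝ) : ℂ → ℂ := fun s =>
  (∑' n : ℕ, (((n : ℂ) + 1) * ((n : ℂ) + 2)) ^ (-s))
    + 2 * ∑' (m : ℕ) (n : ℕ),
        (((a : ℂ) * (m + 1) + n) * ((a : ℂ) * (m + 1) + n + 1)) ^ (-s)

namespace DeformedSphere

open MeasureTheory Set Filter Topology

/-- The Bose weight `1 / (e^{2πy} - 1)`. -/
noncomputable def boseWeight (y : ℝ) : ℝ := (Real.exp (2 * Real.pi * y) - 1)⁻¹

lemma boseWeight_nonneg {y : ℝ} (hy : 0 < y) : 0 ≤ boseWeight y := by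
  have : 1 ≤ Real.exp (2 * Real.pi * y) := Real.one_le_exp (by positivity)
  exact inv_nonneg.mpr (by linarith)

lemma measurable_boseWeight : Measurable boseWeight := by
  unfold boseWeight; fun_prop

lemma mul_boseWeight_le {y : ℝ} (hy : 0 < y) : y * boseWeight y ≤ Real.exp (-3 * y) := by
  have h1 : Real.exp (2 * Real.pi * y) = Real.exp (3 * y) * Real.exp ((2 * Real.pi - 3) * y) := by
    rw [← Real.exp_add]; ring_nf
  have h2 : 1 + 3 * y ≤ Real.exp ((2 * Real.pi - 3) * y) := by
    have := Real.add_one_le_exp ((2 * Real.pi - 3) * y)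
    nlinarith [Real.pi_gt_three]
  have h3 : 1 ≤ Real.exp (3 * y) := Real.one_le_exp (by positivity)
  have h4 : Real.exp (3 * y) * y ≤ Real.exp (2 * Real.pi * y) - 1 := by
    rw [h1]; nlinarith
  have h5 : 0 < Real.exp (2 * Real.pi * y) - 1 := lt_of_lt_of_le (by positivity) h4
  rw [boseWeight, mul_inv_le_iff₀ h5]
  calc y = Real.exp (-3 * y) * (Real.exp (3 * y) * y) := by
        rw [← mul_assoc, ← Real.exp_add]; simp
    _ ≤ _ := by gcongr

lemma norm_cpow_neg_le (s : ℂ) (z : ℂ) (hz : z ≠ 0) :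
    ‖z ^ (-s)‖ ≤ ‖z‖ ^ (-s.re) * Real.exp (Real.pi * ‖s‖) := by
  rw [Complex.norm_cpow_of_ne_zero hz, div_eq_mul_inv, ← Real.exp_neg]
  simp only [Complex.neg_re, Complex.neg_im, mul_neg, neg_neg]
  refine mul_le_mul_of_nonneg_left (Real.exp_le_exp.mpr ?_) (by positivity)
  calc z.arg * s.im ≤ |z.arg * s.im| := le_abs_self _
    _ = |z.arg| * |s.im| := abs_mul _ _
    _ ≤ _ := mul_le_mul (Complex.abs_arg_le_pi z) (Complex.abs_im_le_norm s) (abs_nonneg _)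
        Real.pi_pos.le

lemma exists_norm_cpow_neg_le_exp (S : ℝ) : ∃ C : ℝ, 0 ≤ C ∧ ∀ s : ℂ, ‖s‖ ≤ S → ∀ z : ℂ,
    1 ≤ z.re → ‖z ^ (-s)‖ ≤ C * Real.exp ‖z‖ := by
  refine ⟨(⌈S⌉₊.factorial : ℝ) * Real.exp (Real.pi * S), by positivity, fun s hs z hz => ?_⟩
  have hz1 : 1 ≤ ‖z‖ := hz.trans (Complex.re_le_norm z)
  have hz0 : z ≠ 0 := by rintro rfl; norm_num at hz
  refine (norm_cpow_neg_le s z hz0).trans ?_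
  have h1 : ‖z‖ ^ (-s.re) ≤ (⌈S⌉₊.factorial : ℝ) * Real.exp ‖z‖ := by
    calc ‖z‖ ^ (-s.re) ≤ ‖z‖ ^ ((⌈S⌉₊ : ℕ) : ℝ) := by
          apply Real.rpow_le_rpow_of_exponent_le hz1
          calc -s.re ≤ |s.re| := neg_le_abs _
            _ ≤ ‖s‖ := Complex.abs_re_le_norm s
            _ ≤ _ := hs.trans (Nat.le_ceil S)
      _ = ‖z‖ ^ ⌈S⌉₊ := Real.rpow_natCast _ _
      _ ≤ _ := by
          have := Real.pow_div_factorial_le_exp ‖z‖ (norm_nonneg z) ⌈S⌉₊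
          rwa [div_le_iff₀ (by positivity), mul_comm] at this
  calc _ ≤ ((⌈S⌉₊.factorial : ℝ) * Real.exp ‖z‖) * Real.exp (Real.pi * S) := by
        gcongr
    _ = _ := by ring

/-- Mean value estimate along a vertical segment. -/
lemma norm_vertical_sub_le {F F' : ℂ → ℂ} {c : ℝ} {w : ℂ} {v M : ℝ} (hw : c ≤ w.re) (hv : 0 ≤ v)
    (hF : ∀ z : ℂ, c ≤ z.re → HasDerivAt F (F' z) z)
    (hM : ∀ z : ℂ, c ≤ z.re → ‖z‖ ≤ ‖w‖ + v → ‖F' z‖ ≤ M) :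
    ‖F (w + Complex.I * v) - F (w - Complex.I * v)‖ ≤ 2 * v * M := by
  set A : Set ℂ := {z | c ≤ z.re} ∩ Metric.closedBall 0 (‖w‖ + v)
  have hA : Convex ℝ A := (convex_halfSpace_re_ge c).inter (convex_closedBall _ _)
  have hn : ‖Complex.I * (v : ℂ)‖ = v := by simp [abs_of_nonneg hv]
  have h1 : w - Complex.I * v ∈ A := ⟨by simpa using hw, by
    rw [mem_closedBall_zero_iff]; exact (norm_sub_le _ _).trans (by rw [hn])⟩
  have h2 : w + Complex.I * v ∈ A := ⟨by simpa using hw, by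
    rw [mem_closedBall_zero_iff]; exact (norm_add_le _ _).trans (by rw [hn])⟩
  have := Convex.norm_image_sub_le_of_norm_hasDerivWithin_le
    (fun z hz => (hF z hz.1).hasDerivWithinAt)
    (fun z hz => hM z hz.1 (mem_closedBall_zero_iff.mp hz.2)) hA h1 h2
  refine this.trans (le_of_eq ?_)
  have : w + Complex.I * v - (w - Complex.I * v) = 2 * (Complex.I * v) := by ring
  rw [this, norm_mul, hn]; simp; ring

/-- The difference of `z ^ (-s)` at the two points `w ± i y`. -/
noncomputable def cpowDiff (s w : ℂ) (y : ℝ) : ℂ :=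
  (w + Complex.I * y) ^ (-s) - (w - Complex.I * y) ^ (-s)

lemma hasDerivAt_cpow_neg (s : ℂ) {z : ℂ} (hz : 0 < z.re) :
    HasDerivAt (fun z : ℂ => z ^ (-s)) (-s * z ^ (-(s + 1))) z := by
  refine ((hasDerivAt_id z).cpow_const (c := -s) (Or.inl hz)).congr_deriv ?_
  rw [show -(s + 1) = -s - 1 by ring, mul_one, id]

lemma hasDerivAt_cpowDiff (s : ℂ) {w : ℂ} (hw : 0 < w.re) (y : ℝ) :
    HasDerivAt (fun w => cpowDiff s w y) (-s * cpowDiff (s + 1) w y) w := by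
  have h1 := (hasDerivAt_cpow_neg s (z := w + Complex.I * y) (by simpa using hw)).comp w
    ((hasDerivAt_id w).add_const (Complex.I * y))
  have h2 := (hasDerivAt_cpow_neg s (z := w - Complex.I * y) (by simpa using hw)).comp w
    ((hasDerivAt_id w).sub_const (Complex.I * y))
  refine (h1.sub h2).congr_deriv ?_
  simp only [cpowDiff]; ring

lemma norm_le_add_one {s : ℂ} {S : ℝ} (hs : ‖s‖ ≤ S) : ‖s + 1‖ ≤ S + 1 :=
  (norm_add_le _ _).trans (by simpa using hs)

lemma exists_norm_cpowDiff_le (S : ℝ) : ∃ C : ℝ, 0 ≤ C ∧ ∀ s : ℂ, ‖s‖ ≤ S → ∀ w : ℂ, 1 ≤ w.re →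
    ∀ y : ℝ, 0 ≤ y → ‖cpowDiff s w y‖ ≤ C * y * Real.exp (‖w‖ + y) := by
  obtain ⟨C, hC0, hC⟩ := exists_norm_cpow_neg_le_exp (S + 1)
  refine ⟨2 * (|S| * C), by positivity, fun s hs w hw y hy => ?_⟩
  have hs' : ‖s‖ ≤ |S| := hs.trans (le_abs_self _)
  refine (norm_vertical_sub_le (M := |S| * C * Real.exp (‖w‖ + y)) hw hy
    (fun z hz => hasDerivAt_cpow_neg s (by linarith)) fun z hz hzw => ?_).trans (le_of_eq (by ring))
  rw [norm_mul, norm_neg, mul_assoc]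
  exact mul_le_mul hs' ((hC _ (norm_le_add_one hs) z hz).trans (by gcongr)) (norm_nonneg _)
    (abs_nonneg _)

lemma exists_norm_cpowDiff_vertical_le (S : ℝ) : ∃ C : ℝ, 0 ≤ C ∧ ∀ s : ℂ, ‖s‖ ≤ S →
    ∀ w : ℂ, 1 ≤ w.re → ∀ v y : ℝ, 0 ≤ v → 0 ≤ y →
      ‖cpowDiff s (w + Complex.I * v) y - cpowDiff s (w - Complex.I * v) y‖
        ≤ C * v * y * Real.exp (‖w‖ + v + y) := by
  obtain ⟨C, hC0, hC⟩ := exists_norm_cpowDiff_le (S + 1)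
  refine ⟨2 * (|S| * C), by positivity, fun s hs w hw v y hv hy => ?_⟩
  have hs' : ‖s‖ ≤ |S| := hs.trans (le_abs_self _)
  refine (norm_vertical_sub_le (F := fun w => cpowDiff s w y)
    (M := |S| * C * y * Real.exp (‖w‖ + v + y)) hw hv
    (fun z hz => hasDerivAt_cpowDiff s (by linarith) y) fun z hz hzw => ?_).trans
      (le_of_eq (by ring))
  rw [norm_mul, norm_neg]
  calc _ ≤ |S| * (C * y * Real.exp (‖w‖ + v + y)) :=
        mul_le_mul hs' ((hC _ (norm_le_add_one hs) z hz y hy).trans (by gcongr)) (norm_nonneg _)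
          (abs_nonneg _)
    _ = _ := by ring

/-- Differentiation under the integral sign for a holomorphic family dominated by an integrable
function. -/
lemma hasDerivAt_integral_of_norm_le {α : Type*} [MeasurableSpace α] {μ : Measure α} {U : Set ℂ}
    {F : ℂ → α → ℂ} {b : α → ℝ} {s : ℂ} (hU : IsOpen U) (hs : s ∈ U)
    (hd : ∀ᵐ y ∂μ, DifferentiableOn ℂ (F · y) U)
    (hm : ∀ s ∈ U, AEStronglyMeasurable (F s) μ)
    (hb : ∀ᵐ y ∂μ, ∀ s ∈ U, ‖F s y‖ ≤ b y) (hbi : Integrable b μ) :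
    Integrable (fun y => deriv (F · y) s) μ ∧
      HasDerivAt (fun s => ∫ y, F s y ∂μ) (∫ y, deriv (F · y) s ∂μ) s := by
  obtain ⟨r, hr, hrU⟩ := Metric.isOpen_iff.mp hU s hs
  have hsub : ∀ x ∈ Metric.ball s (r / 2), Metric.closedBall x (r / 3) ⊆ U := fun x hx z hz => by
    apply hrU
    rw [Metric.mem_ball] at hx ⊢
    rw [Metric.mem_closedBall] at hz
    linarith [dist_triangle z x s]
  have hmd : AEStronglyMeasurable (fun y => deriv (F · y) s) μ := by
    obtain ⟨u, hu0, hu⟩ : ∃ u : ℕ → ℂ, (∀ n, u n ≠ 0 ∧ s + u n ∈ U) ∧ Tendsto u atTop (𝓝 0) := by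
      refine ⟨fun n => ((r / 2 / (n + 1) : ℝ) : ℂ), fun n => ⟨?_, hrU ?_⟩, ?_⟩
      · exact Complex.ofReal_ne_zero.mpr (by positivity : r / 2 / ((n : ℝ) + 1) ≠ 0)
      · rw [Metric.mem_ball, dist_eq_norm, add_sub_cancel_left, Complex.norm_real,
          Real.norm_of_nonneg (by positivity)]
        calc r / 2 / ((n : ℝ) + 1) ≤ r / 2 := div_le_self (by positivity) (by simp)
          _ < r := by linarith
      · have := (tendsto_one_div_add_atTop_nhds_zero_nat (𝕜 := ℝ)).const_mul (r / 2)
        rw [mul_zero] at this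
        have h2 := (Complex.continuous_ofReal.tendsto 0).comp this
        simpa [Function.comp_def, div_eq_mul_inv] using h2
    refine aestronglyMeasurable_of_tendsto_ae (u := atTop)
      (f := fun n y => (u n)⁻¹ • (F (s + u n) y - F s y)) (fun n => ?_) ?_
    · exact ((hm _ (hu0 n).2).sub (hm _ hs)).const_smul (u n)⁻¹
    · filter_upwards [hd] with y hy
      have h := ((hy s hs).differentiableAt (hU.mem_nhds hs)).hasDerivAt.tendsto_slope_zero
      exact h.comp (tendsto_nhdsWithin_iff.mpr ⟨hu, Eventually.of_forall fun n => (hu0 n).1⟩)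
  refine hasDerivAt_integral_of_dominated_loc_of_deriv_le (Metric.ball_mem_nhds s (half_pos hr))
    (Filter.eventually_of_mem (hU.mem_nhds hs) hm)
    ⟨hm s hs, HasFiniteIntegral.mono' hbi.2 (hb.mono fun y hy => hy s hs)⟩ hmd
    (bound := fun y => b y / (r / 3)) ?_ (hbi.div_const _) ?_
    (F' := fun s y => deriv (F · y) s)
  · filter_upwards [hd, hb] with y hy hby x hx
    refine Complex.norm_deriv_le_of_forall_mem_sphere_norm_le (by positivity)
      ⟨hy.mono (Metric.ball_subset_closedBall.trans (hsub x hx)), ?_⟩ fun z hz =>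
        hby z (hsub x hx (Metric.sphere_subset_closedBall hz))
    rw [closure_ball x (by positivity)]
    exact hy.continuousOn.mono (hsub x hx)
  · filter_upwards [hd] with y hy x hx
    have hxU : x ∈ U := hsub x hx (Metric.mem_closedBall_self (by positivity))
    exact ((hy x hxU).differentiableAt (hU.mem_nhds hxU)).hasDerivAt

/-- A family of entire functions of `s`, indexed by `y > 0`, which decays like `e^{-y}` locally
uniformly in `s`. -/
structure DominatedEntire (F : ℂ → ℝ → ℂ) : Prop where
  differentiable : ∀ y, 0 < y → Differentiable ℂ (F · y)
  measurable : ∀ s, AEStronglyMeasurable (F s) (volume.restrict (Ioi 0))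
  bound : ∀ S : ℝ, ∃ C, ∀ s, ‖s‖ ≤ S → ∀ y, 0 < y → ‖F s y‖ ≤ C * Real.exp (-y)

namespace DominatedEntire

variable {F : ℂ → ℝ → ℂ}

lemma integrableOn (hF : DominatedEntire F) (s : ℂ) : IntegrableOn (F s) (Ioi 0) := by
  obtain ⟨C, hC⟩ := hF.bound ‖s‖
  exact Integrable.mono' (Integrable.const_mul (integrableOn_exp_neg_Ioi 0) C) (hF.measurable s)
    ((ae_restrict_mem measurableSet_Ioi).mono fun y hy => hC s le_rfl y hy)

lemma hasDerivAt_integral (hF : DominatedEntire F) (s : ℂ) :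
    IntegrableOn (fun y => deriv (F · y) s) (Ioi 0) ∧
      HasDerivAt (fun s => ∫ y in Ioi 0, F s y) (∫ y in Ioi 0, deriv (F · y) s) s := by
  obtain ⟨C, hC⟩ := hF.bound (‖s‖ + 1)
  refine hasDerivAt_integral_of_norm_le (U := Metric.ball 0 (‖s‖ + 1)) Metric.isOpen_ball (by simp)
    ?_ (fun s _ => hF.measurable s) ?_ (Integrable.const_mul (integrableOn_exp_neg_Ioi 0) C)
  · exact (ae_restrict_mem measurableSet_Ioi).mono fun y hy => (hF.differentiable y hy).differentiableOn
  · exact (ae_restrict_mem measurableSet_Ioi).mono fun y hy s hs =>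
      hC s (by simpa using (mem_ball_zero_iff.mp hs).le) y hy

lemma differentiable_integral (hF : DominatedEntire F) :
    Differentiable ℂ (fun s => ∫ y in Ioi 0, F s y) :=
  fun s => (hF.hasDerivAt_integral s).2.differentiableAt

end DominatedEntire

lemma integrableOn_rpow_mul_exp_neg {σ c : ℝ} (hσ : -1 < σ) (hc : 0 < c) :
    IntegrableOn (fun t : ℝ => t ^ σ * Real.exp (-(c * t))) (Ioi 0) := by
  have := integrableOn_rpow_mul_exp_neg_mul_rpow hσ one_pos hc
  simpa using this

lemma norm_cpow_mul_exp {a r : ℂ} {t : ℝ} (ht : 0 < t) :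
    ‖(t : ℂ) ^ (a - 1) * Complex.exp (-(r * t))‖ = t ^ (a.re - 1) * Real.exp (-(r.re * t)) := by
  rw [norm_mul, Complex.norm_cpow_eq_rpow_re_of_pos ht, Complex.norm_exp]
  simp

lemma aestronglyMeasurable_cpow_mul_exp (a r : ℂ) :
    AEStronglyMeasurable (fun t : ℝ => (t : ℂ) ^ (a - 1) * Complex.exp (-(r * t)))
      (volume.restrict (Ioi 0)) := by
  apply Measurable.aestronglyMeasurable; fun_prop

lemma integrableOn_cpow_mul_exp {a r : ℂ} (ha : 0 < a.re) (hr : 0 < r.re) :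
    IntegrableOn (fun t : ℝ => (t : ℂ) ^ (a - 1) * Complex.exp (-(r * t))) (Ioi 0) :=
  Integrable.mono' (integrableOn_rpow_mul_exp_neg (by linarith : -1 < a.re - 1) hr)
    (aestronglyMeasurable_cpow_mul_exp a r)
    ((ae_restrict_mem measurableSet_Ioi).mono fun _ ht => (norm_cpow_mul_exp ht).le)

/-- Euler's integral for `r ^ (-a) * Γ(a)` with complex `r` in the right half-plane. -/
lemma integral_cpow_mul_exp {a r : ℂ} (ha : 0 < a.re) (hr : 0 < r.re) :
    ∫ t : ℝ in Ioi 0, (t : ℂ) ^ (a - 1) * Complex.exp (-(r * t)) = r ^ (-a) * Complex.Gamma a := by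
  have hUo : IsOpen {r : ℂ | 0 < r.re} := isOpen_lt continuous_const Complex.continuous_re
  have hL : AnalyticOnNhd ℂ
      (fun r : ℂ => ∫ t : ℝ in Ioi 0, (t : ℂ) ^ (a - 1) * Complex.exp (-(r * t)))
      {r : ℂ | 0 < r.re} := by
    refine DifferentiableOn.analyticOnNhd (fun r hr => ?_) hUo
    have hr' : 0 < r.re := hr
    refine (hasDerivAt_integral_of_norm_le (U := {z : ℂ | r.re / 2 < z.re})
      (isOpen_lt continuous_const Complex.continuous_re) (by simpa using hr')
      (ae_of_all _ fun y => by fun_prop) (fun s _ => aestronglyMeasurable_cpow_mul_exp a s)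
      (b := fun t => t ^ (a.re - 1) * Real.exp (-(r.re / 2 * t))) ?_
      (integrableOn_rpow_mul_exp_neg (by linarith) (by positivity))).2.differentiableAt.differentiableWithinAt
    refine (ae_restrict_mem measurableSet_Ioi).mono fun t ht s hs => ?_
    have ht' : 0 < t := ht
    rw [norm_cpow_mul_exp ht]
    have : r.re / 2 < s.re := hs
    gcongr
  have hR : AnalyticOnNhd ℂ (fun r : ℂ => r ^ (-a) * Complex.Gamma a) {r : ℂ | 0 < r.re} := by
    refine DifferentiableOn.analyticOnNhd (fun r hr => ?_) hUo
    exact ((hasDerivAt_cpow_neg a hr).differentiableAt.mul_const _).differentiableWithinAt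
  refine hL.eqOn_of_preconnected_of_frequently_eq hR
    (convex_halfSpace_re_gt 0).isPreconnected (z₀ := 1) (by simp) ?_ hr
  have hu : Tendsto (fun n : ℕ => ((1 + 1 / ((n : ℝ) + 1) : ℝ) : ℂ)) atTop (𝓝[≠] 1) := by
    refine tendsto_nhdsWithin_iff.mpr ⟨?_, Eventually.of_forall fun n => ?_⟩
    · have := (tendsto_one_div_add_atTop_nhds_zero_nat (𝕜 := ℝ)).const_add 1
      rw [add_zero] at this
      exact (Complex.continuous_ofReal.tendsto 1).comp this
    · have : (1 + 1 / ((n : ℝ) + 1) : ℝ) ≠ 1 := by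
        have : 0 < 1 / ((n : ℝ) + 1) := by positivity
        linarith
      exact fun h => this (Complex.ofReal_injective (by simpa using h))
  refine hu.frequently (Frequently.of_forall fun n => ?_)
  have hp : 0 < (1 + 1 / ((n : ℝ) + 1) : ℝ) := by positivity
  rw [Complex.integral_cpow_mul_exp_neg_mul_Ioi ha hp, one_div, Complex.inv_cpow,
    Complex.cpow_neg]
  rw [Complex.arg_ofReal_of_nonneg hp.le]; exact Real.pi_pos.ne

lemma integral_exp_neg_mul {r : ℂ} (hr : 0 < r.re) :
    ∫ t : ℝ in Ioi 0, Complex.exp (-(r * t)) = r⁻¹ := by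
  have := integral_cpow_mul_exp (a := 1) (by simp) hr
  simpa [Complex.cpow_neg] using this

lemma integrableOn_exp_neg_mul {r : ℂ} (hr : 0 < r.re) :
    IntegrableOn (fun t : ℝ => Complex.exp (-(r * t))) (Ioi 0) := by
  simpa using integrableOn_cpow_mul_exp (a := 1) (by simp) hr

lemma norm_exp_sub_exp_le (θ : ℝ) :
    ‖Complex.exp (Complex.I * θ) - Complex.exp (-(Complex.I * θ))‖ ≤ 2 * |θ| := by
  have h1 := Real.norm_exp_I_mul_ofReal_sub_one_le (x := θ)
  have h2 := Real.norm_exp_I_mul_ofReal_sub_one_le (x := -θ)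
  rw [Complex.ofReal_neg, mul_neg] at h2
  calc _ = ‖(Complex.exp (Complex.I * θ) - 1) - (Complex.exp (-(Complex.I * θ)) - 1)‖ := by ring_nf
    _ ≤ _ := norm_sub_le _ _
    _ ≤ ‖θ‖ + ‖-θ‖ := add_le_add h1 h2
    _ = _ := by simp; ring

lemma hasSum_boseWeight {y : ℝ} (hy : 0 < y) :
    HasSum (fun k : ℕ => Real.exp (-(2 * Real.pi * (k + 1) * y))) (boseWeight y) := by
  have h0 : 0 < 2 * Real.pi * y := by positivity
  have h1 : Real.exp (-(2 * Real.pi * y)) < 1 := Real.exp_lt_one_iff.mpr (by linarith)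
  have := (hasSum_geometric_of_lt_one (Real.exp_pos _).le h1).mul_left (Real.exp (-(2 * Real.pi * y)))
  have h2 : 1 < Real.exp (2 * Real.pi * y) := Real.one_lt_exp_iff.mpr h0
  have h3 : Real.exp (2 * Real.pi * y) - 1 ≠ 0 := by linarith
  have h4 : boseWeight y = Real.exp (-(2 * Real.pi * y)) * (1 - Real.exp (-(2 * Real.pi * y)))⁻¹ := by
    simp only [boseWeight]
    rw [Real.exp_neg]
    field_simp
  rw [h4]
  convert! this using 2 with k
  rw [← Real.exp_nat_mul, ← Real.exp_add]
  ring_nf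

/-- Legendre's formula for the integral of the sine against the Bose weight. -/
lemma legendre_formula {t : ℝ} (ht : 0 < t) :
    ((1 - Complex.exp (-t))⁻¹ : ℂ) = 1 / 2 + (t : ℂ)⁻¹ - Complex.I * ∫ y : ℝ in Ioi 0,
      (Complex.exp (Complex.I * (y * t : ℝ)) - Complex.exp (-(Complex.I * (y * t : ℝ))))
        * boseWeight y := by
  set c : ℕ → ℝ := fun k => 2 * Real.pi * (k + 1) with hc
  have hcpos : ∀ k, 0 < c k := fun k => by positivity
  set f : ℝ → ℂ := fun y =>
    Complex.exp (Complex.I * (y * t : ℝ)) - Complex.exp (-(Complex.I * (y * t : ℝ))) with hf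
  set F : ℕ → ℝ → ℂ := fun k y => f y * Real.exp (-(c k * y)) with hF
  have hFe : ∀ k, F k = fun y : ℝ => Complex.exp (-((c k - Complex.I * t) * y))
      - Complex.exp (-((c k + Complex.I * t) * y)) := fun k => by
    ext y
    simp only [hF, hf]
    rw [Complex.ofReal_exp, sub_mul, ← Complex.exp_add, ← Complex.exp_add]
    push_cast
    ring_nf
  have hre1 : ∀ k, 0 < (c k - Complex.I * t : ℂ).re := fun k => by simpa using hcpos k
  have hre2 : ∀ k, 0 < (c k + Complex.I * t : ℂ).re := fun k => by simpa using hcpos k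
  have hint : ∀ k, IntegrableOn (F k) (Ioi 0) := fun k => by
    rw [hFe]
    exact (integrableOn_exp_neg_mul (hre1 k)).sub (integrableOn_exp_neg_mul (hre2 k))
  have hval : ∀ k, ∫ y in Ioi 0, F k y = (c k - Complex.I * t : ℂ)⁻¹ - (c k + Complex.I * t : ℂ)⁻¹ :=
    fun k => by
    rw [hFe, integral_sub (integrableOn_exp_neg_mul (hre1 k)) (integrableOn_exp_neg_mul (hre2 k)),
      integral_exp_neg_mul (hre1 k), integral_exp_neg_mul (hre2 k)]
  have hnorm : ∀ k, ∫ y in Ioi 0, ‖F k y‖ ≤ 2 * t / (c k) ^ 2 := fun k => by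
    have h1 : ∫ y : ℝ in Ioi 0, y * Real.exp (-(c k * y)) = 1 / (c k) ^ 2 := by
      have := Real.integral_rpow_mul_exp_neg_mul_Ioi (a := 2) (r := c k) two_pos (hcpos k)
      rw [Real.Gamma_two] at this
      norm_num at this
      simpa using this
    have h2 : IntegrableOn (fun y : ℝ => y * Real.exp (-(c k * y))) (Ioi 0) := by
      simpa using integrableOn_rpow_mul_exp_neg (σ := 1) (by norm_num) (hcpos k)
    calc ∫ y in Ioi 0, ‖F k y‖ ≤ ∫ y : ℝ in Ioi 0, 2 * t * (y * Real.exp (-(c k * y))) := by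
          refine setIntegral_mono_on (hint k).norm (h2.const_mul _) measurableSet_Ioi fun y hy => ?_
          have hy' : 0 < y := hy
          rw [hF]
          simp only [norm_mul, Complex.norm_real, Real.norm_eq_abs, Real.abs_exp]
          rw [← mul_assoc]
          gcongr
          refine (norm_exp_sub_exp_le _).trans (le_of_eq ?_)
          rw [abs_of_pos (by positivity)]; ring
      _ = _ := by rw [integral_const_mul, h1]; ring
  have hsum : Summable fun k => ∫ y in Ioi 0, ‖F k y‖ := by
    refine Summable.of_nonneg_of_le (fun k => integral_nonneg fun _ => norm_nonneg _) hnorm ?_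
    have := ((summable_nat_add_iff 1).mpr (Real.summable_one_div_nat_pow.mpr one_lt_two)).mul_left
      (2 * t / (2 * Real.pi) ^ 2)
    refine this.congr fun k => ?_
    simp only [hc]; push_cast
    field_simp
  have key := hasSum_integral_of_summable_integral_norm hint hsum
  have hB : ∫ y : ℝ in Ioi 0, ∑' k, F k y = ∫ y : ℝ in Ioi 0, f y * boseWeight y := by
    refine setIntegral_congr_fun measurableSet_Ioi fun y hy => ?_
    have h := (Complex.hasSum_ofReal.mpr (hasSum_boseWeight hy)).mul_left (f y)
    exact h.tsum_eq
  rw [hB] at key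
  simp_rw [hval] at key
  have hx : (Complex.I * t / (2 * Real.pi) : ℂ) ∈ Complex.integerComplement := by
    rintro ⟨n, hn⟩
    have := congrArg Complex.im hn
    have h2 : (Complex.I * t / (2 * Real.pi) : ℂ) = Complex.I * (t / (2 * Real.pi) : ℝ) := by
      push_cast; ring
    rw [h2, Complex.I_mul_im, Complex.ofReal_re, Complex.intCast_im] at this
    exact (by positivity : t / (2 * Real.pi) ≠ 0) this.symm
  have hcot := cot_series_rep' hx
  have hpi : (Real.pi : ℂ) ≠ 0 := Complex.ofReal_ne_zero.mpr Real.pi_ne_zero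
  have ht0 : (t : ℂ) ≠ 0 := Complex.ofReal_ne_zero.mpr ht.ne'
  have hS : ∑' n : ℕ, (1 / (Complex.I * t / (2 * Real.pi) - (n + 1) : ℂ)
      + 1 / (Complex.I * t / (2 * Real.pi) + (n + 1) : ℂ))
      = -(2 * Real.pi) * ∫ y : ℝ in Ioi 0, f y * boseWeight y := by
    rw [← key.tsum_eq, ← tsum_mul_left]
    refine tsum_congr fun k => ?_
    have h1 : (c k - Complex.I * t : ℂ) ≠ 0 := fun h => by
      have := hre1 k; rw [h] at this; simp at this
    have h2 : (c k + Complex.I * t : ℂ) ≠ 0 := fun h => by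
      have := hre2 k; rw [h] at this; simp at this
    have e1 : (Complex.I * t / (2 * Real.pi) - (k + 1) : ℂ) = -(c k - Complex.I * t) / (2 * Real.pi) := by
      simp only [hc]; push_cast; field_simp; ring
    have e2 : (Complex.I * t / (2 * Real.pi) + (k + 1) : ℂ) = (c k + Complex.I * t) / (2 * Real.pi) := by
      simp only [hc]; push_cast; field_simp; ring
    rw [e1, e2]
    field_simp
    ring
  rw [hS, Complex.cot_pi_eq_exp_ratio] at hcot
  have he : 2 * Real.pi * Complex.I * (Complex.I * t / (2 * Real.pi)) = (-t : ℂ) := by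
    field_simp
    rw [Complex.I_sq]
  rw [he] at hcot
  have hne : (1 - Complex.exp (-t) : ℂ) ≠ 0 := by
    have : Real.exp (-t) < 1 := Real.exp_lt_one_iff.mpr (by linarith)
    rw [sub_ne_zero]
    intro h
    have h' : ((Real.exp (-t) : ℝ) : ℂ) = 1 := by push_cast; exact h.symm
    have h'' : Real.exp (-t) = 1 := by exact_mod_cast h'
    linarith
  have hI : (∫ y : ℝ in Ioi 0, f y * boseWeight y) = -(2 * Real.pi : ℂ)⁻¹ *
      (Real.pi * ((Complex.exp (-t) + 1) / (Complex.I * (1 - Complex.exp (-t))))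
        - 1 / (Complex.I * t / (2 * Real.pi))) := by
    rw [hcot]; field_simp
  rw [hI]
  field_simp
  ring

/-- The integral term in Hermite's formula for the Hurwitz zeta function. -/
noncomputable def hermiteIntegral (s w : ℂ) : ℂ :=
  ∫ y : ℝ in Ioi 0, cpowDiff s w y * boseWeight y

/-- The Hurwitz zeta function `ζ_H(s, w)` for `1 ≤ Re w`, as given by Hermite's formula. -/
noncomputable def hurwitz (s w : ℂ) : ℂ :=
  w ^ (-s) / 2 + w ^ (1 - s) / (s - 1) + Complex.I * hermiteIntegral s w

lemma integrable_hermite_kernel {s w : ℂ} (hs : 1 < s.re) (hw : 1 ≤ w.re) :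
    Integrable (fun p : ℝ × ℝ => (p.1 : ℂ) ^ (s - 1) * Complex.exp (-(w * p.1)) *
      ((Complex.exp (Complex.I * (p.2 * p.1 : ℝ)) - Complex.exp (-(Complex.I * (p.2 * p.1 : ℝ))))
        * boseWeight p.2)) ((volume.restrict (Ioi 0)).prod (volume.restrict (Ioi 0))) := by
  have h1 : IntegrableOn (fun t : ℝ => 2 * (t ^ s.re * Real.exp (-(w.re * t)))) (Ioi 0) :=
    (integrableOn_rpow_mul_exp_neg (by linarith) (by linarith)).const_mul 2
  have h2 : IntegrableOn (fun y : ℝ => Real.exp (-y)) (Ioi 0) := integrableOn_exp_neg_Ioi 0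
  refine (Integrable.mul_prod h1 h2).mono' ?_ ?_
  · have := measurable_boseWeight
    apply Measurable.aestronglyMeasurable; fun_prop
  · rw [Measure.prod_restrict]
    refine (ae_restrict_mem (measurableSet_Ioi.prod measurableSet_Ioi)).mono ?_
    rintro ⟨t, y⟩ ⟨ht, hy⟩
    have ht' : 0 < t := ht
    have hy' : 0 < y := hy
    have e : t ^ s.re = t ^ (s.re - 1) * t := by
      rw [← Real.rpow_add_one ht'.ne']; ring_nf
    rw [norm_mul, norm_cpow_mul_exp ht', norm_mul, Complex.norm_real,
      Real.norm_of_nonneg (boseWeight_nonneg hy'), e]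
    calc _ ≤ t ^ (s.re - 1) * Real.exp (-(w.re * t)) * (2 * |y * t| * boseWeight y) := by
          gcongr
          · exact boseWeight_nonneg hy'
          · exact norm_exp_sub_exp_le _
      _ = 2 * (t ^ (s.re - 1) * t * Real.exp (-(w.re * t))) * (y * boseWeight y) := by
          rw [abs_of_pos (by positivity)]; ring
      _ ≤ _ := by
          gcongr
          refine (mul_boseWeight_le hy').trans (Real.exp_le_exp.mpr (by linarith))

lemma hasSum_cpow_neg_integral {s w : ℂ} (hs : 1 < s.re) (hw : 1 ≤ w.re) :
    HasSum (fun n : ℕ => ((n : ℂ) + w) ^ (-s) * Complex.Gamma s)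
      (∫ t : ℝ in Ioi 0, (t : ℂ) ^ (s - 1) * Complex.exp (-(w * t)) * (1 - Complex.exp (-t))⁻¹) := by
  have hre : ∀ n : ℕ, 0 < ((n : ℂ) + w).re := fun n => by
    have : (0 : ℝ) ≤ n := n.cast_nonneg
    simp; linarith
  have hs0 : 0 < s.re := by linarith
  have key := hasSum_integral_of_summable_integral_norm
    (fun n : ℕ => integrableOn_cpow_mul_exp hs0 (hre n)) ?_
  · simp_rw [fun n : ℕ => integral_cpow_mul_exp hs0 (hre n)] at key
    convert! key using 1
    refine setIntegral_congr_fun measurableSet_Ioi fun t ht => ?_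
    have ht' : 0 < t := ht
    have h1 : ‖Complex.exp (-(t : ℂ))‖ < 1 := by
      rw [Complex.norm_exp]; simpa using ht'
    have h2 := (hasSum_geometric_of_norm_lt_one h1).mul_left
      ((t : ℂ) ^ (s - 1) * Complex.exp (-(w * t)))
    rw [← h2.tsum_eq]
    refine tsum_congr fun n => ?_
    rw [← Complex.exp_nat_mul, mul_assoc, ← Complex.exp_add]
    ring_nf
  · have hval : ∀ n : ℕ, ∫ t : ℝ in Ioi 0, ‖(t : ℂ) ^ (s - 1) * Complex.exp (-(((n : ℂ) + w) * t))‖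
        = (1 / (n + w.re)) ^ s.re * Real.Gamma s.re := fun n => by
      have hn : 0 < (n : ℝ) + w.re := by simpa using hre n
      rw [← Real.integral_rpow_mul_exp_neg_mul_Ioi hs0 hn]
      refine setIntegral_congr_fun measurableSet_Ioi fun t ht => ?_
      simpa using norm_cpow_mul_exp (a := s) (r := (n : ℂ) + w) ht
    simp_rw [hval]
    refine Summable.mul_right _ (Summable.of_nonneg_of_le (fun n => by positivity) (fun n => ?_)
      ((summable_nat_add_iff 1).mpr (Real.summable_one_div_nat_rpow.mpr hs)))
    rw [Real.div_rpow (by norm_num) (by positivity), Real.one_rpow]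
    push_cast
    gcongr

/-- Hermite's formula. -/
theorem hasSum_hurwitz {s w : ℂ} (hs : 1 < s.re) (hw : 1 ≤ w.re) :
    HasSum (fun n : ℕ => ((n : ℂ) + w) ^ (-s)) (hurwitz s w) := by
  have hs0 : 0 < s.re := by linarith
  have hw0 : 0 < w.re := by linarith
  have hs1 : s - 1 ≠ 0 := fun h => by
    rw [sub_eq_zero.mp h] at hs; simp at hs
  have hΓ : Complex.Gamma s ≠ 0 := Complex.Gamma_ne_zero_of_re_pos hs0
  have hΓ' : Complex.Gamma s = (s - 1) * Complex.Gamma (s - 1) := by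
    rw [← Complex.Gamma_add_one _ hs1]; ring_nf
  have hK := integrable_hermite_kernel hs hw
  set K : ℝ → ℝ → ℂ := fun t y => (t : ℂ) ^ (s - 1) * Complex.exp (-(w * t)) *
      ((Complex.exp (Complex.I * (y * t : ℝ)) - Complex.exp (-(Complex.I * (y * t : ℝ))))
        * boseWeight y) with hKdef
  have hswap : ∫ t in Ioi 0, ∫ y in Ioi 0, K t y
      = -(Complex.Gamma s * hermiteIntegral s w) := by
    rw [integral_integral_swap hK, hermiteIntegral, ← integral_const_mul, ← integral_neg]
    refine setIntegral_congr_fun measurableSet_Ioi fun y _ => ?_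
    have r1 : 0 < (w - Complex.I * y).re := by simpa using hw0
    have r2 : 0 < (w + Complex.I * y).re := by simpa using hw0
    have e : ∀ t : ℝ, K t y = ((t : ℂ) ^ (s - 1) * Complex.exp (-((w - Complex.I * y) * t))
        - (t : ℂ) ^ (s - 1) * Complex.exp (-((w + Complex.I * y) * t))) * boseWeight y := fun t => by
      simp only [hKdef]
      rw [← mul_assoc, mul_assoc ((t : ℂ) ^ (s - 1)), mul_sub, ← Complex.exp_add,
        ← Complex.exp_add, mul_sub]
      push_cast
      ring_nf
    simp_rw [e]
    rw [integral_mul_const, integral_sub (integrableOn_cpow_mul_exp hs0 r1)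
      (integrableOn_cpow_mul_exp hs0 r2), integral_cpow_mul_exp hs0 r1,
      integral_cpow_mul_exp hs0 r2, cpowDiff]
    ring
  have hI1 := integrableOn_cpow_mul_exp hs0 hw0
  have hI2 := integrableOn_cpow_mul_exp (a := s - 1) (by simpa using hs) hw0
  have hI3 : IntegrableOn (fun t => ∫ y in Ioi 0, K t y) (Ioi 0) := hK.integral_prod_left
  have hmain : ∫ t : ℝ in Ioi 0, (t : ℂ) ^ (s - 1) * Complex.exp (-(w * t))
      * (1 - Complex.exp (-t))⁻¹ = hurwitz s w * Complex.Gamma s := by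
    calc _ = ∫ t : ℝ in Ioi 0, ((1 / 2 * ((t : ℂ) ^ (s - 1) * Complex.exp (-(w * t)))
          + (t : ℂ) ^ (s - 1 - 1) * Complex.exp (-(w * t)))
          - Complex.I * ∫ y in Ioi 0, K t y) := by
          refine setIntegral_congr_fun measurableSet_Ioi fun t ht => ?_
          have ht' : (t : ℂ) ≠ 0 := Complex.ofReal_ne_zero.mpr (ne_of_gt ht)
          simp only [hKdef]
          have e : (t : ℂ) ^ (s - 1 - 1) = (t : ℂ) ^ (s - 1) * (t : ℂ)⁻¹ := by
            rw [Complex.cpow_sub _ 1 ht', Complex.cpow_one, div_eq_mul_inv]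
          rw [legendre_formula ht, integral_const_mul, e]
          generalize integral (G := ℂ) (volume.restrict (Ioi (0 : ℝ))) _ = J
          ring
      _ = _ := by
          have h12 : IntegrableOn (fun t : ℝ => 1 / 2 * ((t : ℂ) ^ (s - 1) * Complex.exp (-(w * t)))
            + (t : ℂ) ^ (s - 1 - 1) * Complex.exp (-(w * t))) (Ioi 0) :=
              (hI1.const_mul _).add hI2
          rw [integral_sub h12 (hI3.const_mul _),
            integral_add (hI1.const_mul _) hI2, integral_const_mul, integral_const_mul, hswap,
            integral_cpow_mul_exp hs0 hw0, integral_cpow_mul_exp (by simpa using hs) hw0, hurwitz,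
            hΓ', show -(s - 1) = 1 - s by ring]
          field_simp
          ring
  have := (hasSum_cpow_neg_integral hs hw).div_const (Complex.Gamma s)
  rw [hmain, mul_div_cancel_right₀ _ hΓ] at this
  simpa [mul_div_cancel_right₀ _ hΓ] using this

lemma dominatedEntire_cpowDiff {w : ℂ} (hw : 1 ≤ w.re) {k : ℝ} (hk0 : 0 < k) (hk1 : k ≤ 1) :
    DominatedEntire (fun s y => cpowDiff s w (k * y) * boseWeight y) where
  differentiable y hy := by
    have h1 : w + Complex.I * (k * y : ℝ) ≠ 0 := fun h => by
      have := congrArg Complex.re h; simp at this; linarith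
    have h2 : w - Complex.I * (k * y : ℝ) ≠ 0 := fun h => by
      have := congrArg Complex.re h; simp at this; linarith
    refine Differentiable.mul_const ?_ _
    exact (differentiable_neg.const_cpow (Or.inl h1)).sub (differentiable_neg.const_cpow (Or.inl h2))
  measurable s := by
    have := measurable_boseWeight
    apply Measurable.aestronglyMeasurable
    unfold cpowDiff
    fun_prop
  bound S := by
    obtain ⟨C, hC0, hC⟩ := exists_norm_cpowDiff_le S
    refine ⟨C * Real.exp ‖w‖, fun s hs y hy => ?_⟩
    rw [norm_mul, Complex.norm_real, Real.norm_of_nonneg (boseWeight_nonneg hy)]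
    have hky : k * y ≤ y := mul_le_of_le_one_left hy.le hk1
    calc _ ≤ C * (k * y) * Real.exp (‖w‖ + k * y) * boseWeight y := by
          gcongr
          · exact boseWeight_nonneg hy
          · exact hC s hs w hw _ (by positivity)
      _ ≤ C * y * Real.exp (‖w‖ + y) * boseWeight y := by
          have := boseWeight_nonneg hy
          gcongr
      _ = C * Real.exp (‖w‖ + y) * (y * boseWeight y) := by ring
      _ ≤ C * Real.exp (‖w‖ + y) * Real.exp (-3 * y) := by gcongr; exact mul_boseWeight_le hy
      _ = C * Real.exp ‖w‖ * Real.exp (-2 * y) := by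
          rw [mul_assoc, mul_assoc, ← Real.exp_add, ← Real.exp_add]; ring_nf
      _ ≤ _ := by gcongr; linarith

lemma dominatedEntire_hermite {w : ℂ} (hw : 1 ≤ w.re) :
    DominatedEntire (fun s y => cpowDiff s w y * boseWeight y) := by
  simpa using dominatedEntire_cpowDiff hw one_pos le_rfl

lemma differentiable_hermiteIntegral {w : ℂ} (hw : 1 ≤ w.re) :
    Differentiable ℂ (fun s => hermiteIntegral s w) :=
  (dominatedEntire_hermite hw).differentiable_integral

lemma ne_zero_of_one_le_re {w : ℂ} (hw : 1 ≤ w.re) : w ≠ 0 := fun h => by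
  rw [h] at hw; norm_num at hw

lemma hurwitz_eq_add_div (s w : ℂ) :
    hurwitz s w = (w ^ (-s) / 2 + Complex.I * hermiteIntegral s w) + w ^ (1 - s) / (s - 1) := by
  rw [hurwitz]; ring

lemma differentiable_const_cpow_neg {w : ℂ} (hw : 1 ≤ w.re) : Differentiable ℂ (fun s : ℂ => w ^ (-s)) :=
  differentiable_neg.const_cpow (Or.inl (ne_zero_of_one_le_re hw))

lemma differentiable_hurwitz_regular {w : ℂ} (hw : 1 ≤ w.re) :
    Differentiable ℂ (fun s => w ^ (-s) / 2 + Complex.I * hermiteIntegral s w) :=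
  ((differentiable_const_cpow_neg hw).div_const 2).add
    ((differentiable_hermiteIntegral hw).const_mul _)

lemma differentiable_const_cpow_one_sub {w : ℂ} (hw : 1 ≤ w.re) :
    Differentiable ℂ (fun s : ℂ => w ^ (1 - s)) :=
  (differentiable_fun_id.const_sub 1).const_cpow (Or.inl (ne_zero_of_one_le_re hw))

lemma differentiableAt_hurwitz {w : ℂ} (hw : 1 ≤ w.re) {s : ℂ} (hs : s ≠ 1) :
    DifferentiableAt ℂ (fun s => hurwitz s w) s := by
  simp_rw [hurwitz_eq_add_div]
  exact (differentiable_hurwitz_regular hw s).add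
    ((differentiable_const_cpow_one_sub hw s).div (by fun_prop) (sub_ne_zero.mpr hs))

lemma meromorphicAt_hurwitz {w : ℂ} (hw : 1 ≤ w.re) (s : ℂ) :
    MeromorphicAt (fun s => hurwitz s w) s := by
  simp_rw [hurwitz_eq_add_div]
  exact ((differentiable_hurwitz_regular hw).analyticAt s).meromorphicAt.add
    (((differentiable_const_cpow_one_sub hw).analyticAt s).meromorphicAt.div
      ((differentiable_id.sub_const 1).analyticAt s).meromorphicAt)

lemma eq_of_eq_of_one_lt_re {f g : ℂ → ℂ} (hf : ∀ s, s ≠ 1 → DifferentiableAt ℂ f s)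
    (hg : ∀ s, s ≠ 1 → DifferentiableAt ℂ g s) (h : ∀ s : ℂ, 1 < s.re → f s = g s)
    {s : ℂ} (hs : s ≠ 1) : f s = g s := by
  have hU : IsOpen ({1}ᶜ : Set ℂ) := isOpen_compl_singleton
  have hc : IsPreconnected ({1}ᶜ : Set ℂ) := by
    exact (isConnected_compl_singleton_of_one_lt_rank (by simp) 1).isPreconnected
  have h2 : (2 : ℂ) ∈ ({1}ᶜ : Set ℂ) := by norm_num
  refine AnalyticOnNhd.eqOn_of_preconnected_of_eventuallyEq (f := f) (g := g)
    (DifferentiableOn.analyticOnNhd (fun s hs => (hf s hs).differentiableWithinAt) hU)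
    (DifferentiableOn.analyticOnNhd (fun s hs => (hg s hs).differentiableWithinAt) hU)
    hc h2 ?_ hs
  filter_upwards [(isOpen_lt continuous_const Complex.continuous_re).mem_nhds
    (show (1 : ℝ) < (2 : ℂ).re by norm_num)] with s hs using h s hs

lemma hurwitz_one {s : ℂ} (hs : s ≠ 1) : hurwitz s 1 = riemannZeta s := by
  refine eq_of_eq_of_one_lt_re (f := fun s => hurwitz s 1)
    (fun s hs => differentiableAt_hurwitz (by simp) hs)
    (fun s hs => differentiableAt_riemannZeta hs) (fun s hs => ?_) hs
  rw [zeta_eq_tsum_one_div_nat_add_one_cpow hs, ← (hasSum_hurwitz hs (by simp)).tsum_eq]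
  exact tsum_congr fun n => by rw [Complex.cpow_neg, one_div]

lemma hurwitz_add_one {s w : ℂ} (hw : 1 ≤ w.re) (hs : s ≠ 1) :
    hurwitz s w = w ^ (-s) + hurwitz s (w + 1) := by
  have hw' : 1 ≤ (w + 1).re := by simp; linarith
  refine eq_of_eq_of_one_lt_re (f := fun s => hurwitz s w)
    (g := fun s => w ^ (-s) + hurwitz s (w + 1))
    (fun s hs => differentiableAt_hurwitz hw hs)
    (fun s hs => (differentiable_const_cpow_neg hw s).add (differentiableAt_hurwitz hw' hs))
    (fun s hs => ?_) hs
  have h1 := hasSum_hurwitz hs hw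
  have h2 := hasSum_hurwitz hs hw'
  rw [← h1.tsum_eq, ← h2.tsum_eq, h1.summable.tsum_eq_zero_add]
  simp [add_comm, add_left_comm]

lemma hurwitz_zero (w : ℂ) : hurwitz 0 w = 1 / 2 - w := by
  have h1 (y : ℝ) : cpowDiff 0 w y = 0 := by simp [cpowDiff]
  simp [hurwitz, hermiteIntegral, h1]
  ring

lemma hurwitz_neg_one_aux (w : ℂ) :
    hurwitz (-1) w = w / 2 - w ^ 2 / 2 - 2 * ∫ y : ℝ in Ioi 0, (y : ℂ) * boseWeight y := by
  have h1 (y : ℝ) : cpowDiff (-1) w y * boseWeight y = 2 * Complex.I * (y * boseWeight y) := by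
    simp [cpowDiff]; ring
  have h2 : (w : ℂ) ^ (1 - -1 : ℂ) = w ^ 2 := by
    rw [← Complex.cpow_natCast]; norm_num
  rw [hurwitz, hermiteIntegral, h2]
  simp_rw [h1]
  rw [integral_const_mul]
  norm_num
  linear_combination 2 * (∫ y : ℝ in Ioi 0, (y : ℂ) * boseWeight y) * Complex.I_mul_I

lemma integral_mul_boseWeight : ∫ y : ℝ in Ioi 0, (y : ℂ) * boseWeight y = 1 / 24 := by
  have h1 := hurwitz_neg_one_aux 1
  have h2 := riemannZeta_neg_nat_eq_bernoulli 1
  rw [hurwitz_one (by norm_num)] at h1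
  have h3 : bernoulli (1 + 1) = 1 / 6 := by
    rw [bernoulli_eq_bernoulli'_of_ne_one (by norm_num)]; simp
  rw [h3] at h2
  norm_num at h2
  rw [h2] at h1
  linear_combination (1 / 2) * h1

lemma hurwitz_neg_one (w : ℂ) : hurwitz (-1) w = w / 2 - w ^ 2 / 2 - 1 / 12 := by
  rw [hurwitz_neg_one_aux, integral_mul_boseWeight]; ring

/-- The `s`-derivative of the Hurwitz zeta function at `0`, equal to `log Γ(w) - log (2π) / 2`. -/
noncomputable def hurwitzDerivZero (w : ℂ) : ℂ :=
  (w - 1 / 2) * Complex.log w - w + Complex.I * ∫ y : ℝ in Ioi 0,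
    (Complex.log (w - Complex.I * y) - Complex.log (w + Complex.I * y)) * boseWeight y

lemma hasDerivAt_const_cpow_neg {w : ℂ} (hw : w ≠ 0) (s : ℂ) :
    HasDerivAt (fun s => w ^ (-s)) (-Complex.log w * w ^ (-s)) s := by
  refine ((hasDerivAt_neg s).const_cpow (Or.inl hw)).congr_deriv ?_
  ring

lemma hasDerivAt_cpowDiff_zero {w : ℂ} (hw : 1 ≤ w.re) (y : ℝ) :
    HasDerivAt (fun s => cpowDiff s w y)
      (Complex.log (w - Complex.I * y) - Complex.log (w + Complex.I * y)) 0 := by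
  have h1 : w + Complex.I * y ≠ 0 := ne_zero_of_one_le_re (by simpa using hw)
  have h2 : w - Complex.I * y ≠ 0 := ne_zero_of_one_le_re (by simpa using hw)
  refine ((hasDerivAt_const_cpow_neg h1 0).sub (hasDerivAt_const_cpow_neg h2 0)).congr_deriv ?_
  simp; ring

lemma hasDerivAt_hurwitz_zero {w : ℂ} (hw : 1 ≤ w.re) :
    HasDerivAt (fun s => hurwitz s w) (hurwitzDerivZero w) 0 := by
  have hw0 := ne_zero_of_one_le_re hw
  have h1 := (hasDerivAt_const_cpow_neg hw0 0).div_const 2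
  have h2 : HasDerivAt (fun s : ℂ => w ^ (1 - s)) (-(w * Complex.log w)) 0 := by
    refine (((hasDerivAt_id' (0 : ℂ)).const_sub 1).const_cpow (Or.inl hw0)).congr_deriv ?_
    simp
  have h3 : HasDerivAt (fun s : ℂ => s - 1) 1 0 := (hasDerivAt_id (0 : ℂ)).sub_const 1
  have h4 := ((dominatedEntire_hermite hw).hasDerivAt_integral 0).2.const_mul Complex.I
  refine ((h1.add (h2.div h3 (by norm_num))).add h4).congr_deriv ?_
  rw [hurwitzDerivZero]
  have : ∀ y : ℝ, deriv (fun s => cpowDiff s w y * (boseWeight y : ℂ)) 0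
      = (Complex.log (w - Complex.I * y) - Complex.log (w + Complex.I * y)) * boseWeight y :=
    fun y => ((hasDerivAt_cpowDiff_zero hw y).mul_const _).deriv
  simp_rw [this]
  simp
  ring

lemma hurwitzDerivZero_add_one {w : ℂ} (hw : 1 ≤ w.re) :
    hurwitzDerivZero (w + 1) = hurwitzDerivZero w + Complex.log w := by
  have hw' : 1 ≤ (w + 1).re := by simp; linarith
  have h1 := hasDerivAt_hurwitz_zero hw
  have h2 := (hasDerivAt_const_cpow_neg (ne_zero_of_one_le_re hw) 0).add (hasDerivAt_hurwitz_zero hw')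
  have h3 : (fun s => hurwitz s w) =ᶠ[𝓝 0] (fun s => w ^ (-s) + hurwitz s (w + 1)) := by
    filter_upwards [isOpen_compl_singleton.mem_nhds (show (0 : ℂ) ∈ ({1}ᶜ : Set ℂ) by simp)]
      with s hs using hurwitz_add_one hw hs
  have h4 := h1.unique (h2.congr_of_eventuallyEq h3)
  rw [h4]; simp

/-- The integral in Binet's second formula. -/
noncomputable def binetIntegral (w : ℂ) : ℂ := ∫ y : ℝ in Ioi 0,
    (Complex.log (w - Complex.I * y) - Complex.log (w + Complex.I * y)) * boseWeight y

lemma hurwitzDerivZero_eq (w : ℂ) : hurwitzDerivZero w =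
    (w - 1 / 2) * Complex.log w - w + Complex.I * binetIntegral w := rfl

lemma norm_log_sub_log_le {w : ℂ} {c y : ℝ} (hc : 0 < c) (hw : c ≤ w.re) (hy : 0 < y) :
    ‖(Complex.log (w - Complex.I * y) - Complex.log (w + Complex.I * y)) * boseWeight y‖
      ≤ 2 / c * Real.exp (-y) := by
  have h := norm_vertical_sub_le (F := Complex.log) (M := 1 / c) hw hy.le
    (fun z hz => Complex.hasDerivAt_log (Or.inl (by linarith))) fun z hz _ => by
      rw [norm_inv, one_div]
      exact inv_anti₀ hc (hz.trans (Complex.re_le_norm z))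
  rw [norm_mul, Complex.norm_real, Real.norm_of_nonneg (boseWeight_nonneg hy), norm_sub_rev]
  calc _ ≤ 2 * y * (1 / c) * boseWeight y := by gcongr; exact boseWeight_nonneg hy
    _ = 2 / c * (y * boseWeight y) := by ring
    _ ≤ 2 / c * Real.exp (-3 * y) := by gcongr; exact mul_boseWeight_le hy
    _ ≤ _ := by gcongr; linarith

lemma measurable_binet (w : ℂ) : Measurable fun y : ℝ =>
    (Complex.log (w - Complex.I * y) - Complex.log (w + Complex.I * y)) * boseWeight y := by
  have := measurable_boseWeight
  fun_prop

lemma integral_exp_neg_Ioi_zero' : ∫ y : ℝ in Ioi 0, Real.exp (-y) = 1 := by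
  simpa using integral_exp_neg_Ioi 0

lemma norm_binetIntegral_le {w : ℂ} {c : ℝ} (hc : 0 < c) (hw : c ≤ w.re) :
    ‖binetIntegral w‖ ≤ 2 / c := by
  refine (norm_integral_le_of_norm_le ((integrableOn_exp_neg_Ioi 0).const_mul (2 / c)) ?_).trans
    (le_of_eq ?_)
  · exact (ae_restrict_mem measurableSet_Ioi).mono fun y hy => norm_log_sub_log_le hc hw hy
  · rw [integral_const_mul, integral_exp_neg_Ioi_zero', mul_one]

lemma continuousOn_hurwitzDerivZero : ContinuousOn hurwitzDerivZero {w | 1 ≤ w.re} := by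
  have hsl : ∀ w ∈ {w : ℂ | 1 ≤ w.re}, w ∈ Complex.slitPlane := fun w hw => Or.inl (by
    have : 1 ≤ w.re := hw
    linarith)
  have hb : ContinuousOn binetIntegral {w | 1 ≤ w.re} := by
    refine continuousOn_of_dominated (bound := fun y => 2 / 1 * Real.exp (-y))
      (fun w _ => (measurable_binet w).aestronglyMeasurable)
      (fun w hw => (ae_restrict_mem measurableSet_Ioi).mono fun y hy =>
        norm_log_sub_log_le one_pos hw hy) ((integrableOn_exp_neg_Ioi 0).const_mul _)
      (Eventually.of_forall fun y => ?_)
    refine ContinuousOn.mul (ContinuousOn.sub ?_ ?_) continuousOn_const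
    · exact ContinuousOn.clog (by fun_prop) fun w hw => hsl _ (by simpa using hw)
    · exact ContinuousOn.clog (by fun_prop) fun w hw => hsl _ (by simpa using hw)
  have hl : ContinuousOn Complex.log {w | 1 ≤ w.re} := continuousOn_id.clog hsl
  have : hurwitzDerivZero = fun w => (w - 1 / 2) * Complex.log w - w + Complex.I * binetIntegral w :=
    rfl
  rw [this]
  fun_prop

lemma exp_hurwitzDerivZero_add_nat {w : ℂ} (hw : 1 ≤ w.re) (n : ℕ) :
    Complex.exp (hurwitzDerivZero (w + n))
      = Complex.exp (hurwitzDerivZero w) * ∏ j ∈ Finset.range n, (w + j) := by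
  induction n with
  | zero => simp
  | succ n ih =>
    have h : 1 ≤ (w + n).re := by
      have : (0 : ℝ) ≤ n := n.cast_nonneg
      simp; linarith
    rw [Finset.prod_range_succ, ← mul_assoc, ← ih, Nat.cast_succ, ← add_assoc,
      hurwitzDerivZero_add_one h, Complex.exp_add, Complex.exp_log (ne_zero_of_one_le_re h)]

lemma tendsto_log_asymptotics (w : ℂ) :
    Tendsto (fun n : ℕ => (w + n + 1 / 2) * Complex.log (1 + (w + 1) / n)) atTop (𝓝 (w + 1)) := by
  have h0 : Tendsto (fun n : ℕ => (n : ℂ) * ((w + 1) / n)) atTop (𝓝 (w + 1)) := by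
    refine tendsto_const_nhds.congr' ?_
    filter_upwards [eventually_ne_atTop 0] with n hn
    have : (n : ℂ) ≠ 0 := by exact_mod_cast hn
    field_simp
  have h1 := Complex.tendsto_nat_mul_log_one_add_of_tendsto h0
  have h2 : Tendsto (fun n : ℕ => Complex.log (1 + (w + 1) / n)) atTop (𝓝 0) := by
    have : Tendsto (fun n : ℕ => 1 + (w + 1) / (n : ℂ)) atTop (𝓝 (1 + 0)) :=
      (tendsto_const_div_atTop_nhds_zero_nat _).const_add 1
    simpa using this.clog (by simp)
  have h3 := (h2.const_mul (w + 1 / 2)).add h1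
  rw [mul_zero, zero_add] at h3
  refine h3.congr fun n => by ring

lemma exp_hurwitzDerivZero {w : ℂ} (hw : 1 ≤ w.re) :
    Complex.exp (hurwitzDerivZero w) = Complex.Gamma w / Real.sqrt (2 * Real.pi) := by
  set E : ℕ → ℂ := fun n => (w + n + 1 / 2) * Complex.log (1 + (w + 1) / n) - w - 1
    + Complex.I * binetIntegral (w + (n + 1 : ℕ)) with hE
  have hbin : Tendsto (fun n : ℕ => binetIntegral (w + (n + 1 : ℕ))) atTop (𝓝 0) := by
    refine squeeze_zero_norm (a := fun n : ℕ => 2 * (1 / ((n : ℝ) + 1))) (fun n => ?_) ?_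
    · have := norm_binetIntegral_le (w := w + (n + 1 : ℕ)) (c := n + 1) (by positivity)
        (by simp; linarith)
      refine this.trans (le_of_eq (by ring))
    · simpa using (tendsto_one_div_add_atTop_nhds_zero_nat (𝕜 := ℝ)).const_mul 2
  have hElim : Tendsto E atTop (𝓝 0) := by
    have := (((tendsto_log_asymptotics w).sub_const w).sub_const 1).add
      (hbin.const_mul Complex.I)
    rwa [mul_zero, add_zero, add_sub_cancel_left, sub_self] at this
  have hst : Tendsto (fun n : ℕ => ((Real.sqrt 2 * Stirling.stirlingSeq n : ℝ) : ℂ)) atTop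
      (𝓝 ((Real.sqrt (2 * Real.pi) : ℝ) : ℂ)) := by
    rw [Real.sqrt_mul (by norm_num)]
    exact (Complex.continuous_ofReal.tendsto _).comp
      (Stirling.tendsto_stirlingSeq_sqrt_pi.const_mul _)
  have hπ : ((Real.sqrt (2 * Real.pi) : ℝ) : ℂ) ≠ 0 :=
    Complex.ofReal_ne_zero.mpr (by positivity)
  have hlim := (Complex.GammaSeq_tendsto_Gamma w).mul
    (((Complex.continuous_exp.tendsto 0).comp hElim).div hst hπ)
  rw [Complex.exp_zero, mul_one_div] at hlim
  refine tendsto_nhds_unique (tendsto_const_nhds.congr' ?_) hlim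
  filter_upwards [eventually_gt_atTop 0] with n hn
  have hnR : (0 : ℝ) < n := by exact_mod_cast hn
  have hnC : (n : ℂ) ≠ 0 := by exact_mod_cast hn.ne'
  have hprod : ∏ j ∈ Finset.range (n + 1), (w + j) ≠ 0 := Finset.prod_ne_zero_iff.mpr fun j _ =>
    ne_zero_of_one_le_re (by
      have : (0 : ℝ) ≤ j := j.cast_nonneg
      simp; linarith)
  have hw1 : 1 + (w + 1) / n ≠ 0 := fun h => by
    have h' : w + n + 1 = 0 := by field_simp at h; linear_combination h
    have := congrArg Complex.re h'
    simp at this; linarith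
  have hlog : Complex.log (w + (n + 1 : ℕ)) = Real.log n + Complex.log (1 + (w + 1) / n) := by
    rw [← Complex.log_ofReal_mul hnR hw1]
    congr 1
    push_cast
    field_simp
    ring
  have hfact : ((n.factorial : ℝ) : ℂ) = ((Real.sqrt 2 * Stirling.stirlingSeq n : ℝ) : ℂ)
      * Complex.exp ((n + 1 / 2) * Real.log n - n) := by
    have : (n.factorial : ℝ) = Real.sqrt 2 * Stirling.stirlingSeq n
        * Real.exp ((n + 1 / 2) * Real.log n - n) := by
      rw [Stirling.stirlingSeq]
      have e1 : Real.exp ((n + 1 / 2) * Real.log n - n)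
          = Real.sqrt n * (n / Real.exp 1) ^ n := by
        rw [div_pow, ← Real.exp_nat_mul, mul_one, Real.exp_sub, add_mul, Real.exp_add,
          Real.exp_nat_mul, Real.exp_log hnR, Real.sqrt_eq_rpow, Real.rpow_def_of_pos hnR]
        ring_nf
      rw [e1, Real.sqrt_mul (by norm_num)]
      have := Real.exp_pos 1
      field_simp
    rw [this]; push_cast; rfl
  have hS : ((Real.sqrt 2 * Stirling.stirlingSeq n : ℝ) : ℂ) ≠ 0 := fun h => by
    rw [h, zero_mul] at hfact
    exact n.factorial_ne_zero (by exact_mod_cast hfact)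
  have key := exp_hurwitzDerivZero_add_nat hw (n + 1)
  have hG : hurwitzDerivZero (w + (n + 1 : ℕ))
      = E n + w * Real.log n + ((n + 1 / 2) * Real.log n - n) := by
    rw [hurwitzDerivZero_eq, hlog, hE]
    push_cast
    ring
  rw [hG, Complex.exp_add, Complex.exp_add] at key
  have hcp : (n : ℂ) ^ w = Complex.exp (w * Real.log n) := by
    rw [Complex.cpow_def_of_ne_zero hnC, mul_comm]; simp
  simp only [Pi.div_apply, Function.comp_apply, Complex.GammaSeq, hcp]
  have hfact' : (n.factorial : ℂ) = ((Real.sqrt 2 * Stirling.stirlingSeq n : ℝ) : ℂ)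
      * Complex.exp ((n + 1 / 2) * Real.log n - n) := by rw [← hfact]; simp
  rw [hfact', eq_div_of_mul_eq hprod key.symm]
  field_simp

lemma hurwitzDerivZero_one_im : (hurwitzDerivZero 1).im = 0 := by
  have : ∀ y : ℝ, 0 < y → (Complex.log (1 - Complex.I * y) - Complex.log (1 + Complex.I * y))
      = ((-2 * Complex.arg (1 + Complex.I * y) : ℝ) : ℂ) * Complex.I := fun y hy => by
    have h1 : (1 - Complex.I * y : ℂ) = starRingEnd ℂ (1 + Complex.I * y) := by
      simp [sub_eq_add_neg]
    have h2 : Complex.arg (1 + Complex.I * y) ≠ Real.pi := fun h => by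
      rw [Complex.arg_eq_pi_iff] at h
      simp at h
      linarith [h.1]
    rw [h1, Complex.log_conj _ h2]
    apply Complex.ext <;> simp [Complex.log_re, Complex.log_im]
    ring
  have h2 : binetIntegral 1
      = ((∫ y : ℝ in Ioi 0, -2 * Complex.arg (1 + Complex.I * y) * boseWeight y : ℝ) : ℂ)
        * Complex.I := by
    rw [binetIntegral, ← integral_complex_ofReal, ← integral_mul_const]
    refine setIntegral_congr_fun measurableSet_Ioi fun y hy => ?_
    rw [this y hy]
    push_cast
    ring
  rw [hurwitzDerivZero_eq, h2]
  simp

/-- Lerch's formula. -/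
theorem hurwitzDerivZero_eq_logGamma {LG : ℂ → ℂ} (hLG_an : AnalyticOnNhd ℂ LG {w : ℂ | 0 < w.re})
    (hLG_exp : ∀ w : ℂ, 0 < w.re → Complex.exp (LG w) = Complex.Gamma w)
    (hLG_one : LG 1 = 0) {w : ℂ} (hw : 1 ≤ w.re) :
    hurwitzDerivZero w = LG w - Real.log (2 * Real.pi) / 2 := by
  set h : ℂ → ℂ := fun w => hurwitzDerivZero w - (LG w - Real.log (2 * Real.pi) / 2) with hh
  have hcont : ContinuousOn h {w | 1 ≤ w.re} := by
    refine continuousOn_hurwitzDerivZero.sub (ContinuousOn.sub ?_ continuousOn_const)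
    refine hLG_an.continuousOn.mono fun w hw => ?_
    have : 1 ≤ w.re := hw
    show 0 < w.re
    linarith
  have hexp : ∀ w : ℂ, 1 ≤ w.re → Complex.exp (h w) = 1 := fun w hw => by
    have hw0 : 0 < w.re := by linarith
    have hsq : Complex.exp (Real.log (2 * Real.pi) / 2) = Real.sqrt (2 * Real.pi) := by
      rw [Real.sqrt_eq_rpow, Real.rpow_def_of_pos (by positivity)]
      push_cast; ring_nf
    rw [hh]
    simp only
    rw [Complex.exp_sub, Complex.exp_sub, exp_hurwitzDerivZero hw, hLG_exp w hw0, hsq]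
    have := Complex.Gamma_ne_zero_of_re_pos hw0
    refine div_self (div_ne_zero this (Complex.ofReal_ne_zero.mpr (by positivity)))
  have hint : ∀ w : ℂ, 1 ≤ w.re → ∃ n : ℤ, h w = n * (2 * Real.pi * Complex.I) := fun w hw =>
    Complex.exp_eq_one_iff.mp (hexp w hw)
  have hpre : IsPreconnected {w : ℂ | 1 ≤ w.re} := (convex_halfSpace_re_ge 1).isPreconnected
  have h1 : h 1 = 0 := by
    obtain ⟨n, hn⟩ := hint 1 (by simp)
    have him : (h 1).im = 0 := by
      rw [hh]
      simp only
      rw [hLG_one, Complex.sub_im, hurwitzDerivZero_one_im]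
      have : (0 - (Real.log (2 * Real.pi) : ℂ) / 2) = ((- Real.log (2 * Real.pi) / 2 : ℝ) : ℂ) := by
        push_cast; ring
      rw [this]; simp
    rw [hn] at him ⊢
    simp [Real.pi_ne_zero] at him
    simp [him]
  have hconst : (h w / (2 * Real.pi * Complex.I)).re = (h 1 / (2 * Real.pi * Complex.I)).re := by
    refine hpre.constant_of_mapsTo (f := fun w => (h w / (2 * Real.pi * Complex.I)).re)
      Int.isClosedEmbedding_coe_real.isEmbedding.isDiscrete_range
      (Complex.continuous_re.comp_continuousOn (hcont.div_const _)) (fun w hw => ?_) hw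
      (show 1 ≤ (1 : ℂ).re by simp)
    obtain ⟨n, hn⟩ := hint w hw
    exact ⟨n, by simp [hn]⟩
  obtain ⟨n, hn⟩ := hint w hw
  rw [h1, hn, mul_div_cancel_right₀ _ Complex.two_pi_I_ne_zero] at hconst
  simp at hconst
  rw [hconst] at hn
  simp only [Int.cast_zero, zero_mul] at hn
  exact sub_eq_zero.mp hn

/-- The integral over `y` of the difference of `ζ_H(s, ·)` at `w ± i k y`, weighted by
`1 / (e^{2πy} - 1)`. -/
noncomputable def hurwitzDiffIntegral (k : ℝ) (s w : ℂ) : ℂ :=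
  ∫ y : ℝ in Ioi 0, (hurwitz s (w + Complex.I * (k * y : ℝ)) - hurwitz s (w - Complex.I * (k * y : ℝ)))
    * boseWeight y

/-- The double zeta function `∑_{m, n ≥ 0} (n + a (m + w))^{-s}`, continued by applying Hermite's
formula in both variables. -/
noncomputable def doubleZeta (a : ℝ) (w s : ℂ) : ℂ :=
  (a : ℂ) ^ (-s) / 2 * hurwitz s w + (a : ℂ) ^ (1 - s) / (s - 1) * hurwitz (s - 1) w
    + Complex.I * (a : ℂ) ^ (-s) * hurwitzDiffIntegral a⁻¹ s w

lemma hurwitz_vertical_sub (s w : ℂ) (v : ℝ) :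
    hurwitz s (w + Complex.I * v) - hurwitz s (w - Complex.I * v)
      = cpowDiff s w v / 2 + cpowDiff (s - 1) w v / (s - 1)
        + Complex.I * (hermiteIntegral s (w + Complex.I * v)
          - hermiteIntegral s (w - Complex.I * v)) := by
  simp only [hurwitz, cpowDiff, show -(s - 1) = 1 - s by ring]
  ring

lemma measurable_hermiteIntegral (s : ℂ) : Measurable (hermiteIntegral s) := by
  have := measurable_boseWeight
  have h : Measurable (fun p : ℂ × ℝ => cpowDiff s p.1 p.2 * boseWeight p.2) := by
    unfold cpowDiff; fun_prop
  exact (h.stronglyMeasurable.integral_prod_right (ν := volume.restrict (Ioi 0))).measurable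

lemma dominatedEntire_hermiteIntegral_sub {w : ℂ} (hw : 1 ≤ w.re) {k : ℝ} (hk0 : 0 < k)
    (hk1 : k ≤ 1) :
    DominatedEntire (fun s y => (hermiteIntegral s (w + Complex.I * (k * y : ℝ))
      - hermiteIntegral s (w - Complex.I * (k * y : ℝ))) * boseWeight y) where
  differentiable y _ := ((differentiable_hermiteIntegral (by simpa using hw)).sub
    (differentiable_hermiteIntegral (by simpa using hw))).mul_const _
  measurable s := by
    have := measurable_boseWeight
    have := measurable_hermiteIntegral s
    apply Measurable.aestronglyMeasurable
    fun_prop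
  bound S := by
    obtain ⟨C, hC0, hC⟩ := exists_norm_cpowDiff_vertical_le S
    have hdiff : ∀ s, ‖s‖ ≤ S → ∀ v : ℝ, 0 ≤ v → ‖hermiteIntegral s (w + Complex.I * v)
        - hermiteIntegral s (w - Complex.I * v)‖ ≤ C * v * Real.exp (‖w‖ + v) := by
      intro s hs v hv
      rw [hermiteIntegral, hermiteIntegral, ← integral_sub
        ((dominatedEntire_hermite (by simpa using hw)).integrableOn s)
        ((dominatedEntire_hermite (by simpa using hw)).integrableOn s)]
      refine (norm_integral_le_of_norm_le
        ((integrableOn_exp_neg_Ioi 0).const_mul (C * v * Real.exp (‖w‖ + v))) ?_).trans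
        (le_of_eq ?_)
      · refine (ae_restrict_mem measurableSet_Ioi).mono fun y hy => ?_
        have hy' : 0 < y := hy
        rw [← sub_mul, norm_mul, Complex.norm_real, Real.norm_of_nonneg (boseWeight_nonneg hy')]
        calc _ ≤ C * v * y * Real.exp (‖w‖ + v + y) * boseWeight y := by
              gcongr
              · exact boseWeight_nonneg hy'
              · exact hC s hs w hw v y hv hy'.le
          _ = C * v * Real.exp (‖w‖ + v + y) * (y * boseWeight y) := by ring
          _ ≤ C * v * Real.exp (‖w‖ + v + y) * Real.exp (-3 * y) := by
              gcongr; exact mul_boseWeight_le hy'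
          _ = C * v * Real.exp (‖w‖ + v) * Real.exp (-2 * y) := by
              rw [mul_assoc (C * v), mul_assoc (C * v), ← Real.exp_add, ← Real.exp_add]; ring_nf
          _ ≤ _ := by gcongr; linarith
      · rw [integral_const_mul, integral_exp_neg_Ioi_zero', mul_one]
    refine ⟨C * Real.exp ‖w‖, fun s hs y hy => ?_⟩
    rw [norm_mul, Complex.norm_real, Real.norm_of_nonneg (boseWeight_nonneg hy)]
    have hky : k * y ≤ y := mul_le_of_le_one_left hy.le hk1
    have hb := boseWeight_nonneg hy
    calc _ ≤ C * (k * y) * Real.exp (‖w‖ + k * y) * boseWeight y := by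
          gcongr
          exact hdiff s hs _ (by positivity)
      _ ≤ C * y * Real.exp (‖w‖ + y) * boseWeight y := by gcongr
      _ = C * Real.exp (‖w‖ + y) * (y * boseWeight y) := by ring
      _ ≤ C * Real.exp (‖w‖ + y) * Real.exp (-3 * y) := by gcongr; exact mul_boseWeight_le hy
      _ = C * Real.exp ‖w‖ * Real.exp (-2 * y) := by
          rw [mul_assoc, mul_assoc, ← Real.exp_add, ← Real.exp_add]; ring_nf
      _ ≤ _ := by gcongr; linarith

section

variable {w : ℂ} {k : ℝ}

lemma hurwitzDiffIntegral_eq (hw : 1 ≤ w.re) (hk0 : 0 < k) (hk1 : k ≤ 1) (s : ℂ) :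
    hurwitzDiffIntegral k s w = (∫ y : ℝ in Ioi 0, cpowDiff s w (k * y) * boseWeight y) / 2
      + Complex.I * (∫ y : ℝ in Ioi 0, (hermiteIntegral s (w + Complex.I * (k * y : ℝ))
        - hermiteIntegral s (w - Complex.I * (k * y : ℝ))) * boseWeight y)
      + (∫ y : ℝ in Ioi 0, cpowDiff (s - 1) w (k * y) * boseWeight y) / (s - 1) := by
  have h1 : IntegrableOn (fun y : ℝ => cpowDiff s w (k * y) * boseWeight y / 2) (Ioi 0) :=
    ((dominatedEntire_cpowDiff hw hk0 hk1).integrableOn s).div_const 2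
  have h2 : IntegrableOn (fun y : ℝ => Complex.I * ((hermiteIntegral s (w + Complex.I * (k * y : ℝ))
        - hermiteIntegral s (w - Complex.I * (k * y : ℝ))) * boseWeight y)) (Ioi 0) :=
    ((dominatedEntire_hermiteIntegral_sub hw hk0 hk1).integrableOn s).const_mul _
  have h3 : IntegrableOn (fun y : ℝ => cpowDiff (s - 1) w (k * y) * boseWeight y / (s - 1))
      (Ioi 0) := ((dominatedEntire_cpowDiff hw hk0 hk1).integrableOn (s - 1)).div_const _
  have h12 : IntegrableOn (fun y : ℝ => cpowDiff s w (k * y) * boseWeight y / 2 +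
      Complex.I * ((hermiteIntegral s (w + Complex.I * (k * y : ℝ))
        - hermiteIntegral s (w - Complex.I * (k * y : ℝ))) * boseWeight y)) (Ioi 0) := h1.add h2
  rw [← integral_div, ← integral_div, ← integral_const_mul, ← integral_add h1 h2,
    ← integral_add h12 h3, hurwitzDiffIntegral]
  refine integral_congr_ae (Eventually.of_forall fun y => ?_)
  simp only
  rw [hurwitz_vertical_sub]
  ring

lemma differentiable_hurwitzDiffIntegral_regular (hw : 1 ≤ w.re) (hk0 : 0 < k) (hk1 : k ≤ 1) :
    Differentiable ℂ (fun s => (∫ y : ℝ in Ioi 0, cpowDiff s w (k * y) * boseWeight y) / 2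
      + Complex.I * (∫ y : ℝ in Ioi 0, (hermiteIntegral s (w + Complex.I * (k * y : ℝ))
        - hermiteIntegral s (w - Complex.I * (k * y : ℝ))) * boseWeight y)) :=
  ((dominatedEntire_cpowDiff hw hk0 hk1).differentiable_integral.div_const 2).add
    ((dominatedEntire_hermiteIntegral_sub hw hk0 hk1).differentiable_integral.const_mul _)

lemma differentiable_cpowDiff_integral_sub_one (hw : 1 ≤ w.re) (hk0 : 0 < k) (hk1 : k ≤ 1) :
    Differentiable ℂ
      (fun s => ∫ y : ℝ in Ioi 0, cpowDiff (s - 1) w (k * y) * boseWeight y) :=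
  (dominatedEntire_cpowDiff hw hk0 hk1).differentiable_integral.comp
    (differentiable_id.sub_const 1)

lemma differentiableAt_hurwitzDiffIntegral (hw : 1 ≤ w.re) (hk0 : 0 < k) (hk1 : k ≤ 1) {s : ℂ}
    (hs : s ≠ 1) : DifferentiableAt ℂ (fun s => hurwitzDiffIntegral k s w) s := by
  simp_rw [hurwitzDiffIntegral_eq hw hk0 hk1]
  exact (differentiable_hurwitzDiffIntegral_regular hw hk0 hk1 s).add
    ((differentiable_cpowDiff_integral_sub_one hw hk0 hk1 s).div (by fun_prop) (sub_ne_zero.mpr hs))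

lemma meromorphicAt_hurwitzDiffIntegral (hw : 1 ≤ w.re) (hk0 : 0 < k) (hk1 : k ≤ 1) (s : ℂ) :
    MeromorphicAt (fun s => hurwitzDiffIntegral k s w) s := by
  simp_rw [hurwitzDiffIntegral_eq hw hk0 hk1]
  exact ((differentiable_hurwitzDiffIntegral_regular hw hk0 hk1).analyticAt s).meromorphicAt.add
    (((differentiable_cpowDiff_integral_sub_one hw hk0 hk1).analyticAt s).meromorphicAt.div
      ((differentiable_id.sub_const 1).analyticAt s).meromorphicAt)

lemma hurwitzDiffIntegral_zero : hurwitzDiffIntegral k 0 w = -(Complex.I * k / 12) := by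
  have h : ∀ y : ℝ, (hurwitz 0 (w + Complex.I * (k * y : ℝ)) - hurwitz 0 (w - Complex.I * (k * y : ℝ)))
      * boseWeight y = -(2 * Complex.I * k) * (y * boseWeight y) := fun y => by
    rw [hurwitz_zero, hurwitz_zero]; push_cast; ring
  rw [hurwitzDiffIntegral]
  simp_rw [h]
  rw [integral_const_mul, integral_mul_boseWeight]
  ring

lemma hasDerivAt_hurwitzDiffIntegral_zero (hw : 1 ≤ w.re) (hk0 : 0 < k) (hk1 : k ≤ 1) :
    IntegrableOn (fun y : ℝ => (hurwitzDerivZero (w + Complex.I * (k * y : ℝ))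
      - hurwitzDerivZero (w - Complex.I * (k * y : ℝ))) * boseWeight y) (Ioi 0) ∧
    HasDerivAt (fun s => hurwitzDiffIntegral k s w)
      (∫ y : ℝ in Ioi 0, (hurwitzDerivZero (w + Complex.I * (k * y : ℝ))
        - hurwitzDerivZero (w - Complex.I * (k * y : ℝ))) * boseWeight y) 0 := by
  have hp : ∀ v : ℝ, 1 ≤ (w + Complex.I * v).re := fun v => by simpa using hw
  have hm : ∀ v : ℝ, 1 ≤ (w - Complex.I * v).re := fun v => by simpa using hw
  have hne : ∀ s ∈ Metric.ball (0 : ℂ) (1 / 2), s ≠ 1 := fun s hs h => by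
    rw [h] at hs; norm_num at hs
  have hderiv : ∀ y : ℝ, deriv (fun s => (hurwitz s (w + Complex.I * (k * y : ℝ))
      - hurwitz s (w - Complex.I * (k * y : ℝ))) * boseWeight y) 0
      = (hurwitzDerivZero (w + Complex.I * (k * y : ℝ))
        - hurwitzDerivZero (w - Complex.I * (k * y : ℝ))) * boseWeight y := fun y =>
    (((hasDerivAt_hurwitz_zero (hp _)).sub (hasDerivAt_hurwitz_zero (hm _))).mul_const _).deriv
  obtain ⟨C1, hC1⟩ := (dominatedEntire_cpowDiff hw hk0 hk1).bound 2
  obtain ⟨C2, hC2⟩ := (dominatedEntire_hermiteIntegral_sub hw hk0 hk1).bound 2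
  have key := hasDerivAt_integral_of_norm_le (μ := volume.restrict (Ioi 0))
    (U := Metric.ball 0 (1 / 2)) (s := 0) Metric.isOpen_ball
    (Metric.mem_ball_self (by norm_num : (0 : ℝ) < 1 / 2))
    (F := fun s (y : ℝ) => (hurwitz s (w + Complex.I * (k * y : ℝ))
      - hurwitz s (w - Complex.I * (k * y : ℝ))) * boseWeight y)
    (b := fun y => (C1 / 2 + 2 * C1 + C2) * Real.exp (-y)) ?_ ?_ ?_
    ((integrableOn_exp_neg_Ioi 0).const_mul _)
  · simp_rw [hderiv] at key
    exact key
  · refine Eventually.of_forall fun y s hs => DifferentiableAt.differentiableWithinAt ?_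
    exact ((differentiableAt_hurwitz (hp _) (hne s hs)).sub
      (differentiableAt_hurwitz (hm _) (hne s hs))).mul_const _
  · intro s hs
    have := measurable_boseWeight
    have := measurable_hermiteIntegral s
    apply Measurable.aestronglyMeasurable
    unfold hurwitz
    fun_prop
  · refine (ae_restrict_mem measurableSet_Ioi).mono fun y hy s hs => ?_
    have hs' : ‖s‖ < 1 / 2 := by simpa using hs
    have hs2 : ‖s - 1‖ ≤ 2 := (norm_sub_le _ _).trans (by norm_num; linarith)
    have hs3 : 1 / 2 ≤ ‖s - 1‖ := by
      have := norm_sub_norm_le (1 : ℂ) s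
      rw [norm_sub_rev] at this
      norm_num at this
      linarith
    have e1 := hC1 s (by linarith) y hy
    have e2 := hC1 (s - 1) hs2 y hy
    have e3 := hC2 s (by linarith) y hy
    rw [hurwitz_vertical_sub, show ∀ A B C D : ℂ, (A / 2 + B / (s - 1) + Complex.I * C) * D
      = A * D / 2 + B * D / (s - 1) + Complex.I * (C * D) by intros; ring]
    refine (norm_add₃_le).trans ?_
    rw [norm_div, norm_div, norm_mul Complex.I, Complex.norm_I, one_mul]
    have e4 : ‖cpowDiff (s - 1) w (k * y) * boseWeight y‖ / ‖s - 1‖ ≤ C1 * Real.exp (-y) / (1 / 2) := by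
      gcongr
      exact (norm_nonneg _).trans e2
    have e5 : ‖(2 : ℂ)‖ = 2 := by simp
    rw [e5]
    linarith

end

section

variable {a : ℝ} {w : ℂ}

lemma hasDerivAt_doubleZeta_zero (ha : 1 ≤ a) (hw : 1 ≤ w.re) :
    HasDerivAt (doubleZeta a w)
      (-(Real.log a / 2 * (1 / 2 - w)) + hurwitzDerivZero w / 2
        + a * (Real.log a - 1) * (w / 2 - w ^ 2 / 2 - 1 / 12)
        - a * deriv (fun s => hurwitz s w) (-1) - Real.log a / (12 * a)
        + Complex.I * ∫ y : ℝ in Ioi 0, (hurwitzDerivZero (w + Complex.I * (a⁻¹ * y : ℝ))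
          - hurwitzDerivZero (w - Complex.I * (a⁻¹ * y : ℝ))) * boseWeight y) 0 := by
  have ha0 : 0 < a := by linarith
  have haC : (a : ℂ) ≠ 0 := Complex.ofReal_ne_zero.mpr ha0.ne'
  have h1 := hasDerivAt_const_cpow_neg haC 0
  have h2 : HasDerivAt (fun s : ℂ => (a : ℂ) ^ (1 - s)) (-(a * Complex.log a)) 0 := by
    refine (((hasDerivAt_id' (0 : ℂ)).const_sub 1).const_cpow (Or.inl haC)).congr_deriv ?_
    simp
  have h3 : HasDerivAt (fun s : ℂ => s - 1) 1 0 := (hasDerivAt_id (0 : ℂ)).sub_const 1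
  have h4 : HasDerivAt (fun s => hurwitz (s - 1) w) (deriv (fun s => hurwitz s w) (-1)) 0 := by
    have : HasDerivAt (fun s => hurwitz s w) (deriv (fun s => hurwitz s w) (-1)) ((0 : ℂ) - 1) := by
      rw [zero_sub]
      exact (differentiableAt_hurwitz hw (by norm_num)).hasDerivAt
    exact this.comp_sub_const 0 1
  have h5 := (hasDerivAt_hurwitzDiffIntegral_zero hw (inv_pos.mpr ha0) (inv_le_one_of_one_le₀ ha)).2
  have h := (((h1.div_const 2).mul (hasDerivAt_hurwitz_zero hw)).add
    ((h2.div h3 (by norm_num)).mul h4)).add ((h1.const_mul Complex.I).mul h5)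
  refine h.congr_deriv ?_
  rw [hurwitzDiffIntegral_zero, hurwitz_zero, zero_sub, hurwitz_neg_one]
  simp only [neg_zero, Complex.cpow_zero, sub_zero, Complex.cpow_one, Complex.ofReal_log ha0.le,
    Pi.div_apply]
  push_cast
  field_simp
  linear_combination (-4 * Complex.log a) * Complex.I_sq

lemma hasSum_hurwitz_sub {s : ℂ} (hs : 1 < s.re) (hw : 1 ≤ w.re) (y : ℝ) :
    HasSum (fun m : ℕ => cpowDiff s (m + w) y)
      (hurwitz s (w + Complex.I * y) - hurwitz s (w - Complex.I * y)) := by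
  have h1 := hasSum_hurwitz hs (w := w + Complex.I * y) (by simpa using hw)
  have h2 := hasSum_hurwitz hs (w := w - Complex.I * y) (by simpa using hw)
  refine (h1.sub h2).congr_fun fun m => ?_
  simp only [cpowDiff]
  ring_nf

lemma norm_cpowDiff_le {s : ℂ} (hs : -1 ≤ s.re) (hw : 1 ≤ w.re) {y : ℝ} (hy : 0 ≤ y) :
    ‖cpowDiff s w y‖ ≤ 2 * y * (‖s‖ * Real.exp (Real.pi * ‖s + 1‖) * w.re ^ (-(s.re + 1))) := by
  refine norm_vertical_sub_le (c := w.re) le_rfl hy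
    (fun z hz => hasDerivAt_cpow_neg s (by linarith)) fun z hz _ => ?_
  have hz0 : z ≠ 0 := ne_zero_of_one_le_re (hw.trans hz)
  rw [norm_mul, norm_neg, mul_assoc]
  gcongr
  refine (norm_cpow_neg_le _ z hz0).trans ?_
  rw [mul_comm]
  gcongr
  exact Real.rpow_le_rpow_of_nonpos (by linarith) (hz.trans (Complex.re_le_norm z))
    (by simp; linarith)

lemma mul_cpow_neg_ofReal (ha : 0 < a) {x : ℂ} (hx : x ≠ 0) (s : ℂ) :
    (a * x) ^ (-s) = (a : ℂ) ^ (-s) * x ^ (-s) := by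
  have haC : (a : ℂ) ≠ 0 := Complex.ofReal_ne_zero.mpr ha.ne'
  rw [Complex.cpow_def_of_ne_zero (mul_ne_zero haC hx), Complex.cpow_def_of_ne_zero haC,
    Complex.cpow_def_of_ne_zero hx, ← Complex.exp_add, Complex.log_ofReal_mul ha hx,
    Complex.ofReal_log ha.le]
  ring_nf

lemma cpowDiff_mul (ha : 0 < a) (hw : 1 ≤ w.re) (s : ℂ) (y : ℝ) :
    cpowDiff s (a * w) y = (a : ℂ) ^ (-s) * cpowDiff s w (a⁻¹ * y) := by
  have haC : (a : ℂ) ≠ 0 := Complex.ofReal_ne_zero.mpr ha.ne'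
  rw [cpowDiff, cpowDiff, mul_sub, ← mul_cpow_neg_ofReal ha (ne_zero_of_one_le_re (by simpa using hw)),
    ← mul_cpow_neg_ofReal ha (ne_zero_of_one_le_re (by simpa using hw))]
  push_cast
  congr 2 <;> field_simp

/-- Summing Hermite's formula. -/
theorem hasSum_doubleZeta (ha : 1 ≤ a) (hw : 1 ≤ w.re) {s : ℂ} (hs : 2 < s.re) :
    HasSum (fun m : ℕ => hurwitz s (a * (m + w))) (doubleZeta a w s) := by
  have ha0 : 0 < a := by linarith
  have hk0 : 0 < a⁻¹ := inv_pos.mpr ha0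
  have hk1 : a⁻¹ ≤ 1 := inv_le_one_of_one_le₀ ha
  have hre : ∀ m : ℕ, 1 ≤ ((m : ℂ) + w).re := fun m => by
    have : (0 : ℝ) ≤ m := m.cast_nonneg
    simp; linarith
  have h1 := (hasSum_hurwitz (s := s) (by linarith) hw).mul_left ((a : ℂ) ^ (-s) / 2)
  have h2 := (hasSum_hurwitz (s := s - 1) (by simp; linarith) hw).mul_left
    ((a : ℂ) ^ (1 - s) / (s - 1))
  have h3 : HasSum (fun m : ℕ => ∫ y : ℝ in Ioi 0, cpowDiff s (m + w) (a⁻¹ * y) * boseWeight y)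
      (hurwitzDiffIntegral a⁻¹ s w) := by
    have key := hasSum_integral_of_summable_integral_norm
      (F := fun (m : ℕ) (y : ℝ) => cpowDiff s (m + w) (a⁻¹ * y) * boseWeight y)
      (μ := volume.restrict (Ioi 0))
      (fun m => (dominatedEntire_cpowDiff (hre m) hk0 hk1).integrableOn s) ?_
    · convert! key using 1
      refine setIntegral_congr_fun measurableSet_Ioi fun y _ => ?_
      exact ((hasSum_hurwitz_sub (by linarith) hw _).mul_right _).tsum_eq.symm
    · set M : ℝ := 2 * (‖s‖ * Real.exp (Real.pi * ‖s + 1‖)) with hM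
      have hM0 : 0 ≤ M := by positivity
      refine Summable.of_nonneg_of_le (fun m => integral_nonneg fun y => norm_nonneg _)
        (f := fun m : ℕ => M * ((m + 1 : ℕ) : ℝ) ^ (-(s.re + 1))) (fun m => ?_) ?_
      · refine (integral_mono_of_nonneg (Eventually.of_forall fun y => norm_nonneg _)
          ((integrableOn_exp_neg_Ioi 0).const_mul (M * ((m + 1 : ℕ) : ℝ) ^ (-(s.re + 1)))) ?_).trans
          (le_of_eq ?_)
        · refine (ae_restrict_mem measurableSet_Ioi).mono fun y hy => ?_
          have hy' : 0 < y := hy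
          have hb := boseWeight_nonneg hy'
          simp only
          rw [norm_mul, Complex.norm_real, Real.norm_of_nonneg hb]
          have hmw : ((m + 1 : ℕ) : ℝ) ≤ ((m : ℂ) + w).re := by simp; linarith
          have hrp : ((m : ℂ) + w).re ^ (-(s.re + 1)) ≤ ((m + 1 : ℕ) : ℝ) ^ (-(s.re + 1)) :=
            Real.rpow_le_rpow_of_nonpos (by positivity) hmw (by linarith)
          have hwp : 0 ≤ ((m : ℂ) + w).re := by linarith [hre m]
          calc _ ≤ 2 * (a⁻¹ * y) * (‖s‖ * Real.exp (Real.pi * ‖s + 1‖)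
                * ((m : ℂ) + w).re ^ (-(s.re + 1))) * boseWeight y := by
                gcongr
                exact norm_cpowDiff_le (by linarith) (hre m) (by positivity)
            _ ≤ 2 * (1 * y) * (‖s‖ * Real.exp (Real.pi * ‖s + 1‖)
                * ((m + 1 : ℕ) : ℝ) ^ (-(s.re + 1))) * boseWeight y := by
                gcongr
            _ = M * ((m + 1 : ℕ) : ℝ) ^ (-(s.re + 1)) * (y * boseWeight y) := by rw [hM]; ring
            _ ≤ _ := by
                gcongr
                exact (mul_boseWeight_le hy').trans (Real.exp_le_exp.mpr (by linarith))
        · rw [integral_const_mul, integral_exp_neg_Ioi_zero', mul_one]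
      · refine Summable.mul_left _ ((summable_nat_add_iff
          (f := fun m : ℕ => (m : ℝ) ^ (-(s.re + 1))) 1).mpr ?_)
        exact Real.summable_nat_rpow.mpr (by linarith)
  refine ((h1.add h2).add (h3.mul_left (Complex.I * (a : ℂ) ^ (-s)))).congr_fun fun m => ?_
  have hm0 := ne_zero_of_one_le_re (hre m)
  have e : ((a : ℂ) * (m + w)) ^ (1 - s) = (a : ℂ) ^ (1 - s) * ((m : ℂ) + w) ^ (1 - s) := by
    have := mul_cpow_neg_ofReal ha0 hm0 (s - 1)
    rwa [neg_sub] at this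
  rw [hurwitz, mul_cpow_neg_ofReal ha0 hm0, e, hermiteIntegral, neg_sub]
  simp_rw [cpowDiff_mul ha0 (hre m), mul_assoc]
  rw [integral_const_mul]
  ring

lemma differentiableAt_doubleZeta (ha : 1 ≤ a) (hw : 1 ≤ w.re) {s : ℂ} (hs1 : s ≠ 1) (hs2 : s ≠ 2) :
    DifferentiableAt ℂ (doubleZeta a w) s := by
  have ha0 : 0 < a := by linarith
  have haC : 1 ≤ (a : ℂ).re := by simpa
  have h1 := (differentiable_const_cpow_neg haC) s
  have h2 := (differentiable_const_cpow_one_sub haC) s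
  have h3 := differentiableAt_hurwitzDiffIntegral hw (inv_pos.mpr ha0) (inv_le_one_of_one_le₀ ha) hs1
  have h4 := differentiableAt_hurwitz hw hs1
  have h5 : DifferentiableAt ℂ (fun s => hurwitz (s - 1) w) s :=
    differentiableAt_comp_sub_const.mpr
      (differentiableAt_hurwitz hw (s := s - 1) fun h => hs2 (by linear_combination h))
  have h6 : DifferentiableAt ℂ (fun s : ℂ => s - 1) s := by fun_prop
  unfold doubleZeta
  exact (((h1.div_const 2).mul h4).add ((h2.div h6 (sub_ne_zero.mpr hs1)).mul h5)).add
    ((h1.const_mul Complex.I).mul h3)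

lemma meromorphicAt_doubleZeta (ha : 1 ≤ a) (hw : 1 ≤ w.re) (s : ℂ) :
    MeromorphicAt (doubleZeta a w) s := by
  have ha0 : 0 < a := by linarith
  have haC : 1 ≤ (a : ℂ).re := by simpa
  have h1 := ((differentiable_const_cpow_neg haC).analyticAt s).meromorphicAt
  have h2 := ((differentiable_const_cpow_one_sub haC).analyticAt s).meromorphicAt
  have h3 := meromorphicAt_hurwitzDiffIntegral hw (inv_pos.mpr ha0) (inv_le_one_of_one_le₀ ha) s
  have h4 := meromorphicAt_hurwitz hw s
  have h5 : MeromorphicAt (fun s => hurwitz (s - 1) w) s :=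
    (meromorphicAt_hurwitz hw (s - 1)).comp_analyticAt (g := fun s => s - 1) (by fun_prop)
  have h6 : MeromorphicAt (fun s : ℂ => s - 1) s := by fun_prop
  exact (((h1.div (MeromorphicAt.const 2 s)).mul h4).add ((h2.div h6).mul h5)).add
    (((MeromorphicAt.const Complex.I s).mul h1).mul h3)

/-- The residue of the double zeta function at its rightmost pole. -/
lemma exists_doubleZeta_residue (ha : 1 ≤ a) (hw : 1 ≤ w.re) :
    ∃ R : ℂ → ℂ, DifferentiableAt ℂ R 2 ∧ R 2 = 1 / a ∧
      ∀ s, s ≠ 2 → (s - 2) * doubleZeta a w s = R s := by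
  have ha0 : 0 < a := by linarith
  have haC : 1 ≤ (a : ℂ).re := by simpa
  have h1 := (differentiable_const_cpow_neg haC) 2
  have h2 := (differentiable_const_cpow_one_sub haC) 2
  have h3 := differentiableAt_hurwitzDiffIntegral hw (inv_pos.mpr ha0) (inv_le_one_of_one_le₀ ha)
    (s := 2) (by norm_num)
  have h4 := differentiableAt_hurwitz hw (s := 2) (by norm_num)
  have h5 : DifferentiableAt ℂ (fun s => w ^ (-(s - 1)) / 2
      + Complex.I * hermiteIntegral (s - 1) w) 2 :=
    differentiableAt_comp_sub_const.mpr (differentiable_hurwitz_regular hw (2 - 1))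
  have h6 : DifferentiableAt ℂ (fun s : ℂ => w ^ (1 - (s - 1))) 2 :=
    differentiableAt_comp_sub_const (f := fun s : ℂ => w ^ (1 - s)).mpr
      (differentiable_const_cpow_one_sub hw (2 - 1))
  refine ⟨fun s => (s - 2) * ((a : ℂ) ^ (-s) / 2 * hurwitz s w
    + Complex.I * (a : ℂ) ^ (-s) * hurwitzDiffIntegral a⁻¹ s w)
    + (a : ℂ) ^ (1 - s) / (s - 1) * ((s - 2) * (w ^ (-(s - 1)) / 2
      + Complex.I * hermiteIntegral (s - 1) w) + w ^ (1 - (s - 1))), ?_, ?_, fun s hs => ?_⟩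
  · have h7 : DifferentiableAt ℂ (fun s : ℂ => s - 2) 2 := by fun_prop
    have h8 : DifferentiableAt ℂ (fun s : ℂ => s - 1) 2 := by fun_prop
    exact (h7.mul (((h1.div_const 2).mul h4).add ((h1.const_mul Complex.I).mul h3))).add
      ((h2.div h8 (by norm_num)).mul ((h7.mul h5).add h6))
  · norm_num
    rw [Complex.cpow_neg_one]
  · have : s - 2 ≠ 0 := sub_ne_zero.mpr hs
    rw [doubleZeta, hurwitz_eq_add_div (s - 1), show s - 1 - 1 = s - 2 by ring]
    field_simp
    ring

end

/-- The coefficient of `z ^ k` in the binomial series of `(1 - z) ^ (-s)`. -/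
noncomputable def binomCoeff : ℕ → ℂ → ℂ
  | 0, _ => 1
  | k + 1, s => s * binomCoeff k (s + 1) / (k + 1)

lemma differentiable_binomCoeff (k : ℕ) : Differentiable ℂ (binomCoeff k) := by
  induction k with
  | zero => exact differentiable_const 1
  | succ k ih =>
    have : binomCoeff (k + 1) = fun s => s * binomCoeff k (s + 1) / (k + 1) := rfl
    rw [this]
    fun_prop

lemma binomCoeff_succ_zero (k : ℕ) : binomCoeff (k + 1) 0 = 0 := by simp [binomCoeff]

/-- The remainder of the binomial series of `(1 - z) ^ (-s)` at order `K`. -/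
noncomputable def binomRem (K : ℕ) (s z : ℂ) : ℂ :=
  (1 - z) ^ (-s) - ∑ k ∈ Finset.range K, binomCoeff k s * z ^ k

lemma one_sub_re_pos {z : ℂ} (hz : ‖z‖ ≤ 1 / 2) : 0 < (1 - z).re := by
  have := (Complex.abs_re_le_norm z).trans hz
  rw [abs_le] at this
  simp; linarith [this.2]

lemma differentiable_binomRem (K : ℕ) {z : ℂ} (hz : ‖z‖ ≤ 1 / 2) :
    Differentiable ℂ (fun s => binomRem K s z) := by
  have h0 : 1 - z ≠ 0 := fun h => by simpa [h] using one_sub_re_pos hz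
  have := differentiable_binomCoeff
  unfold binomRem
  refine (differentiable_neg.const_cpow (Or.inl h0)).sub ?_
  fun_prop

lemma hasDerivAt_binomRem_succ (K : ℕ) (s : ℂ) {z : ℂ} (hz : ‖z‖ ≤ 1 / 2) :
    HasDerivAt (binomRem (K + 1) s) (s * binomRem K (s + 1) z) z := by
  have h1 : HasDerivAt (fun z : ℂ => (1 - z) ^ (-s)) (s * (1 - z) ^ (-(s + 1))) z := by
    refine (((hasDerivAt_cpow_neg s (one_sub_re_pos hz)).comp z
      ((hasDerivAt_id' z).const_sub 1))).congr_deriv ?_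
    ring
  have h2 : HasDerivAt (fun z : ℂ => ∑ k ∈ Finset.range (K + 1), binomCoeff k s * z ^ k)
      (∑ k ∈ Finset.range (K + 1), binomCoeff k s * (k * z ^ (k - 1))) z :=
    HasDerivAt.fun_sum fun k _ => (hasDerivAt_pow k z).const_mul _
  refine (h1.sub h2).congr_deriv ?_
  rw [Finset.sum_range_succ', binomRem, mul_sub, Finset.mul_sum]
  simp only [Nat.cast_zero, zero_mul, mul_zero, add_zero]
  congr 1
  refine Finset.sum_congr rfl fun k _ => ?_
  have : (k : ℂ) + 1 ≠ 0 := Nat.cast_add_one_ne_zero k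
  rw [binomCoeff]
  push_cast
  field_simp

lemma binomRem_succ_at_zero (K : ℕ) (s : ℂ) : binomRem (K + 1) s 0 = 0 := by
  rw [binomRem, Finset.sum_range_succ']
  simp [binomCoeff]

lemma exists_norm_binomRem_le (K : ℕ) (S : ℝ) : ∃ C, 0 ≤ C ∧ ∀ s : ℂ, ‖s‖ ≤ S → ∀ z : ℂ,
    ‖z‖ ≤ 1 / 2 → ‖binomRem K s z‖ ≤ C * ‖z‖ ^ K := by
  induction K generalizing S with
  | zero =>
    refine ⟨Real.exp |S| * Real.exp (Real.pi * |S|), by positivity, fun s hs z hz => ?_⟩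
    have hs' : ‖s‖ ≤ |S| := hs.trans (le_abs_self S)
    have hre := one_sub_re_pos hz
    have h0 : 1 - z ≠ 0 := fun h => by simp [h] at hre
    have hpos : 0 < ‖1 - z‖ := norm_pos_iff.mpr h0
    have hlo : 1 / 2 ≤ ‖1 - z‖ := by
      have := norm_sub_norm_le (1 : ℂ) z
      simp at this; linarith
    have hhi : ‖1 - z‖ ≤ 3 / 2 := (norm_sub_le _ _).trans (by simp; linarith)
    simp only [binomRem, Finset.range_zero, Finset.sum_empty, sub_zero, pow_zero, mul_one]
    refine (norm_cpow_neg_le s _ h0).trans ?_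
    gcongr
    rw [Real.rpow_def_of_pos hpos, Real.exp_le_exp]
    have hl1 : |Real.log ‖1 - z‖| ≤ 1 := by
      rw [abs_le]
      have h1 := Real.one_sub_inv_le_log_of_pos hpos
      have h2 := Real.log_le_sub_one_of_pos hpos
      have h3 : ‖1 - z‖⁻¹ ≤ 2 := by
        rw [inv_le_comm₀ hpos (by norm_num)]; linarith
      constructor <;> linarith
    calc Real.log ‖1 - z‖ * -s.re ≤ |Real.log ‖1 - z‖ * -s.re| := le_abs_self _
      _ = |Real.log ‖1 - z‖| * |s.re| := by rw [abs_mul, abs_neg]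
      _ ≤ 1 * |S| :=
          mul_le_mul hl1 ((Complex.abs_re_le_norm s).trans hs') (abs_nonneg _) zero_le_one
      _ = |S| := one_mul _
  | succ K ih =>
    obtain ⟨C, hC0, hC⟩ := ih (S + 1)
    refine ⟨|S| * C, by positivity, fun s hs z hz => ?_⟩
    have hs' : ‖s‖ ≤ |S| := hs.trans (le_abs_self S)
    have h := (convex_closedBall (0 : ℂ) ‖z‖).norm_image_sub_le_of_norm_hasDerivWithin_le
      (f := binomRem (K + 1) s) (f' := fun z => s * binomRem K (s + 1) z) (C := |S| * C * ‖z‖ ^ K)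
      (x := 0) (y := z) (fun x hx => (hasDerivAt_binomRem_succ K s
        ((mem_closedBall_zero_iff.mp hx).trans hz)).hasDerivWithinAt) (fun x hx => ?_)
      (by simp) (by simp)
    · rw [binomRem_succ_at_zero, sub_zero, sub_zero] at h
      rw [pow_succ, ← mul_assoc]
      exact h
    · have hx' : ‖x‖ ≤ ‖z‖ := mem_closedBall_zero_iff.mp hx
      rw [norm_mul, mul_assoc]
      have h1 : ‖s + 1‖ ≤ S + 1 := (norm_add_le _ _).trans (by simpa using hs)
      gcongr
      exact (hC _ h1 x (hx'.trans hz)).trans (by gcongr)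

lemma hasDerivAt_sub_half_comp_two_mul {F : ℂ → ℂ} (hF : Differentiable ℂ F) :
    HasDerivAt (fun s => F s - F (2 * s) / 2) 0 0 := by
  have h1 : HasDerivAt F (deriv F 0) 0 := (hF 0).hasDerivAt
  have h2 : HasDerivAt F (deriv F 0) (2 * 0) := by rw [mul_zero]; exact h1
  have h3 : HasDerivAt (fun s : ℂ => 2 * s) 2 0 := by
    simpa using (hasDerivAt_id' (0 : ℂ)).const_mul 2
  refine (h1.sub ((h2.comp 0 h3).div_const 2)).congr_deriv ?_
  ring

/-- The coefficients of the expansion of `(1 - z) ^ (-s) - (1 - z) ^ (-2 s) / 2`. -/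
noncomputable def eigenCoeff (k : ℕ) (s : ℂ) : ℂ := binomCoeff k s - binomCoeff k (2 * s) / 2

lemma differentiable_eigenCoeff (k : ℕ) : Differentiable ℂ (eigenCoeff k) := by
  have := differentiable_binomCoeff k
  unfold eigenCoeff
  fun_prop

lemma eigenCoeff_zero (s : ℂ) : eigenCoeff 0 s = 1 / 2 := by
  norm_num [eigenCoeff, binomCoeff]

lemma eigenCoeff_one (s : ℂ) : eigenCoeff 1 s = 0 := by
  norm_num [eigenCoeff, binomCoeff]

lemma eigenCoeff_two (s : ℂ) : eigenCoeff 2 s = -(s ^ 2 / 2) := by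
  norm_num [eigenCoeff, binomCoeff]; ring

lemma eigenCoeff_succ_at_zero (k : ℕ) : eigenCoeff (k + 1) 0 = 0 := by
  simp [eigenCoeff, binomCoeff_succ_zero]

lemma hasDerivAt_eigenCoeff (k : ℕ) : HasDerivAt (eigenCoeff k) 0 0 :=
  hasDerivAt_sub_half_comp_two_mul (differentiable_binomCoeff k)

/-- The remainder of the expansion of `(1 - z) ^ (-s) - (1 - z) ^ (-2 s) / 2`. -/
noncomputable def eigenRem (K : ℕ) (s z : ℂ) : ℂ := binomRem K s z - binomRem K (2 * s) z / 2

lemma differentiable_eigenRem (K : ℕ) {z : ℂ} (hz : ‖z‖ ≤ 1 / 2) :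
    Differentiable ℂ (fun s => eigenRem K s z) := by
  have := differentiable_binomRem K hz
  exact this.sub ((this.comp (differentiable_id.const_mul 2)).div_const 2)

lemma hasDerivAt_eigenRem (K : ℕ) {z : ℂ} (hz : ‖z‖ ≤ 1 / 2) :
    HasDerivAt (fun s => eigenRem K s z) 0 0 :=
  hasDerivAt_sub_half_comp_two_mul (differentiable_binomRem K hz)

lemma eigenRem_succ_zero (K : ℕ) (z : ℂ) : eigenRem (K + 1) 0 z = 0 := by
  have : binomRem (K + 1) 0 z = 0 := by
    rw [binomRem, Finset.sum_range_succ']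
    simp [binomCoeff]
  simp [eigenRem, this]

lemma exists_norm_eigenRem_le (K : ℕ) (S : ℝ) : ∃ C, 0 ≤ C ∧ ∀ s : ℂ, ‖s‖ ≤ S → ∀ z : ℂ,
    ‖z‖ ≤ 1 / 2 → ‖eigenRem K s z‖ ≤ C * ‖z‖ ^ K := by
  obtain ⟨C1, h1, hC1⟩ := exists_norm_binomRem_le K S
  obtain ⟨C2, h2, hC2⟩ := exists_norm_binomRem_le K (2 * S)
  refine ⟨C1 + C2 / 2, by positivity, fun s hs z hz => ?_⟩
  have e1 := hC1 s hs z hz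
  have e2 := hC2 (2 * s) (by simpa using hs) z hz
  refine (norm_sub_le _ _).trans ?_
  rw [norm_div, Complex.norm_ofNat]
  linarith

/-- Expansion of `(v (v - 1)) ^ (-s)` in powers of `1 / v`. -/
lemma eigenvalue_cpow_expansion {v : ℝ} (hv : 2 ≤ v) (K : ℕ) (s : ℂ) :
    ((v - 1 : ℂ) * v) ^ (-s) = (v - 1 : ℂ) ^ (-(2 * s)) / 2
      + ∑ k ∈ Finset.range K, eigenCoeff k s * (v : ℂ) ^ (-(2 * s + k))
      + (v : ℂ) ^ (-(2 * s)) * eigenRem K s (v : ℂ)⁻¹ := by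
  have hv0 : 0 < v := by linarith
  have hvC : (v : ℂ) ≠ 0 := Complex.ofReal_ne_zero.mpr hv0.ne'
  have hz : ‖(v : ℂ)⁻¹‖ ≤ 1 / 2 := by
    rw [norm_inv, Complex.norm_real, Real.norm_of_nonneg hv0.le, one_div]
    exact inv_anti₀ (by norm_num) hv
  have h0 : 1 - (v : ℂ)⁻¹ ≠ 0 := fun h => by simpa [h] using one_sub_re_pos hz
  have hx : (v - 1 : ℂ) = v * (1 - (v : ℂ)⁻¹) := by field_simp
  have e1 : (v - 1 : ℂ) ^ (-(2 * s)) = (v : ℂ) ^ (-(2 * s)) * (1 - (v : ℂ)⁻¹) ^ (-(2 * s)) := by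
    rw [hx, mul_cpow_neg_ofReal hv0 h0]
  have e2 : ((v - 1 : ℂ) * v) ^ (-s) = (v : ℂ) ^ (-(2 * s)) * (1 - (v : ℂ)⁻¹) ^ (-s) := by
    have hne : (v : ℂ) * (1 - (v : ℂ)⁻¹) ≠ 0 := mul_ne_zero hvC h0
    rw [hx, mul_comm, mul_cpow_neg_ofReal hv0 hne, mul_cpow_neg_ofReal hv0 h0, ← mul_assoc,
      ← Complex.cpow_add _ _ hvC]
    ring_nf
  have e3 : ∀ k : ℕ, (v : ℂ) ^ (-(2 * s + k)) = (v : ℂ) ^ (-(2 * s)) * (v : ℂ)⁻¹ ^ k := fun k => by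
    rw [neg_add, Complex.cpow_add _ _ hvC, Complex.cpow_neg _ (k : ℂ), Complex.cpow_natCast, inv_pow]
  rw [e1, e2, eigenRem, binomRem, binomRem]
  simp_rw [e3, eigenCoeff, sub_mul]
  rw [Finset.sum_sub_distrib]
  have e4 : ∀ c : ℕ → ℂ, ∑ k ∈ Finset.range K, c k * ((v : ℂ) ^ (-(2 * s)) * (v : ℂ)⁻¹ ^ k)
      = (v : ℂ) ^ (-(2 * s)) * ∑ k ∈ Finset.range K, c k * (v : ℂ)⁻¹ ^ k := fun c => by
    rw [Finset.mul_sum]; exact Finset.sum_congr rfl fun k _ => by ring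
  rw [e4, e4 (fun k => binomCoeff k (2 * s) / 2)]
  have e5 : ∑ k ∈ Finset.range K, binomCoeff k (2 * s) / 2 * (v : ℂ)⁻¹ ^ k
      = (∑ k ∈ Finset.range K, binomCoeff k (2 * s) * (v : ℂ)⁻¹ ^ k) / 2 := by
    rw [Finset.sum_div]; exact Finset.sum_congr rfl fun k _ => by ring
  rw [e5]
  ring

section

variable {ι : Type*} {v : ι → ℝ}

/-- The tail of the spectral zeta function after removing `K` terms of the expansion. -/
noncomputable def eigenTail (v : ι → ℝ) (K : ℕ) (s : ℂ) : ℂ :=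
  ∑' i, (v i : ℂ) ^ (-(2 * s)) * eigenRem K s (v i : ℂ)⁻¹

lemma exists_eigenTail_majorant (hv : ∀ i, 2 ≤ v i)
    (hsum : ∀ σ : ℝ, 2 < σ → Summable fun i => v i ^ (-σ)) {K : ℕ} {s₀ : ℂ}
    (hs₀ : 2 < 2 * s₀.re + K) : ∃ r > 0, ∃ u : ι → ℝ, Summable u ∧ ∀ i, ∀ s ∈ Metric.ball s₀ r,
      ‖(v i : ℂ) ^ (-(2 * s)) * eigenRem K s (v i : ℂ)⁻¹‖ ≤ u i := by
  set r : ℝ := (2 * s₀.re + K - 2) / 4 with hr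
  obtain ⟨C, hC0, hC⟩ := exists_norm_eigenRem_le K (‖s₀‖ + r)
  refine ⟨r, by rw [hr]; linarith, fun i => C * v i ^ (-(2 * (s₀.re - r) + K)),
    (hsum _ (by rw [hr]; linarith)).mul_left C, fun i s hs => ?_⟩
  have hv0 : 0 < v i := by linarith [hv i]
  have hz : ‖(v i : ℂ)⁻¹‖ = (v i)⁻¹ := by
    rw [norm_inv, Complex.norm_real, Real.norm_of_nonneg hv0.le]
  have hd : ‖s - s₀‖ < r := by simpa [dist_eq_norm] using hs
  have hs1 : ‖s‖ ≤ ‖s₀‖ + r := by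
    have := norm_add_le s₀ (s - s₀)
    rw [add_sub_cancel] at this
    linarith
  have hs2 : s₀.re - r ≤ s.re := by
    have := (Complex.abs_re_le_norm (s - s₀)).trans hd.le
    rw [abs_le, Complex.sub_re] at this
    linarith [this.1]
  rw [norm_mul, Complex.norm_cpow_eq_rpow_re_of_pos hv0]
  have h1 := hC s hs1 (v i : ℂ)⁻¹ (by rw [hz, one_div]; exact inv_anti₀ (by norm_num) (hv i))
  rw [hz, inv_pow] at h1
  have h2 : v i ^ (-(2 * s)).re ≤ v i ^ (-(2 * (s₀.re - r))) := by
    refine Real.rpow_le_rpow_of_exponent_le (by linarith [hv i]) ?_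
    simp; linarith
  calc _ ≤ v i ^ (-(2 * (s₀.re - r))) * (C * (v i ^ K)⁻¹) := by gcongr
    _ = C * v i ^ (-(2 * (s₀.re - r) + K)) := by
        rw [neg_add, Real.rpow_add hv0, Real.rpow_neg hv0.le (K : ℝ), Real.rpow_natCast]; ring

lemma differentiable_eigenTail_term (hv : ∀ i, 2 ≤ v i) (K : ℕ) (i : ι) :
    Differentiable ℂ fun s => (v i : ℂ) ^ (-(2 * s)) * eigenRem K s (v i : ℂ)⁻¹ := by
  have hv0 : 0 < v i := by linarith [hv i]
  have hvC : (v i : ℂ) ≠ 0 := Complex.ofReal_ne_zero.mpr hv0.ne'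
  have hz : ‖(v i : ℂ)⁻¹‖ ≤ 1 / 2 := by
    rw [norm_inv, Complex.norm_real, Real.norm_of_nonneg hv0.le, one_div]
    exact inv_anti₀ (by norm_num) (hv i)
  exact ((differentiable_fun_id.const_mul 2).neg.const_cpow (Or.inl hvC)).mul
    (differentiable_eigenRem K hz)

lemma differentiableAt_eigenTail (hv : ∀ i, 2 ≤ v i)
    (hsum : ∀ σ : ℝ, 2 < σ → Summable fun i => v i ^ (-σ)) {K : ℕ} {s₀ : ℂ}
    (hs₀ : 2 < 2 * s₀.re + K) : DifferentiableAt ℂ (eigenTail v K) s₀ := by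
  obtain ⟨r, hr, u, hu, hle⟩ := exists_eigenTail_majorant hv hsum hs₀
  exact (Complex.differentiableOn_tsum_of_summable_norm hu
    (fun i => (differentiable_eigenTail_term hv K i).differentiableOn) Metric.isOpen_ball
    hle).differentiableAt (Metric.ball_mem_nhds s₀ hr)

lemma hasDerivAt_eigenTail_zero (hv : ∀ i, 2 ≤ v i)
    (hsum : ∀ σ : ℝ, 2 < σ → Summable fun i => v i ^ (-σ)) {K : ℕ} (hK : 3 ≤ K) :
    HasDerivAt (eigenTail v K) 0 0 := by
  have hK' : (3 : ℝ) ≤ K := by exact_mod_cast hK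
  have hs₀ : 2 < 2 * (0 : ℂ).re + K := by simp; linarith
  obtain ⟨r, hr, u, hu, hle⟩ := exists_eigenTail_majorant hv hsum hs₀
  have h := Complex.hasSum_deriv_of_summable_norm hu
    (fun i => (differentiable_eigenTail_term hv K i).differentiableOn) Metric.isOpen_ball
    hle (Metric.mem_ball_self hr)
  have h0 : ∀ i, deriv (fun s => (v i : ℂ) ^ (-(2 * s)) * eigenRem K s (v i : ℂ)⁻¹) 0 = 0 := by
    intro i
    have hv0 : 0 < v i := by linarith [hv i]
    have hvC : (v i : ℂ) ≠ 0 := Complex.ofReal_ne_zero.mpr hv0.ne'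
    have hz : ‖(v i : ℂ)⁻¹‖ ≤ 1 / 2 := by
      rw [norm_inv, Complex.norm_real, Real.norm_of_nonneg hv0.le, one_div]
      exact inv_anti₀ (by norm_num) (hv i)
    have h1 : DifferentiableAt ℂ (fun s : ℂ => (v i : ℂ) ^ (-(2 * s))) 0 :=
      ((differentiable_fun_id.const_mul 2).neg.const_cpow (Or.inl hvC)) 0
    obtain ⟨K, rfl⟩ := Nat.exists_eq_add_of_le' (show 1 ≤ K by omega)
    refine (h1.hasDerivAt.fun_mul (hasDerivAt_eigenRem (K + 1) hz)).deriv.trans ?_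
    rw [eigenRem_succ_zero]
    ring
  simp_rw [h0] at h
  have hd := (differentiableAt_eigenTail hv hsum hs₀).hasDerivAt
  have e : deriv (eigenTail v K) 0 = 0 := h.unique hasSum_zero
  rwa [e] at hd

/-- Decomposition of a spectral zeta function with eigenvalues `v (v - 1)`. -/
lemma tsum_eigenvalue_cpow (hv : ∀ i, 2 ≤ v i)
    (hsum : ∀ σ : ℝ, 2 < σ → Summable fun i => v i ^ (-σ)) (K : ℕ) {s : ℂ} (hs : 2 < s.re)
    (hx : Summable fun i => (v i - 1 : ℂ) ^ (-(2 * s))) :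
    ∑' i, ((v i - 1 : ℂ) * v i) ^ (-s) = (∑' i, (v i - 1 : ℂ) ^ (-(2 * s))) / 2
      + ∑ k ∈ Finset.range K, eigenCoeff k s * ∑' i, (v i : ℂ) ^ (-(2 * s + k))
      + eigenTail v K s ∧
    Summable fun i => ((v i - 1 : ℂ) * v i) ^ (-s) := by
  have hk : ∀ k : ℕ, Summable fun i => (v i : ℂ) ^ (-(2 * s + k)) := fun k => by
    refine Summable.of_norm ?_
    have hk0 : (0 : ℝ) ≤ k := k.cast_nonneg
    refine (hsum (2 * s.re + k) (by linarith)).congr fun i => ?_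
    rw [Complex.norm_cpow_eq_rpow_re_of_pos (by linarith [hv i])]
    simp
  have ht : Summable fun i => (v i : ℂ) ^ (-(2 * s)) * eigenRem K s (v i : ℂ)⁻¹ := by
    have hK0 : (0 : ℝ) ≤ K := K.cast_nonneg
    obtain ⟨r, hr, u, hu, hle⟩ := exists_eigenTail_majorant hv hsum (K := K) (s₀ := s) (by linarith)
    exact Summable.of_norm_bounded hu fun i => hle i s (Metric.mem_ball_self hr)
  have h1 := (hx.div_const 2).hasSum.add
    ((hasSum_sum fun k (_ : k ∈ Finset.range K) => ((hk k).mul_left (eigenCoeff k s)).hasSum))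
  have h2 := (h1.add ht.hasSum).congr_fun fun i => eigenvalue_cpow_expansion (hv i) K s
  refine ⟨?_, h2.summable⟩
  rw [h2.tsum_eq, tsum_div_const, eigenTail]
  simp_rw [tsum_mul_left]

end

/-- The linear form `n + a (m + w)` on the lattice `ℕ × ℕ`. -/
noncomputable def latticeForm (a w : ℝ) (p : ℕ × ℕ) : ℝ := p.2 + a * (p.1 + w)

lemma le_latticeForm {a w : ℝ} (ha : 1 ≤ a) (hw : 1 ≤ w) (p : ℕ × ℕ) :
    (p.1 : ℝ) + p.2 + 1 ≤ latticeForm a w p := by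
  have h1 : (0 : ℝ) ≤ p.1 := p.1.cast_nonneg
  rw [latticeForm]
  nlinarith

lemma summable_latticeForm_rpow {a w : ℝ} (ha : 1 ≤ a) (hw : 1 ≤ w) {σ : ℝ} (hσ : 2 < σ) :
    Summable fun p => latticeForm a w p ^ (-σ) := by
  have h : Summable fun n : ℕ => ((n : ℝ) + 1) ^ (-(σ / 2)) := by
    have := (summable_nat_add_iff (f := fun n : ℕ => (n : ℝ) ^ (-(σ / 2))) 1).mpr
      (Real.summable_nat_rpow.mpr (by linarith))
    simpa using this
  have h2 := h.mul_of_nonneg h (fun n => by positivity) (fun n => by positivity)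
  refine Summable.of_nonneg_of_le (fun p => ?_) (fun p => ?_) h2
  · have := le_latticeForm ha hw p
    exact Real.rpow_nonneg (by have := p.1.cast_nonneg (α := ℝ); have := p.2.cast_nonneg (α := ℝ)
                               linarith) _
  · have hm := p.1.cast_nonneg (α := ℝ)
    have hn := p.2.cast_nonneg (α := ℝ)
    have hl := le_latticeForm ha hw p
    have hl0 : 0 ≤ latticeForm a w p := by linarith
    calc latticeForm a w p ^ (-σ) = (latticeForm a w p ^ (2 : ℝ)) ^ (-(σ / 2)) := by
          rw [← Real.rpow_mul hl0]; ring_nf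
      _ ≤ (((p.1 : ℝ) + 1) * ((p.2 : ℝ) + 1)) ^ (-(σ / 2)) := by
          refine Real.rpow_le_rpow_of_nonpos (by positivity) ?_ (by linarith)
          rw [Real.rpow_two]
          nlinarith
      _ = _ := Real.mul_rpow (by positivity) (by positivity)

lemma summable_cpow_of_summable_rpow {ι : Type*} {v : ι → ℝ} (hv : ∀ i, 0 < v i)
    {s : ℂ} (h : Summable fun i => v i ^ (-s.re)) : Summable fun i => (v i : ℂ) ^ (-s) := by
  refine Summable.of_norm (h.congr fun i => ?_)
  rw [Complex.norm_cpow_eq_rpow_re_of_pos (hv i), Complex.neg_re]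

lemma hasSum_latticeForm_cpow {a w : ℝ} (ha : 1 ≤ a) (hw : 1 ≤ w) {s : ℂ} (hs : 2 < s.re) :
    HasSum (fun p => (latticeForm a w p : ℂ) ^ (-s)) (doubleZeta a w s) := by
  have hpos : ∀ p, 0 < latticeForm a w p := fun p => by
    have := le_latticeForm ha hw p
    have := p.1.cast_nonneg (α := ℝ)
    have := p.2.cast_nonneg (α := ℝ)
    linarith
  have hsum := summable_cpow_of_summable_rpow hpos (summable_latticeForm_rpow ha hw hs)
  have h1 : ∀ m : ℕ, HasSum (fun n : ℕ => (latticeForm a w (m, n) : ℂ) ^ (-s))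
      (hurwitz s (a * (m + w))) := fun m => by
    have hm := m.cast_nonneg (α := ℝ)
    have := hasSum_hurwitz (s := s) (w := (a * (m + w) : ℂ)) (by linarith) (by
      rw [← Complex.ofReal_natCast, ← Complex.ofReal_add, ← Complex.ofReal_mul, Complex.ofReal_re]
      nlinarith)
    refine this.congr_fun fun n => ?_
    simp [latticeForm]
  have h2 := hsum.hasSum.prod_fiberwise h1
  rw [← h2.unique (hasSum_doubleZeta ha (w := (w : ℂ)) (by simpa using hw) hs)]
  exact hsum.hasSum

/-- The spectral zeta function of the deformed sphere, after expanding the eigenvalues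
`v (v - 1)` to order `K` in `v⁻¹`. -/
noncomputable def spectralModel (a : ℝ) (K : ℕ) (s : ℂ) : ℂ :=
  (hurwitz (2 * s) 1 / 2 + ∑ k ∈ Finset.range K, eigenCoeff k s * hurwitz (2 * s + k) 2
    + eigenTail (fun n : ℕ => (n : ℝ) + 2) K s)
  + 2 * (doubleZeta a 1 (2 * s) / 2
    + ∑ k ∈ Finset.range K, eigenCoeff k s * doubleZeta a (1 + 1 / a) (2 * s + k)
    + eigenTail (latticeForm a (1 + 1 / a)) K s)

lemma summable_add_two_rpow {σ : ℝ} (hσ : 2 < σ) :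
    Summable fun n : ℕ => ((n : ℝ) + 2) ^ (-σ) := by
  have := (summable_nat_add_iff (f := fun n : ℕ => (n : ℝ) ^ (-σ)) 2).mpr
    (Real.summable_nat_rpow.mpr (by linarith))
  simpa using this

lemma two_le_latticeForm {a : ℝ} (ha : 1 ≤ a) (p : ℕ × ℕ) :
    2 ≤ latticeForm a (1 + 1 / a) p := by
  have h0 : a ≠ 0 := by linarith
  have h1 : (0 : ℝ) ≤ p.1 := p.1.cast_nonneg
  have h2 : (0 : ℝ) ≤ p.2 := p.2.cast_nonneg
  have : latticeForm a (1 + 1 / a) p = p.2 + a * p.1 + a + 1 := by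
    rw [latticeForm]; field_simp; ring
  rw [this]; nlinarith

lemma one_le_one_add_one_div {a : ℝ} (ha : 1 ≤ a) : 1 ≤ 1 + 1 / a := by
  have : 0 ≤ 1 / a := by positivity
  linarith

lemma latticeForm_sub_one {a : ℝ} (ha : 1 ≤ a) (p : ℕ × ℕ) :
    (latticeForm a (1 + 1 / a) p : ℂ) - 1 = (latticeForm a 1 p : ℂ) := by
  have h0 : (a : ℂ) ≠ 0 := Complex.ofReal_ne_zero.mpr (by linarith)
  simp only [latticeForm]
  push_cast
  field_simp
  ring

lemma tsum_single_eigenvalue (K : ℕ) {s : ℂ} (hs : 2 < s.re) :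
    ∑' n : ℕ, (((n : ℂ) + 1) * ((n : ℂ) + 2)) ^ (-s) =
      hurwitz (2 * s) 1 / 2 + ∑ k ∈ Finset.range K, eigenCoeff k s * hurwitz (2 * s + k) 2
        + eigenTail (fun n : ℕ => (n : ℝ) + 2) K s := by
  have h1 : HasSum (fun n : ℕ => ((((n : ℝ) + 2 : ℝ) : ℂ) - 1) ^ (-(2 * s))) (hurwitz (2 * s) 1) := by
    refine (hasSum_hurwitz (s := 2 * s) (w := 1) (by simp; linarith) (by simp)).congr_fun
      fun n => ?_
    push_cast; ring_nf
  have h2 : ∀ k : ℕ, HasSum (fun n : ℕ => (((n : ℝ) + 2 : ℝ) : ℂ) ^ (-(2 * s + k)))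
      (hurwitz (2 * s + k) 2) := fun k => by
    have hk := k.cast_nonneg (α := ℝ)
    refine (hasSum_hurwitz (s := 2 * s + k) (w := 2) (by simp; linarith) (by simp)).congr_fun
      fun n => ?_
    push_cast; ring_nf
  have h := (tsum_eigenvalue_cpow (v := fun n : ℕ => (n : ℝ) + 2) (fun n => by simp)
    (fun σ => summable_add_two_rpow) K hs h1.summable).1
  rw [h1.tsum_eq] at h
  simp_rw [(h2 _).tsum_eq] at h
  rw [← h]
  refine tsum_congr fun n => ?_
  push_cast; ring_nf

lemma tsum_double_eigenvalue {a : ℝ} (ha : 1 ≤ a) (K : ℕ) {s : ℂ} (hs : 2 < s.re) :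
    ∑' (m : ℕ) (n : ℕ), (((a : ℂ) * (m + 1) + n) * ((a : ℂ) * (m + 1) + n + 1)) ^ (-s) =
      doubleZeta a 1 (2 * s) / 2
        + ∑ k ∈ Finset.range K, eigenCoeff k s * doubleZeta a (1 + 1 / a) (2 * s + k)
        + eigenTail (latticeForm a (1 + 1 / a)) K s := by
  have hw := one_le_one_add_one_div ha
  have h1 : HasSum (fun p => ((latticeForm a (1 + 1 / a) p : ℂ) - 1) ^ (-(2 * s)))
      (doubleZeta a 1 (2 * s)) := by
    simp_rw [latticeForm_sub_one ha]
    simpa using hasSum_latticeForm_cpow ha le_rfl (s := 2 * s) (by simp; linarith)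
  have h2 : ∀ k : ℕ, HasSum (fun p => (latticeForm a (1 + 1 / a) p : ℂ) ^ (-(2 * s + k)))
      (doubleZeta a (1 + 1 / a) (2 * s + k)) := fun k => by
    have hk := k.cast_nonneg (α := ℝ)
    have := hasSum_latticeForm_cpow ha hw (s := 2 * s + k) (by simp; linarith)
    push_cast at this
    exact this
  obtain ⟨h, hS⟩ := tsum_eigenvalue_cpow (two_le_latticeForm ha)
    (fun σ => summable_latticeForm_rpow ha hw) K hs h1.summable
  rw [h1.tsum_eq] at h
  simp_rw [(h2 _).tsum_eq] at h
  rw [← h, hS.tsum_prod]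
  refine tsum_congr fun m => tsum_congr fun n => ?_
  have e1 := latticeForm_sub_one ha (m, n)
  have e2 : (latticeForm a 1 (m, n) : ℂ) = (a : ℂ) * (m + 1) + n := by
    simp only [latticeForm]; push_cast; ring
  rw [e2] at e1
  rw [e1, ← e1, sub_add_cancel]

/-- A continuation along a connected open set agrees near the end point with any sufficiently far
reaching member of a family of meromorphic continuations to growing half-planes. -/
lemma exists_eventuallyEq_of_continuation {f : ℂ → ℂ} {G : ℕ → ℂ → ℂ} {U : Set ℂ} {c : ℝ} {z : ℂ}
    (hUo : IsOpen U) (hUc : IsConnected U) (hz : z ∈ U) (hcU : {s : ℂ | c < s.re} ⊆ U)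
    (hf : AnalyticOnNhd ℂ f U) (hfG : ∀ K, ∀ s : ℂ, c < s.re → f s = G K s)
    (hG : ∀ K : ℕ, ∀ s : ℂ, 2 < 2 * s.re + K → MeromorphicAt (G K) s) (K₀ : ℕ) :
    ∃ K, K₀ ≤ K ∧ f =ᶠ[𝓝[≠] z] G K := by
  have hc1 : ((c + 1 : ℝ) : ℂ) ∈ {s : ℂ | c < s.re} := by simp
  obtain ⟨γ, hγ⟩ := (hUo.isConnected_iff_isPathConnected.mp hUc).joinedIn _ hz _ (hcU hc1)
  have hcont : Continuous fun t => (γ t).re := Complex.continuous_re.comp γ.continuous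
  obtain ⟨B, hB⟩ := (isCompact_range hcont).bddBelow
  obtain ⟨K₁, hK₁⟩ := exists_nat_gt (2 - 2 * B)
  refine ⟨max K₀ K₁, le_max_left _ _, ?_⟩
  have hK : (K₁ : ℝ) ≤ (max K₀ K₁ : ℕ) := by exact_mod_cast le_max_right _ _
  set K := max K₀ K₁
  have hmer : MeromorphicOn (f - G K) (range γ) := by
    rintro _ ⟨t, rfl⟩
    refine (hf _ (hγ t)).meromorphicAt.sub (hG K _ ?_)
    have := hB (mem_range_self t)
    linarith
  have htop : meromorphicOrderAt (f - G K) ((c + 1 : ℝ) : ℂ) = ⊤ := by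
    rw [meromorphicOrderAt_eq_top_iff]
    refine Filter.Eventually.filter_mono nhdsWithin_le_nhds ?_
    filter_upwards [(isOpen_lt continuous_const Complex.continuous_re).mem_nhds hc1] with s hs
    rw [Pi.sub_apply, hfG K s hs, sub_self]
  have hend : meromorphicOrderAt (f - G K) z = ⊤ := by
    by_contra h
    exact hmer.meromorphicOrderAt_ne_top_of_isPreconnected (isPreconnected_range γ.continuous)
      ⟨0, γ.source⟩ ⟨1, γ.target⟩ h htop
  rw [meromorphicOrderAt_eq_top_iff] at hend
  filter_upwards [hend] with s hs using sub_eq_zero.mp hs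

lemma analyticAt_eigenTail {ι : Type*} {v : ι → ℝ} (hv : ∀ i, 2 ≤ v i)
    (hsum : ∀ σ : ℝ, 2 < σ → Summable fun i => v i ^ (-σ)) {K : ℕ} {s : ℂ}
    (hs : 2 < 2 * s.re + K) : AnalyticAt ℂ (eigenTail v K) s := by
  have ho : IsOpen {s : ℂ | 2 < 2 * s.re + K} :=
    isOpen_lt continuous_const (by fun_prop)
  exact DifferentiableOn.analyticAt (s := {s : ℂ | 2 < 2 * s.re + K})
    (fun z hz => (differentiableAt_eigenTail hv hsum hz).differentiableWithinAt) (ho.mem_nhds hs)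

lemma meromorphicAt_sum_eigenCoeff_mul {h : ℂ → ℂ} (hh : ∀ s, MeromorphicAt h s) (K : ℕ) (s : ℂ) :
    MeromorphicAt (fun s => ∑ k ∈ Finset.range K, eigenCoeff k s * h (2 * s + k)) s :=
  MeromorphicAt.fun_sum fun k _ =>
    ((differentiable_eigenCoeff k).analyticAt s).meromorphicAt.mul
      ((hh (2 * s + k)).comp_analyticAt (g := fun s : ℂ => 2 * s + (k : ℂ)) (by fun_prop))

lemma meromorphicAt_spectralModel {a : ℝ} (ha : 1 ≤ a) {K : ℕ} {s : ℂ} (hs : 2 < 2 * s.re + K) :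
    MeromorphicAt (spectralModel a K) s := by
  have hw := one_le_one_add_one_div ha
  have hw' : 1 ≤ (1 + 1 / a : ℂ).re := by
    rw [← Complex.ofReal_one, ← Complex.ofReal_div, ← Complex.ofReal_add]; exact hw
  have h2 : MeromorphicAt (fun s : ℂ => (2 : ℂ)) s := MeromorphicAt.const _ _
  have e1 := ((meromorphicAt_hurwitz (w := 1) (by simp) (2 * s)).comp_analyticAt
    (g := fun s => 2 * s) (by fun_prop)).div h2
  have e2 := meromorphicAt_sum_eigenCoeff_mul (meromorphicAt_hurwitz (w := 2) (by simp)) K s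
  have e3 := (analyticAt_eigenTail (v := fun n : ℕ => (n : ℝ) + 2) (fun n => by simp)
    (fun σ => summable_add_two_rpow) hs).meromorphicAt
  have e4 := ((meromorphicAt_doubleZeta ha (w := 1) (by simp) (2 * s)).comp_analyticAt
    (g := fun s => 2 * s) (by fun_prop)).div h2
  have e5 := meromorphicAt_sum_eigenCoeff_mul (meromorphicAt_doubleZeta ha hw') K s
  have e6 := (analyticAt_eigenTail (two_le_latticeForm ha)
    (fun σ => summable_latticeForm_rpow ha hw) hs).meromorphicAt
  exact ((e1.add e2).add e3).add (h2.mul ((e4.add e5).add e6))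

lemma exists_hasDerivAt_sum_eigenCoeff_mul {h R : ℂ → ℂ} {h' : ℂ} (h0 : HasDerivAt h h' 0)
    (hR : DifferentiableAt ℂ R 2) (hRh : ∀ s, s ≠ 2 → (s - 2) * h s = R s)
    (hk : ∀ k : ℕ, 3 ≤ k → DifferentiableAt ℂ h k) {K : ℕ} (hK : 3 ≤ K) :
    ∃ g : ℂ → ℂ, g =ᶠ[𝓝[≠] 0] (fun s => ∑ k ∈ Finset.range K, eigenCoeff k s * h (2 * s + k)) ∧
      HasDerivAt g (h' - R 2 / 4) 0 := by
  have hcomp : ∀ (φ : ℂ → ℂ) (d k : ℂ), HasDerivAt φ d k →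
      HasDerivAt (fun s : ℂ => φ (2 * s + k)) (d * 2) 0 := fun φ d k hφ => by
    have hlin : HasDerivAt (fun s : ℂ => 2 * s + k) 2 0 := by
      simpa using ((hasDerivAt_id' (0 : ℂ)).const_mul 2).add_const k
    exact HasDerivAt.comp_of_eq (0 : ℂ) hφ hlin (by simp)
  obtain ⟨K, rfl⟩ := Nat.exists_eq_add_of_le' hK
  have e0 : HasDerivAt (fun s => 1 / 2 * h (2 * s + 0)) h' 0 :=
    ((hcomp h h' 0 h0).const_mul (1 / 2)).congr_deriv (by ring)
  have e2 : HasDerivAt (fun s : ℂ => -(s / 4) * R (2 * s + 2)) (-(R 2 / 4)) 0 := by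
    refine (((hasDerivAt_id' (0 : ℂ)).div_const 4).fun_neg.fun_mul
      (hcomp R _ 2 hR.hasDerivAt)).congr_deriv ?_
    simp; ring
  have e3 : HasDerivAt (fun s : ℂ => ∑ k ∈ Finset.range K,
      eigenCoeff (k + 3) s * h (2 * s + (k + 3 : ℕ))) 0 0 := by
    have : ∀ k ∈ Finset.range K,
        HasDerivAt (fun s : ℂ => eigenCoeff (k + 3) s * h (2 * s + (k + 3 : ℕ))) 0 0 := by
      intro k _
      refine ((hasDerivAt_eigenCoeff (k + 3)).fun_mul
        (hcomp h _ _ (hk (k + 3) (by omega)).hasDerivAt)).congr_deriv ?_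
      rw [eigenCoeff_succ_at_zero]; ring
    simpa using HasDerivAt.fun_sum this
  refine ⟨_, ?_, ((e0.add e2).add e3).congr_deriv (by ring)⟩
  filter_upwards [self_mem_nhdsWithin] with s hs
  have hs0 : s ≠ 0 := hs
  have hR' := hRh (2 * s + 2) (by simpa using hs0)
  rw [Finset.sum_range_succ', Finset.sum_range_succ', Finset.sum_range_succ', eigenCoeff_zero,
    eigenCoeff_one, eigenCoeff_two]
  simp only [Pi.add_apply, ← hR']
  push_cast
  ring_nf

lemma exists_hasDerivAt_spectralModel {a : ℝ} (ha : 1 ≤ a) {d₁ d₂ : ℂ}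
    (h₁ : HasDerivAt (doubleZeta a 1) d₁ 0)
    (h₂ : HasDerivAt (doubleZeta a (1 + 1 / a)) d₂ 0) {K : ℕ} (hK : 3 ≤ K) :
    ∃ g : ℂ → ℂ, g =ᶠ[𝓝[≠] 0] spectralModel a K ∧
      HasDerivAt g (2 * hurwitzDerivZero 1 + 2 * d₁ + 2 * d₂ - 1 / (2 * a)) 0 := by
  have hw := one_le_one_add_one_div ha
  have hw' : 1 ≤ (1 + 1 / a : ℂ).re := by
    rw [← Complex.ofReal_one, ← Complex.ofReal_div, ← Complex.ofReal_add]; exact hw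
  have hne : ∀ k : ℕ, 3 ≤ k → (k : ℂ) ≠ 1 ∧ (k : ℂ) ≠ 2 := fun k hk =>
    ⟨by norm_cast; omega, by norm_cast; omega⟩
  have hhalf : ∀ (φ : ℂ → ℂ) (d : ℂ), HasDerivAt φ d 0 →
      HasDerivAt (fun s : ℂ => φ (2 * s) / 2) d 0 := fun φ d hφ => by
    have hlin : HasDerivAt (fun s : ℂ => 2 * s) 2 0 := by
      simpa using (hasDerivAt_id' (0 : ℂ)).const_mul 2
    exact ((HasDerivAt.comp_of_eq (0 : ℂ) hφ hlin (by simp)).div_const 2).congr_deriv (by ring)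
  obtain ⟨R, hR, hR2, hRh⟩ := exists_doubleZeta_residue ha hw'
  obtain ⟨g₁, hg₁, hd₁⟩ := exists_hasDerivAt_sum_eigenCoeff_mul
    (hasDerivAt_hurwitz_zero (w := 2) (by simp)) (R := fun s => (s - 2) * hurwitz s 2)
    ((differentiableAt_id.sub_const 2).mul (differentiableAt_hurwitz (by simp) (by norm_num)))
    (fun s _ => rfl) (fun k hk => differentiableAt_hurwitz (by simp) (hne k hk).1) hK
  obtain ⟨g₂, hg₂, hd₂⟩ := exists_hasDerivAt_sum_eigenCoeff_mul h₂ hR hRh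
    (fun k hk => differentiableAt_doubleZeta ha hw' (hne k hk).1 (hne k hk).2) hK
  have e := (((hhalf _ _ (hasDerivAt_hurwitz_zero (w := 1) (by simp))).add hd₁).add
    (hasDerivAt_eigenTail_zero (v := fun n : ℕ => (n : ℝ) + 2) (fun n => by simp)
      (fun σ => summable_add_two_rpow) hK)).add
    ((((hhalf _ _ h₁).add hd₂).add (hasDerivAt_eigenTail_zero (two_le_latticeForm ha)
      (fun σ => summable_latticeForm_rpow ha hw) hK)).const_mul 2)
  have h12 : hurwitzDerivZero 2 = hurwitzDerivZero 1 := by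
    rw [show (2 : ℂ) = 1 + 1 by norm_num, hurwitzDerivZero_add_one (by simp)]
    simp
  refine ⟨_, ?_, e.congr_deriv ?_⟩
  · filter_upwards [hg₁, hg₂] with s hs₁ hs₂
    simp only [Pi.add_apply, hs₁, hs₂, spectralModel]
  · rw [h12, hR2, sub_self, zero_mul]
    ring

lemma deriv_hurwitz_one_neg_one : deriv (fun s => hurwitz s 1) (-1) = deriv riemannZeta (-1) := by
  refine Filter.EventuallyEq.deriv_eq ?_
  filter_upwards [isOpen_ne.mem_nhds (show (-1 : ℂ) ≠ 1 by norm_num)] with s hs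
  exact hurwitz_one hs

lemma deriv_hurwitz_eq_of_tsum {w : ℂ} (hw : 1 ≤ w.re) {H : ℂ → ℂ}
    (hH : AnalyticOnNhd ℂ H {s : ℂ | s ≠ 1})
    (hH_eq : ∀ s : ℂ, 1 < s.re → H s = ∑' n : ℕ, ((n : ℂ) + w) ^ (-s)) {s : ℂ} (hs : s ≠ 1) :
    deriv (fun s => hurwitz s w) s = deriv H s := by
  refine Filter.EventuallyEq.deriv_eq ?_
  filter_upwards [isOpen_ne.mem_nhds hs] with z hz
  refine eq_of_eq_of_one_lt_re (fun z hz => differentiableAt_hurwitz hw hz)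
    (fun z hz => (hH z hz).differentiableAt) (fun z hz => ?_) hz
  rw [hH_eq z hz, (hasSum_hurwitz hz hw).tsum_eq]

lemma zetaS2_eq_spectralModel {a : ℝ} (ha : 1 ≤ a) (K : ℕ) {s : ℂ} (hs : 2 < s.re) :
    zetaS2 a s = spectralModel a K s := by
  rw [zetaS2, spectralModel, tsum_single_eigenvalue K hs, tsum_double_eigenvalue ha K hs]

lemma deriv_of_isContinuationAt {a : ℝ} (ha : 1 ≤ a) {d₁ d₂ : ℂ}
    (h₁ : HasDerivAt (doubleZeta a 1) d₁ 0)
    (h₂ : HasDerivAt (doubleZeta a (1 + 1 / a)) d₂ 0) {f : ℂ → ℂ}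
    (hf : IsContinuationAt (zetaS2 a) 2 0 f) :
    deriv f 0 = 2 * hurwitzDerivZero 1 + 2 * d₁ + 2 * d₂ - 1 / (2 * a) := by
  obtain ⟨U, hUo, hUc, h0, hcU, hfU, hfF⟩ := hf
  obtain ⟨K, hK, hfK⟩ := exists_eventuallyEq_of_continuation (G := spectralModel a) hUo hUc h0 hcU
    hfU (fun K s hs => (hfF s hs).trans (zetaS2_eq_spectralModel ha K hs))
    (fun K s hs => meromorphicAt_spectralModel ha hs) 3
  obtain ⟨g, hg, hd⟩ := exists_hasDerivAt_spectralModel ha h₁ h₂ hK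
  have : f =ᶠ[𝓝 0] g := ((hfU 0 h0).continuousAt.eventuallyEq_nhds_iff_eventuallyEq_nhdsNE
    hd.continuousAt).mp (hfK.trans hg.symm)
  rw [this.deriv_eq, hd.deriv]

end DeformedSphere

/-- for `a ≥ 1`, every analytic continuation `f` to `0` of the spectral zeta
function `Z(s) = ζ(s, Δ_{S²_{1/a}})` (absolutely convergent for `Re s > 2`) satisfies
`f′(0) = −(a/3 + 1/(3a))·log a − 2·log(2π) + logΓ(1 + 1/a) + a/3 + 1 + 1/(2a)`
`− 2a·ζ′(−1) − 2a·ζ_H′(−1, 1 + 1/a)`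
`+ 2i·∫₀^∞ [logΓ(1+iy/a) + logΓ(1+1/a+iy/a) − logΓ(1−iy/a) − logΓ(1+1/a−iy/a)]/(e^{2πy}−1) dy`.
Here `Hz` is the Hurwitz zeta function `ζ_H(·, 1 + 1/a)` (the analytic continuation of
`∑_{n≥0} (n + 1 + 1/a)^{-s}`), and `LG` is the analytic branch of `logΓ` on the right
half-plane with `LG 1 = 0`. -/
theorem stmt12 (a : ℝ) (ha : 1 ≤ a)
    (LG : ℂ → ℂ) (hLG_an : AnalyticOnNhd ℂ LG {w : ℂ | 0 < w.re})
    (hLG_exp : ∀ w : ℂ, 0 < w.re → Complex.exp (LG w) = Complex.Gamma w)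
    (hLG_one : LG 1 = 0)
    (Hz : ℂ → ℂ) (hHz_an : AnalyticOnNhd ℂ Hz {s : ℂ | s ≠ 1})
    (hHz_eq : ∀ s : ℂ, 1 < s.re →
      Hz s = ∑' n : ℕ, (((n : ℝ) + (1 + 1 / a) : ℝ) : ℂ) ^ (-s)) :
    ∀ f : ℂ → ℂ, IsContinuationAt (zetaS2 a) 2 0 f →
      deriv f 0 =
        -(((a : ℂ) / 3 + 1 / (3 * (a : ℂ))) * (Real.log a : ℂ))
          - 2 * (Real.log (2 * Real.pi) : ℂ)
          + LG (1 + 1 / (a : ℂ))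
          + (a : ℂ) / 3 + 1 + 1 / (2 * (a : ℂ))
          - 2 * (a : ℂ) * deriv riemannZeta (-1)
          - 2 * (a : ℂ) * deriv Hz (-1)
          + 2 * Complex.I * ∫ y in Set.Ioi (0 : ℝ),
              (LG (1 + Complex.I * (y : ℂ) / (a : ℂ))
                + LG (1 + 1 / (a : ℂ) + Complex.I * (y : ℂ) / (a : ℂ))
                - LG (1 - Complex.I * (y : ℂ) / (a : ℂ))
                - LG (1 + 1 / (a : ℂ) - Complex.I * (y : ℂ) / (a : ℂ)))
              * ((Real.exp (2 * Real.pi * y) - 1 : ℝ) : ℂ)⁻¹ := by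
  intro f hf
  have ha0 : 0 < a := by linarith
  have haC : (a : ℂ) ≠ 0 := Complex.ofReal_ne_zero.mpr ha0.ne'
  have hw : 1 ≤ (1 + 1 / a : ℂ).re := by
    rw [← Complex.ofReal_one, ← Complex.ofReal_div, ← Complex.ofReal_add]
    exact DeformedSphere.one_le_one_add_one_div ha
  have hLG : ∀ {w : ℂ}, 1 ≤ w.re →
      DeformedSphere.hurwitzDerivZero w = LG w - Real.log (2 * Real.pi) / 2 := fun hw =>
    DeformedSphere.hurwitzDerivZero_eq_logGamma hLG_an hLG_exp hLG_one hw
  have hHz : deriv (fun s => DeformedSphere.hurwitz s (1 + 1 / a)) (-1) = deriv Hz (-1) := by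
    refine DeformedSphere.deriv_hurwitz_eq_of_tsum hw hHz_an (fun s hs => ?_) (by norm_num)
    rw [hHz_eq s hs]
    push_cast
    rfl
  have hi := fun {w : ℂ} (hw : 1 ≤ w.re) =>
    (DeformedSphere.hasDerivAt_hurwitzDiffIntegral_zero hw (inv_pos.mpr ha0)
      (inv_le_one_of_one_le₀ ha)).1
  have hint : (∫ y in Set.Ioi (0 : ℝ),
              (LG (1 + Complex.I * (y : ℂ) / (a : ℂ))
                + LG (1 + 1 / (a : ℂ) + Complex.I * (y : ℂ) / (a : ℂ))
                - LG (1 - Complex.I * (y : ℂ) / (a : ℂ))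
                - LG (1 + 1 / (a : ℂ) - Complex.I * (y : ℂ) / (a : ℂ)))
              * ((Real.exp (2 * Real.pi * y) - 1 : ℝ) : ℂ)⁻¹) = _ :=
    (MeasureTheory.integral_congr_ae (Filter.Eventually.of_forall fun y => ?_)).trans
      (MeasureTheory.integral_add (hi (w := 1) (by simp)) (hi hw))
  · rw [DeformedSphere.deriv_of_isContinuationAt ha
      (DeformedSphere.hasDerivAt_doubleZeta_zero ha (w := 1) (by simp))
      (DeformedSphere.hasDerivAt_doubleZeta_zero ha hw) hf, hint,
      DeformedSphere.deriv_hurwitz_one_neg_one, hHz, hLG hw, hLG (w := 1) (by simp), hLG_one]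
    field_simp
    ring
  · have e : Complex.I * ((a⁻¹ * y : ℝ) : ℂ) = Complex.I * y / a := by
      push_cast; ring
    have hre : (Complex.I * y / a).re = 0 := by
      rw [← e]; simp
    simp only [e]
    rw [hLG, hLG, hLG, hLG, DeformedSphere.boseWeight, Complex.ofReal_inv]
    · ring
    all_goals
      first | rw [Complex.add_re, hre, add_zero] | rw [Complex.sub_re, hre, sub_zero]
      first | exact hw | simp
end

section
/- Let a ≥ 1 be a real number and let Z(s) = ∑_{n=1}^∞ (n+1)·(n(n+2))^{-s} + 2·∑_{m=1}^∞ ∑_{n=0}^∞ (n+1)·((a m + n)(a m + n + 2))^{-s}, which converges absolutely for Re(s) > 3. Then every analytic continuation f of this series to the point 0 satisfies f(0) = −1 (independently of a). -/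
/-- The spectral zeta function of the Laplacian on the 3-dimensional deformed sphere
`S³_{1/a}`:
`Z(s) = ∑_{n≥1} (n+1)(n(n+2))^{-s} + 2·∑_{m≥1} ∑_{n≥0} (n+1)((am+n)(am+n+2))^{-s}`. -/
noncomputable def zetaS3 (a : ℝ) : ℂ → ℂ := fun s =>
  (∑' n : ℕ, ((n : ℂ) + 2) * (((n : ℂ) + 1) * ((n : ℂ) + 3)) ^ (-s))
    + 2 * ∑' (m : ℕ) (n : ℕ),
        ((n : ℂ) + 1) * (((a : ℂ) * (m + 1) + n) * ((a : ℂ) * (m + 1) + n + 2)) ^ (-s)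

section

open Filter Topology Asymptotics Set MeasureTheory

/-- An odd function that is meromorphic at `0` has a Laurent expansion with odd exponents only. -/
theorem exists_odd_laurent_expansion {g : ℝ → ℝ} (hg : MeromorphicAt g 0)
    (hodd : ∀ t, t ≠ 0 → g (-t) = -g t) :
    ∃ (n : ℕ) (b : ℕ → ℝ), (∀ i, Even (n + i) → b i = 0) ∧ ∀ J : ℕ,
      (fun t => g t - ∑ i ∈ Finset.range J, b i * t ^ ((i : ℤ) - n))
        =O[𝓝[>] 0] fun t => t ^ ((J : ℤ) - n) := by
  obtain ⟨n, p, hp⟩ := hg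
  refine ⟨n, fun i => p.coeff i * (1 - (-1) ^ (n + i)) / 2, ?_, ?_⟩
  · intro i hi
    simp [hi.neg_one_pow]
  intro J
  set R : ℝ → ℝ := fun t => t ^ n * g t - p.partialSum J t with hR
  have hO : R =O[𝓝 0] fun t => t ^ J := by
    have := hp.isBigO_sub_partialSum_pow J
    simp only [zero_add, sub_zero, smul_eq_mul] at this
    refine this.trans ?_
    refine IsBigO.of_norm_right ?_
    simp only [norm_pow]
    exact isBigO_refl _ _
  have hO' : (fun t => R (-t)) =O[𝓝 0] fun t => t ^ J := by
    have h := hO.comp_tendsto (show Tendsto (fun t : ℝ => -t) (𝓝 0) (𝓝 0) by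
      simpa using (continuous_neg.tendsto (0 : ℝ)))
    refine h.trans ?_
    refine ((isBigO_refl (fun t : ℝ => t ^ J) (𝓝 0)).const_mul_left ((-1) ^ J)).congr_left ?_
    intro t
    exact (neg_pow t J).symm
  have hsum : (fun t => (R t - (-1) ^ n * R (-t)) / 2) =O[𝓝 0] fun t => t ^ J := by
    have := (hO.sub (hO'.const_mul_left ((-1) ^ n))).const_mul_left (1 / 2)
    refine this.congr_left fun t => by ring
  have hmul := (isBigO_refl (fun t : ℝ => t ^ (-(n : ℤ))) (𝓝[>] 0)).mul
    (hsum.mono (nhdsWithin_le_nhds (s := Ioi 0)))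
  refine hmul.congr' ?_ ?_
  · filter_upwards [self_mem_nhdsWithin] with t (ht : 0 < t)
    have hne : t ≠ 0 := ht.ne'
    have hs : ∀ x : ℝ, p.partialSum J x = ∑ i ∈ Finset.range J, p.coeff i * x ^ i := by
      intro x
      simp [FormalMultilinearSeries.partialSum, mul_comm]
    simp only [hR, hodd t hne, hs]
    have e1 : ∑ i ∈ Finset.range J, p.coeff i * (1 - (-1) ^ (n + i)) / 2 * t ^ ((i : ℤ) - n)
        = t ^ (-(n : ℤ)) * ((∑ i ∈ Finset.range J, p.coeff i * t ^ i
          - (-1) ^ n * ∑ i ∈ Finset.range J, p.coeff i * (-t) ^ i) / 2) := by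
      rw [Finset.mul_sum, ← Finset.sum_sub_distrib, Finset.sum_div, Finset.mul_sum]
      refine Finset.sum_congr rfl fun i _ => ?_
      rw [sub_eq_add_neg (i : ℤ), add_comm (i : ℤ), zpow_add₀ hne, neg_pow t, pow_add, zpow_natCast]
      ring
    rw [e1]
    have e2 : g t = t ^ (-(n : ℤ)) * ((t ^ n * g t - (-1) ^ n * ((-t) ^ n * (-g t))) / 2) := by
      rw [neg_pow t]
      have : ((-1 : ℝ)) ^ n * (-1) ^ n = 1 := by rw [← mul_pow]; simp
      have h3 : t ^ (-(n : ℤ)) * t ^ n = 1 := by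
        rw [zpow_neg, zpow_natCast]; field_simp
      linear_combination (-g t) * h3 / 2 - g t * h3 / 2 * ((-1 : ℝ) ^ n * (-1) ^ n) - g t / 2 * this
    conv_rhs => rw [e2]
    ring
  · filter_upwards [self_mem_nhdsWithin] with t (ht : 0 < t)
    rw [← zpow_natCast, ← zpow_add₀ ht.ne']
    ring_nf

/-- The Mellin transform of a rapidly decaying odd function that is meromorphic at `0` continues
meromorphically to every half-plane, and the continuation is regular at even integers. -/
theorem exists_mellin_continuation {g : ℝ → ℝ} (hc : ContinuousOn g (Ioi 0))
    (hdecay : ∀ A : ℝ, g =O[atTop] fun t => t ^ (-A)) (hg : MeromorphicAt g 0)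
    (hodd : ∀ t, t ≠ 0 → g (-t) = -g t) :
    ∃ x₀ : ℝ, ∀ L : ℝ, ∃ M : ℂ → ℂ, (∀ w : ℂ, -L < w.re → MeromorphicAt M w) ∧
      (∀ w : ℂ, -L < w.re → (∃ k : ℤ, w = 2 * k) → AnalyticAt ℂ M w) ∧
      ∀ w : ℂ, x₀ < w.re → M w = mellin (fun t => (g t : ℂ)) w := by
  obtain ⟨n, b, hb, hO⟩ := exists_odd_laurent_expansion hg hodd
  refine ⟨n, fun L => ?_⟩
  obtain ⟨J, hJ⟩ := exists_nat_gt (n + L)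
  have hlg : LocallyIntegrableOn (fun t => (g t : ℂ)) (Ioi 0) :=
    (Complex.continuous_ofReal.comp_continuousOn hc).locallyIntegrableOn measurableSet_Ioi
  set T : ℕ → ℝ → ℂ := fun i => indicator (Ioc 0 1) (fun t : ℝ => (t : ℂ) ^ ((i : ℂ) - n)) with hT
  have hlT : ∀ i, LocallyIntegrableOn (T i) (Ioi 0) := by
    intro i
    have h1 : ContinuousOn (fun t : ℝ => (t : ℂ) ^ ((i : ℂ) - n)) (Ioi 0) := by
      intro t ht
      refine ContinuousAt.continuousWithinAt ?_
      exact Complex.continuousAt_ofReal_cpow_const _ _ (Or.inr (ne_of_gt ht))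
    rw [locallyIntegrableOn_iff isOpen_Ioi.isLocallyClosed]
    intro k hk hkc
    exact ((h1.mono hk).integrableOn_compact hkc).indicator measurableSet_Ioc
  set rem : ℝ → ℂ := fun t => (g t : ℂ) - ∑ i ∈ Finset.range J, (b i : ℂ) * T i t with hrem
  have hlsum : LocallyIntegrableOn
      (fun t => ∑ i ∈ Finset.range J, (b i : ℂ) * T i t) (Ioi 0) := by
    induction Finset.range J using Finset.induction_on with
    | empty => simpa using locallyIntegrableOn_zero
    | insert i s hi ih =>
      simp only [Finset.sum_insert hi]
      exact ((hlT i).smul (b i : ℂ)).add ih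
  have hlrem : LocallyIntegrableOn rem (Ioi 0) := hlg.sub hlsum
  have hremtop : ∀ A : ℝ, rem =O[atTop] fun t => t ^ (-A) := by
    intro A
    refine (Complex.isBigO_ofReal_left.2 (hdecay A)).congr' ?_ EventuallyEq.rfl
    filter_upwards [eventually_gt_atTop 1] with t ht
    have : ∀ i, T i t = 0 := fun i => indicator_of_notMem (fun h => by linarith [h.2]) _
    simp [hrem, this]
  have hrembot : rem =O[𝓝[>] 0] fun t => t ^ (-((n : ℝ) - J)) := by
    refine (Complex.isBigO_ofReal_left.2 (hO J)).congr' ?_ ?_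
    · filter_upwards [Ioc_mem_nhdsGT (zero_lt_one' ℝ)] with t ht
      have : ∀ i, T i t = ((t ^ ((i : ℤ) - n) : ℝ) : ℂ) := by
        intro i
        rw [hT]
        simp only [indicator_of_mem ht]
        rw [Complex.ofReal_zpow, ← Complex.cpow_intCast]
        push_cast
        rfl
      simp [hrem, this]
    · filter_upwards [self_mem_nhdsWithin] with t ht
      rw [← Real.rpow_intCast]
      push_cast
      ring_nf
  have hgbot : (fun t => (g t : ℂ)) =O[𝓝[>] 0] fun t => t ^ (-(n : ℝ)) := by
    refine (Complex.isBigO_ofReal_left.2 (hO 0)).congr' ?_ ?_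
    · simp
    · filter_upwards [self_mem_nhdsWithin] with t ht
      rw [← Real.rpow_intCast]
      simp
  set M : ℂ → ℂ := fun w => mellin rem w
      + ∑ i ∈ Finset.range J, (b i : ℂ) * (1 / (w + ((i : ℂ) - n))) with hM
  have han : ∀ w : ℂ, -L < w.re → AnalyticAt ℂ (mellin rem) w := by
    intro w hw
    have : DifferentiableOn ℂ (mellin rem) {z : ℂ | -L < z.re} := by
      intro z (hz : -L < z.re)
      exact (mellin_differentiableAt_of_isBigO_rpow (a := z.re + 1) hlrem (hremtop _) (by linarith)
        hrembot (by linarith)).differentiableWithinAt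
    exact this.analyticAt ((isOpen_lt continuous_const Complex.continuous_re).mem_nhds hw)
  refine ⟨M, ?_, ?_, ?_⟩
  · intro w hw
    refine (han w hw).meromorphicAt.add ?_
    fun_prop
  · rintro w hw ⟨k, rfl⟩
    refine (han _ hw).add ?_
    refine Finset.analyticAt_fun_sum _ fun i _ => ?_
    by_cases hi : Even (n + i)
    · simp only [hb i hi, Complex.ofReal_zero, zero_mul]
      exact analyticAt_const
    · have : (2 * (k : ℂ) + ((i : ℂ) - n)) ≠ 0 := by
        intro h
        apply hi
        have h' : 2 * k + ((i : ℤ) - n) = 0 := by exact_mod_cast h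
        exact ⟨(n - k).toNat, by omega⟩
      fun_prop (disch := assumption)
  · intro w hw
    have hgm : MellinConvergent (fun t => (g t : ℂ)) w :=
      mellinConvergent_of_isBigO_rpow (a := w.re + 1) hlg
        (Complex.isBigO_ofReal_left.2 (hdecay _)) (by linarith) hgbot hw
    have hTm : ∀ i, HasMellin (T i) w (1 / (w + ((i : ℂ) - n))) := by
      intro i
      apply hasMellin_cpow_Ioc
      simp
      have : (0 : ℝ) ≤ i := by positivity
      linarith
    have hs : HasMellin (fun t => ∑ i ∈ Finset.range J, (b i : ℂ) * T i t) w
        (∑ i ∈ Finset.range J, (b i : ℂ) * (1 / (w + ((i : ℂ) - n)))) := by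
      induction Finset.range J using Finset.induction_on with
      | empty => simp [HasMellin, MellinConvergent, mellin]
      | insert i s hi ih =>
        simp only [Finset.sum_insert hi]
        have h1 := hasMellin_const_smul (hTm i).1 (b i : ℂ)
        rw [(hTm i).2] at h1
        have h2 := hasMellin_add h1.1 ih.1
        rw [h1.2, ih.2] at h2
        exact h2
    simp only [hM, hrem]
    rw [(hasMellin_sub hgm hs.1).2, hs.2]
    ring

/-- The coefficients of the binomial series `(1 - u) ^ (-s) = ∑ aₖ(s) uᵏ`. -/
noncomputable def binomCoeff : ℕ → ℂ → ℂ
  | 0, _ => 1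
  | k + 1, s => s * binomCoeff k (s + 1) / (k + 1)

theorem differentiable_binomCoeff (k : ℕ) : Differentiable ℂ (binomCoeff k) := by
  induction k with
  | zero => exact differentiable_const _
  | succ k ih =>
    have : Differentiable ℂ fun s => binomCoeff k (s + 1) := ih.comp (by fun_prop)
    change Differentiable ℂ fun s => s * binomCoeff k (s + 1) / (k + 1)
    fun_prop

/-- The remainder of the binomial series. -/
noncomputable def binomRem (M : ℕ) (s : ℂ) (u : ℝ) : ℂ :=
  (1 - u : ℂ) ^ (-s) - ∑ k ∈ Finset.range M, binomCoeff k s * (u : ℂ) ^ k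

theorem hasDerivAt_binomRem_succ (M : ℕ) (s : ℂ) {u : ℝ} (hu : u < 1) :
    HasDerivAt (binomRem (M + 1) s) (s * binomRem M (s + 1) u) u := by
  have h0 : HasDerivAt (fun u : ℝ => (u : ℂ)) 1 u := Complex.ofRealCLM.hasDerivAt
  have hs : (1 - u : ℂ) ∈ Complex.slitPlane := by
    rw [show (1 - u : ℂ) = ((1 - u : ℝ) : ℂ) by push_cast; ring]
    exact Complex.ofReal_mem_slitPlane.2 (by linarith)
  have h1 := (((hasDerivAt_id (u : ℂ)).const_sub 1).cpow_const (c := -s) hs).comp_ofReal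
  have h2 : HasDerivAt (fun u : ℝ => ∑ k ∈ Finset.range (M + 1), binomCoeff k s * (u : ℂ) ^ k)
      (∑ k ∈ Finset.range (M + 1), binomCoeff k s * (k * (u : ℂ) ^ (k - 1) * 1)) u :=
    HasDerivAt.fun_sum fun k _ => (h0.pow k).const_mul _
  refine (h1.sub h2).congr_deriv ?_
  rw [Finset.sum_range_succ', binomRem, mul_sub, Finset.mul_sum]
  congr 1
  · rw [show -s - 1 = -(s + 1) by ring]
    simp only [id]
    ring
  · simp only [Nat.cast_zero, zero_mul, mul_zero, add_zero]
    refine Finset.sum_congr rfl fun k _ => ?_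
    have : (k : ℂ) + 1 ≠ 0 := by exact_mod_cast k.succ_ne_zero
    simp only [binomCoeff, Nat.add_sub_cancel]
    push_cast
    field_simp

theorem exists_norm_binomRem_le (M : ℕ) (B : ℝ) :
    ∃ C : ℝ, 0 ≤ C ∧ ∀ s : ℂ, ‖s‖ ≤ B → ∀ u : ℝ, 0 ≤ u → u ≤ 1 / 4 →
      ‖binomRem M s u‖ ≤ C * u ^ M := by
  induction M generalizing B with
  | zero =>
    refine ⟨(3 / 4 : ℝ) ^ (-B), by positivity, fun s hs u hu hu' => ?_⟩
    have h1 : (1 - u : ℂ) = ((1 - u : ℝ) : ℂ) := by push_cast; ring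
    simp only [binomRem, Finset.range_zero, Finset.sum_empty, sub_zero, pow_zero, mul_one]
    rw [h1, Complex.norm_cpow_eq_rpow_re_of_pos (by linarith)]
    have hre : s.re ≤ B := (Complex.re_le_norm s).trans hs
    have hre' : -B ≤ s.re := by linarith [neg_le_of_abs_le ((Complex.abs_re_le_norm s).trans hs)]
    calc (1 - u) ^ (-s).re ≤ (1 - u) ^ (-B) :=
          Real.rpow_le_rpow_of_exponent_ge (by linarith) (by linarith) (by simp [hre])
      _ ≤ (3 / 4) ^ (-B) :=
          Real.rpow_le_rpow_of_nonpos (by norm_num) (by linarith)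
            (by linarith [(norm_nonneg s).trans hs])
  | succ M ih =>
    obtain ⟨C, hC, h⟩ := ih (B + 1)
    refine ⟨|B| * C, by positivity, fun s hs u hu hu' => ?_⟩
    have hB : 0 ≤ B := (norm_nonneg s).trans hs
    have hs1 : ‖s + 1‖ ≤ B + 1 := (norm_add_le _ _).trans (by simpa using hs)
    have key := (convex_Icc (0 : ℝ) u).norm_image_sub_le_of_norm_hasDerivWithin_le
      (f := binomRem (M + 1) s) (f' := fun v => s * binomRem M (s + 1) v) (C := B * (C * u ^ M))
      (x := 0) (y := u)
      (fun v hv => (hasDerivAt_binomRem_succ M s (by linarith [hv.2])).hasDerivWithinAt)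
      (fun v hv => by
        rw [norm_mul]
        have := h (s + 1) hs1 v hv.1 (hv.2.trans hu')
        have h3 : C * v ^ M ≤ C * u ^ M := by gcongr; exacts [hv.1, hv.2]
        gcongr
        exact this.trans h3)
      (left_mem_Icc.2 hu) (right_mem_Icc.2 hu)
    have h0 : binomRem (M + 1) s 0 = 0 := by
      simp [binomRem, Finset.sum_range_succ', binomCoeff]
    rw [h0, sub_zero, sub_zero, Real.norm_of_nonneg hu] at key
    rw [abs_of_nonneg hB]
    exact key.trans_eq (by ring)

theorem binomCoeff_zero_right (k : ℕ) : binomCoeff k 0 = if k = 0 then 1 else 0 := by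
  cases k <;> simp [binomCoeff]

theorem differentiable_binomRem (M : ℕ) {u : ℝ} (hu : u < 1) :
    Differentiable ℂ fun s => binomRem M s u := by
  unfold binomRem
  have h : (1 - u : ℂ) ≠ 0 := by
    rw [sub_ne_zero]
    exact_mod_cast hu.ne'
  have := differentiable_binomCoeff
  refine Differentiable.sub ?_ (by fun_prop)
  exact differentiable_neg.const_cpow (Or.inl h)

theorem binomRem_zero {M : ℕ} (hM : M ≠ 0) (u : ℝ) : binomRem M 0 u = 0 := by
  obtain ⟨M, rfl⟩ := Nat.exists_eq_succ_of_ne_zero hM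
  simp [binomRem, binomCoeff_zero_right]

/-- The multiplicity attached to the index `(m, n)`. -/
noncomputable def mult (p : ℕ × ℕ) : ℝ := (p.2 + 1) * if p.1 = 0 then 1 else 2

/-- The multiplicities, with the zero mode removed. -/
noncomputable def redMult (p : ℕ × ℕ) : ℝ := if p = 0 then 0 else mult p

/-- The frequencies `a m + n + 1`; the eigenvalues are `freq a (m, n) ^ 2 - 1`. -/
noncomputable def freq (a : ℝ) (p : ℕ × ℕ) : ℝ := a * p.1 + p.2 + 1

/-- The heat kernel `∑ mult p * exp (-freq a p * t)` in closed form. -/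
noncomputable def heat (a t : ℝ) : ℝ :=
  Real.exp (-t) / (1 - Real.exp (-t)) ^ 2 *
    ((1 + Real.exp (-(a * t))) / (1 - Real.exp (-(a * t))))

theorem mult_nonneg (p : ℕ × ℕ) : 0 ≤ mult p := by
  unfold mult; positivity

theorem mult_le (p : ℕ × ℕ) : mult p ≤ 2 * (p.2 + 1) := by
  unfold mult
  split_ifs <;> nlinarith [(Nat.cast_nonneg p.2 : (0 : ℝ) ≤ p.2)]

theorem redMult_nonneg (p : ℕ × ℕ) : 0 ≤ redMult p := by
  unfold redMult
  split_ifs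
  exacts [le_rfl, mult_nonneg p]

theorem redMult_le (p : ℕ × ℕ) : redMult p ≤ mult p := by
  unfold redMult
  split_ifs
  exacts [mult_nonneg p, le_rfl]

variable {a : ℝ}

theorem add_one_le_freq (ha : 1 ≤ a) (p : ℕ × ℕ) : (p.1 : ℝ) + p.2 + 1 ≤ freq a p := by
  unfold freq
  nlinarith [(Nat.cast_nonneg p.1 : (0 : ℝ) ≤ p.1)]

theorem freq_pos (ha : 1 ≤ a) (p : ℕ × ℕ) : 0 < freq a p :=
  lt_of_lt_of_le (by positivity) (add_one_le_freq ha p)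

theorem two_le_freq (ha : 1 ≤ a) {p : ℕ × ℕ} (hp : p ≠ 0) : 2 ≤ freq a p := by
  refine le_trans ?_ (add_one_le_freq ha p)
  have : 1 ≤ p.1 + p.2 := by
    by_contra! h
    exact hp (Prod.ext (by simp; omega) (by simp; omega))
  have : (1 : ℝ) ≤ p.1 + p.2 := by exact_mod_cast this
  linarith

theorem mul_le_freq_sq (ha : 1 ≤ a) (p : ℕ × ℕ) :
    ((p.1 : ℝ) + 1) * (p.2 + 1) ≤ freq a p ^ 2 := by
  have h := pow_le_pow_left₀ (by positivity) (add_one_le_freq ha p) 2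
  nlinarith [(Nat.cast_nonneg p.1 : (0 : ℝ) ≤ p.1), (Nat.cast_nonneg p.2 : (0 : ℝ) ≤ p.2),
    mul_nonneg (Nat.cast_nonneg p.1 : (0 : ℝ) ≤ p.1) (Nat.cast_nonneg p.2 : (0 : ℝ) ≤ p.2)]

theorem mul_le_freq_sq_sub_one (ha : 1 ≤ a) {p : ℕ × ℕ} (hp : p ≠ 0) :
    ((p.1 : ℝ) + 1) * (p.2 + 1) ≤ freq a p ^ 2 - 1 := by
  have : 1 ≤ p.1 + p.2 := by
    by_contra! h
    exact hp (Prod.ext (by simp; omega) (by simp; omega))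
  have : (1 : ℝ) ≤ p.1 + p.2 := by exact_mod_cast this
  have h := pow_le_pow_left₀ (by positivity) (add_one_le_freq ha p) 2
  nlinarith [(Nat.cast_nonneg p.1 : (0 : ℝ) ≤ p.1), (Nat.cast_nonneg p.2 : (0 : ℝ) ≤ p.2),
    mul_nonneg (Nat.cast_nonneg p.1 : (0 : ℝ) ≤ p.1) (Nat.cast_nonneg p.2 : (0 : ℝ) ≤ p.2)]

theorem summable_mul_rpow {τ : ℝ} (hτ : 2 < τ) :
    Summable fun p : ℕ × ℕ => 2 * ((p.2 : ℝ) + 1) * (((p.1 : ℝ) + 1) * (p.2 + 1)) ^ (-τ) := by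
  have h1 : ∀ x : ℝ, x < -1 → Summable fun n : ℕ => ((n : ℝ) + 1) ^ x := fun x hx => by
    simpa using (summable_nat_add_iff 1).2 (Real.summable_nat_rpow.2 hx)
  have h := ((h1 (-τ) (by linarith)).mul_of_nonneg (h1 (1 - τ) (by linarith))
    (fun _ => by positivity) (fun _ => by positivity)).mul_left 2
  refine h.congr fun p => ?_
  rw [Real.mul_rpow (by positivity) (by positivity), sub_eq_add_neg,
    Real.rpow_add (by positivity), Real.rpow_one]
  ring

theorem summable_mult_mul_freq_rpow (ha : 1 ≤ a) {σ : ℝ} (hσ : 4 < σ) :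
    Summable fun p => mult p * freq a p ^ (-σ) := by
  refine (summable_mul_rpow (τ := σ / 2) (by linarith)).of_nonneg_of_le
    (fun p => mul_nonneg (mult_nonneg p) (Real.rpow_nonneg (freq_pos ha p).le _)) fun p => ?_
  have h : freq a p ^ (-σ) = (freq a p ^ 2) ^ (-(σ / 2)) := by
    rw [← Real.rpow_natCast, ← Real.rpow_mul (freq_pos ha p).le]
    congr 1; push_cast; ring
  rw [h]
  exact mul_le_mul (mult_le p) (Real.rpow_le_rpow_of_nonpos (by positivity)
    (mul_le_freq_sq ha p) (by linarith)) (Real.rpow_nonneg (by positivity) _) (by positivity)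

theorem hasSum_heat (ha : 1 ≤ a) {t : ℝ} (ht : 0 < t) :
    HasSum (fun p => mult p * Real.exp (-freq a p * t)) (heat a t) := by
  set q := Real.exp (-t) with hq
  set r := Real.exp (-(a * t)) with hr
  have hq1 : q < 1 := Real.exp_lt_one_iff.2 (by linarith)
  have hr1 : r < 1 := Real.exp_lt_one_iff.2 (by nlinarith)
  have hq0 : 0 < q := Real.exp_pos _
  have hr0 : 0 < r := Real.exp_pos _
  have h1 : HasSum (fun n : ℕ => ((n : ℝ) + 1) * q ^ (n + 1)) (q / (1 - q) ^ 2) := by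
    have := hasSum_coe_mul_geometric_of_norm_lt_one (𝕜 := ℝ) (r := q)
      (by rwa [Real.norm_of_nonneg hq0.le])
    rw [← hasSum_nat_add_iff' 1] at this
    simpa using this
  have h2 : HasSum (fun m : ℕ => (if m = 0 then (1 : ℝ) else 2) * r ^ m) ((1 + r) / (1 - r)) := by
    have := ((hasSum_geometric_of_lt_one hr0.le hr1).mul_left 2).sub (hasSum_ite_eq (0 : ℕ) (1 : ℝ))
    have hne : 1 - r ≠ 0 := by linarith
    have e : (1 + r) / (1 - r) = 2 * (1 - r)⁻¹ - 1 := by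
      field_simp
      ring
    rw [e]
    refine this.congr_fun fun m => ?_
    split_ifs with h
    · subst h; norm_num
    · ring
  have h3 := h2.mul h1 (h2.summable.mul_of_nonneg h1.summable
    (fun m => by dsimp only; positivity) (fun n => by dsimp only; positivity))
  rw [mul_comm] at h3
  refine h3.congr_fun fun p => ?_
  have e : Real.exp (-freq a p * t) = r ^ p.1 * q ^ (p.2 + 1) := by
    rw [hr, hq, ← Real.exp_nat_mul, ← Real.exp_nat_mul, ← Real.exp_add]
    unfold freq
    congr 1
    push_cast
    ring
  rw [e]
  unfold mult
  ring

theorem heat_neg {t : ℝ} (ha : 1 ≤ a) (ht : t ≠ 0) : heat a (-t) = -heat a t := by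
  unfold heat
  have hat : a * t ≠ 0 := mul_ne_zero (by linarith) ht
  rw [neg_neg, mul_neg, neg_neg, Real.exp_neg, Real.exp_neg]
  have h1 : Real.exp t - 1 ≠ 0 := by
    rw [sub_ne_zero]; simpa using ht
  have h2 : Real.exp (a * t) - 1 ≠ 0 := by
    rw [sub_ne_zero]; simpa using hat
  have h1' : 1 - Real.exp t ≠ 0 := by
    rw [← neg_sub]; exact neg_ne_zero.2 h1
  have h2' : 1 - Real.exp (a * t) ≠ 0 := by
    rw [← neg_sub]; exact neg_ne_zero.2 h2
  have e1 := Real.exp_pos t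
  have e2 := Real.exp_pos (a * t)
  field_simp
  ring

theorem meromorphicAt_heat : MeromorphicAt (heat a) 0 := by
  have h1 : AnalyticAt ℝ (fun t : ℝ => Real.exp (-t)) 0 := by fun_prop
  have h2 : AnalyticAt ℝ (fun t : ℝ => Real.exp (-(a * t))) 0 := by fun_prop
  have h1 := h1.meromorphicAt
  have h2 := h2.meromorphicAt
  unfold heat
  fun_prop

theorem continuousOn_heat (ha : 1 ≤ a) : ContinuousOn (heat a) (Ioi 0) := by
  intro t (ht : 0 < t)
  have h1 : (1 - Real.exp (-t)) ^ 2 ≠ 0 :=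
    pow_ne_zero _ (sub_pos.2 (Real.exp_lt_one_iff.2 (by linarith))).ne'
  have h2 : 1 - Real.exp (-(a * t)) ≠ 0 := (sub_pos.2 (Real.exp_lt_one_iff.2 (by nlinarith))).ne'
  unfold heat
  refine ContinuousAt.continuousWithinAt ?_
  fun_prop (disch := assumption)

theorem heat_isBigO_atTop (ha : 1 ≤ a) (A : ℝ) : heat a =O[atTop] fun t => t ^ (-A) := by
  have h0 : Tendsto (fun t : ℝ => Real.exp (-t)) atTop (𝓝 0) :=
    Real.tendsto_exp_neg_atTop_nhds_zero
  have h1 : Tendsto (fun t : ℝ => Real.exp (-(a * t))) atTop (𝓝 0) :=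
    h0.comp (tendsto_id.const_mul_atTop (by linarith))
  have h2 : Tendsto (fun t : ℝ => 1 / (1 - Real.exp (-t)) ^ 2 *
      ((1 + Real.exp (-(a * t))) / (1 - Real.exp (-(a * t))))) atTop
      (𝓝 (1 / (1 - 0) ^ 2 * ((1 + 0) / (1 - 0)))) :=
    ((tendsto_const_nhds).div ((tendsto_const_nhds.sub h0).pow 2) (by norm_num)).mul
      ((tendsto_const_nhds.add h1).div (tendsto_const_nhds.sub h1) (by norm_num))
  have h3 : (fun t : ℝ => Real.exp (-t)) =O[atTop] fun t => t ^ (-A) := by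
    simpa using (isLittleO_exp_neg_mul_rpow_atTop one_pos (-A)).isBigO
  refine (h3.mul (h2.isBigO_one ℝ)).congr (fun t => ?_) (fun t => by simp)
  unfold heat
  ring

/-- The general term of the spectral zeta function, indexed by `ℕ × ℕ`. -/
noncomputable def zetaTerm (a : ℝ) (s : ℂ) (p : ℕ × ℕ) : ℂ :=
  (redMult p : ℂ) * ((freq a p : ℂ) ^ 2 - 1) ^ (-s)

theorem zetaTerm_zero_succ (s : ℂ) (n : ℕ) :
    zetaTerm a s (0, n + 1) = ((n : ℂ) + 2) * (((n : ℂ) + 1) * ((n : ℂ) + 3)) ^ (-s) := by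
  have h : ((0, n + 1) : ℕ × ℕ) ≠ 0 := by simp
  simp only [zetaTerm, redMult, mult, freq, h, if_false, if_true]
  push_cast
  congr 2 <;> ring

theorem zetaTerm_succ (s : ℂ) (m n : ℕ) :
    zetaTerm a s (m + 1, n) = 2 * (((n : ℂ) + 1) *
      (((a : ℂ) * (m + 1) + n) * ((a : ℂ) * (m + 1) + n + 2)) ^ (-s)) := by
  have h : ((m + 1, n) : ℕ × ℕ) ≠ 0 := by simp
  simp only [zetaTerm, redMult, mult, freq, h, if_false, Nat.succ_ne_zero]
  push_cast
  rw [show ((a : ℂ) * (m + 1) + n + 1) ^ 2 - 1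
    = ((a : ℂ) * (m + 1) + n) * ((a : ℂ) * (m + 1) + n + 2) by ring]
  ring

theorem summable_norm_zetaTerm (ha : 1 ≤ a) {s : ℂ} (hs : 3 < s.re) :
    Summable fun p => ‖zetaTerm a s p‖ := by
  refine (summable_mul_rpow (τ := s.re) (by linarith)).of_nonneg_of_le
    (fun p => norm_nonneg _) fun p => ?_
  by_cases hp : p = 0
  · simp only [zetaTerm, redMult, hp, if_true, Complex.ofReal_zero, zero_mul, norm_zero]
    positivity
  have h1 := mul_le_freq_sq_sub_one ha hp
  have h2 : (0 : ℝ) < ((p.1 : ℝ) + 1) * (p.2 + 1) := by positivity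
  have h3 : ((freq a p : ℂ) ^ 2 - 1) = ((freq a p ^ 2 - 1 : ℝ) : ℂ) := by push_cast; ring
  rw [zetaTerm, norm_mul, h3, Complex.norm_cpow_eq_rpow_re_of_pos (by linarith),
    Complex.norm_of_nonneg (redMult_nonneg p), Complex.neg_re]
  exact mul_le_mul ((redMult_le p).trans (mult_le p))
    (Real.rpow_le_rpow_of_nonpos h2 h1 (by linarith)) (Real.rpow_nonneg (by linarith) _)
    (by positivity)

theorem zetaS3_eq_tsum (ha : 1 ≤ a) {s : ℂ} (hs : 3 < s.re) :
    zetaS3 a s = ∑' p, zetaTerm a s p := by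
  have h := (summable_norm_zetaTerm ha hs).of_norm
  have h0 : Summable fun n => zetaTerm a s (0, n) := h.prod_factor 0
  have h00 : zetaTerm a s (0, 0) = 0 := by
    simp [zetaTerm, redMult, ← Prod.zero_eq_mk]
  rw [h.tsum_prod, h.prod.tsum_eq_zero_add, h0.tsum_eq_zero_add, h00, zero_add]
  simp only [zetaTerm_zero_succ, zetaTerm_succ, tsum_mul_left, zetaS3]

/-- The Dirichlet series `∑ redMult p * freq a p ^ (-w)` continues meromorphically to every
half-plane; the continuation is regular at even integers, with value `-1` at `0`. -/
theorem exists_spectral_continuation (ha : 1 ≤ a) :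
    ∃ x₀ : ℝ, ∀ L : ℝ, ∃ T : ℂ → ℂ, (∀ w : ℂ, -L < w.re → MeromorphicAt T w) ∧
      (∀ w : ℂ, -L < w.re → (∃ k : ℤ, w = 2 * k) → AnalyticAt ℂ T w) ∧ T 0 = -1 ∧
      ∀ w : ℂ, x₀ < w.re →
        HasSum (fun p => (redMult p : ℂ) * (freq a p : ℂ) ^ (-w)) (T w) := by
  obtain ⟨x₀, h⟩ := exists_mellin_continuation (continuousOn_heat ha) (heat_isBigO_atTop ha)
    meromorphicAt_heat (fun t ht => heat_neg ha ht)
  refine ⟨max x₀ 4, fun L => ?_⟩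
  obtain ⟨M, hm, han, heq⟩ := h L
  have hΓ : ∀ w, AnalyticAt ℂ (fun w => (Complex.Gamma w)⁻¹) w :=
    fun w => Complex.differentiable_one_div_Gamma.analyticAt w
  refine ⟨fun w => (Complex.Gamma w)⁻¹ * M w - 1, fun w hw => ?_, fun w hw hk => ?_, ?_, ?_⟩
  · exact ((hΓ w).meromorphicAt.mul (hm w hw)).sub analyticAt_const.meromorphicAt
  · exact ((hΓ w).mul (han w hw hk)).sub analyticAt_const
  · simp [Complex.Gamma_zero]
  · intro w hw
    have hw4 : 4 < w.re := (le_max_right _ _).trans_lt hw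
    have hG : Complex.Gamma w ≠ 0 := Complex.Gamma_ne_zero_of_re_pos (by linarith)
    have h1 := hasSum_mellin (a := fun p => (mult p : ℂ)) (p := freq a)
      (F := fun t => (heat a t : ℂ)) (s := w) (fun p => Or.inr (freq_pos ha p)) (by linarith)
      (fun t ht => by exact_mod_cast hasSum_heat ha ht)
      ((summable_mult_mul_freq_rpow ha hw4).congr fun p => by
        rw [Complex.norm_of_nonneg (mult_nonneg p), Real.rpow_neg (freq_pos ha p).le,
          div_eq_mul_inv])
    rw [← heq w ((le_max_left _ _).trans_lt hw)] at h1
    have h2 := hasSum_ite_sub_hasSum (h1.mul_left (Complex.Gamma w)⁻¹) 0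
    have h0 : (Complex.Gamma w)⁻¹ * (Complex.Gamma w * (mult 0 : ℂ) / (freq a 0 : ℂ) ^ w) = 1 := by
      simp [mult, freq, hG]
    rw [h0] at h2
    refine h2.congr_fun fun p => ?_
    by_cases hp : p = 0
    · simp [hp, redMult]
    · simp only [hp, redMult, if_false, Complex.cpow_neg]
      field_simp

/-- The spectral zeta function continues meromorphically to every half-plane, with value `-1`
at `0`. -/
theorem exists_zetaS3_continuation (ha : 1 ≤ a) (K : ℕ) :
    ∃ (G : ℂ → ℂ) (x₀ : ℝ), (∀ s : ℂ, -(K : ℝ) < s.re → MeromorphicAt G s) ∧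
      (0 < K → ContinuousAt G 0) ∧ G 0 = -1 ∧ ∀ s : ℂ, x₀ < s.re → G s = zetaS3 a s := by
  obtain ⟨x₀, h⟩ := exists_spectral_continuation ha
  obtain ⟨T, hTm, hTa, hT0, hT⟩ := h (2 * K)
  set M := K + 3 with hM
  set R : ℂ → ℕ × ℕ → ℂ := fun s p =>
    (redMult p : ℂ) * ((freq a p : ℂ) ^ (-(2 * s)) * binomRem M s ((freq a p ^ 2)⁻¹)) with hR
  have hu : ∀ p, p ≠ 0 → (freq a p ^ 2)⁻¹ ≤ 1 / 4 := by
    intro p hp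
    have := two_le_freq ha hp
    rw [inv_le_comm₀ (by have := freq_pos ha p; positivity) (by norm_num)]
    nlinarith
  have hbound : ∀ B : ℝ, ∃ C : ℝ, ∀ p, ∀ s : ℂ, -(K : ℝ) < s.re → ‖s‖ < B →
      ‖R s p‖ ≤ C * (mult p * freq a p ^ (-6 : ℝ)) := by
    intro B
    obtain ⟨C, hC, h⟩ := exists_norm_binomRem_le M B
    refine ⟨C, fun p s hs hsB => ?_⟩
    have hν := freq_pos ha p
    by_cases hp : p = 0
    · have : R s p = 0 := by simp [hR, redMult, hp]
      rw [this, norm_zero]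
      exact mul_nonneg hC (mul_nonneg (mult_nonneg p) (Real.rpow_nonneg hν.le _))
    have h1 := h s hsB.le ((freq a p ^ 2)⁻¹) (by positivity) (hu p hp)
    have h2 : freq a p ^ (-(2 * s)).re ≤ freq a p ^ (2 * K : ℝ) := by
      refine Real.rpow_le_rpow_of_exponent_le (by linarith [two_le_freq ha hp]) ?_
      simp
      linarith
    have h3 : freq a p ^ (2 * K : ℝ) * ((freq a p ^ 2)⁻¹) ^ M = freq a p ^ (-6 : ℝ) := by
      rw [← Real.rpow_natCast (freq a p) 2, ← Real.rpow_neg hν.le, ← Real.rpow_natCast,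
        ← Real.rpow_mul hν.le, ← Real.rpow_add hν]
      congr 1
      rw [hM]
      push_cast
      ring
    rw [hR]
    simp only
    rw [norm_mul, norm_mul, Complex.norm_of_nonneg (redMult_nonneg p),
      Complex.norm_cpow_eq_rpow_re_of_pos hν]
    calc redMult p * (freq a p ^ (-(2 * s)).re * ‖binomRem M s ((freq a p ^ 2)⁻¹)‖)
        ≤ mult p * (freq a p ^ (2 * K : ℝ) * (C * ((freq a p ^ 2)⁻¹) ^ M)) := by
          gcongr
          · exact mult_nonneg p
          · exact redMult_le p
      _ = C * (mult p * freq a p ^ (-6 : ℝ)) := by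
          rw [← h3]; ring
  have hsum6 : Summable fun p => mult p * freq a p ^ (-6 : ℝ) :=
    summable_mult_mul_freq_rpow ha (by norm_num)
  have hRsum : ∀ s : ℂ, -(K : ℝ) < s.re → Summable (R s) := by
    intro s hs
    obtain ⟨C, hC⟩ := hbound (‖s‖ + 1)
    exact (hsum6.mul_left C).of_norm_bounded fun p => hC p s hs (by linarith)
  have hRdiff : ∀ p, Differentiable ℂ fun s => R s p := by
    intro p
    by_cases hp : p = 0
    · simp [hR, redMult, hp]
    have hν : (freq a p : ℂ) ≠ 0 := by exact_mod_cast (freq_pos ha p).ne'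
    have h1 := differentiable_binomRem M (u := (freq a p ^ 2)⁻¹) (by linarith [hu p hp])
    have h2 : Differentiable ℂ fun s : ℂ => (freq a p : ℂ) ^ (-(2 * s)) :=
      Differentiable.const_cpow (by fun_prop) (Or.inl hν)
    exact (h2.mul h1).const_mul _
  have hRan : ∀ s : ℂ, -(K : ℝ) < s.re → AnalyticAt ℂ (fun s => ∑' p, R s p) s := by
    intro s hs
    obtain ⟨C, hC⟩ := hbound (‖s‖ + 1)
    have ho : IsOpen {z : ℂ | -(K : ℝ) < z.re ∧ ‖z‖ < ‖s‖ + 1} :=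
      (isOpen_lt continuous_const Complex.continuous_re).inter
        (isOpen_lt continuous_norm continuous_const)
    have := Complex.differentiableOn_tsum_of_summable_norm (F := fun p s => R s p) (hsum6.mul_left C)
      (fun p => (hRdiff p).differentiableOn) ho (fun p z hz => hC p z hz.1 hz.2)
    exact this.analyticAt (ho.mem_nhds ⟨hs, by linarith⟩)
  have hbc : ∀ k s, AnalyticAt ℂ (binomCoeff k) s := fun k s =>
    (differentiable_binomCoeff k).analyticAt s
  have hlin : ∀ (k : ℕ) s, AnalyticAt ℂ (fun s : ℂ => 2 * s + 2 * k) s := by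
    intro k s; fun_prop
  refine ⟨fun s => ∑ k ∈ Finset.range M, binomCoeff k s * T (2 * s + 2 * k) + ∑' p, R s p,
    max (x₀ / 2) 3, ?_, ?_, ?_, ?_⟩
  · intro s hs
    refine MeromorphicAt.fun_add (MeromorphicAt.fun_sum fun k _ => ?_) (hRan s hs).meromorphicAt
    refine (hbc k s).meromorphicAt.mul ?_
    refine MeromorphicAt.comp_analyticAt (f := T) (g := fun s : ℂ => 2 * s + 2 * k)
      (hTm _ ?_) (hlin k s)
    have : (0 : ℝ) ≤ k := by positivity
    simp
    linarith
  · intro hK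
    have hK' : (0 : ℝ) < K := by exact_mod_cast hK
    refine AnalyticAt.continuousAt (𝕜 := ℂ) ?_
    refine AnalyticAt.fun_add (Finset.analyticAt_fun_sum _ fun k _ => ?_) (hRan 0 (by simpa))
    refine (hbc k 0).mul ?_
    refine AnalyticAt.fun_comp (g := T) (f := fun s : ℂ => 2 * s + 2 * k)
      (hTa _ ?_ ⟨k, by simp⟩) (hlin k 0)
    have : (0 : ℝ) ≤ k := by positivity
    simp
    linarith
  · have h1 : ∀ p, R 0 p = 0 := fun p => by
      simp [hR, binomRem_zero (show M ≠ 0 by omega)]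
    simp [h1, binomCoeff_zero_right, hM, hT0]
  · intro s hs
    have hs3 : 3 < s.re := (le_max_right _ _).trans_lt hs
    have hsx : x₀ / 2 < s.re := (le_max_left _ _).trans_lt hs
    have hK0 : (0 : ℝ) ≤ K := by positivity
    have h1 : ∀ k ∈ Finset.range M, HasSum (fun p => binomCoeff k s *
        ((redMult p : ℂ) * (freq a p : ℂ) ^ (-(2 * s + 2 * k))))
        (binomCoeff k s * T (2 * s + 2 * k)) := by
      intro k _
      refine (hT _ ?_).mul_left _
      have : (0 : ℝ) ≤ k := by positivity
      simp
      linarith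
    have h2 := (hasSum_sum h1).add (hRsum s (by linarith)).hasSum
    rw [zetaS3_eq_tsum ha hs3]
    refine (HasSum.tsum_eq ?_).symm
    refine h2.congr_fun fun p => ?_
    by_cases hp : p = 0
    · simp [zetaTerm, hR, redMult, hp]
    have hν := freq_pos ha p
    have hνc : (freq a p : ℂ) ≠ 0 := by exact_mod_cast hν.ne'
    have e1 : ((freq a p : ℂ) ^ 2 - 1) ^ (-s) = (freq a p : ℂ) ^ (-(2 * s)) *
        (1 - (((freq a p ^ 2)⁻¹ : ℝ) : ℂ)) ^ (-s) := by
      have e2 : ((freq a p : ℂ) ^ 2 - 1) = ((freq a p ^ 2 : ℝ) : ℂ) *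
          ((1 - (freq a p ^ 2)⁻¹ : ℝ) : ℂ) := by
        push_cast
        field_simp
      rw [e2, Complex.mul_cpow_ofReal_nonneg (by positivity) (by linarith [hu p hp])]
      congr 1
      · rw [show -(2 * s) = ((2 : ℕ) : ℂ) * (-s) by push_cast; ring,
          Complex.cpow_nat_mul']
        · push_cast; rfl
        · simp [Complex.arg_ofReal_of_nonneg hν.le, Real.pi_pos]
        · simp [Complex.arg_ofReal_of_nonneg hν.le, Real.pi_pos.le]
      · push_cast; rfl
    have e3 : ∀ k : ℕ, (freq a p : ℂ) ^ (-(2 * s + 2 * k)) = (freq a p : ℂ) ^ (-(2 * s)) *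
        (((freq a p ^ 2)⁻¹ : ℝ) : ℂ) ^ k := by
      intro k
      rw [neg_add, Complex.cpow_add _ _ hνc, Complex.cpow_neg _ (2 * (k : ℂ)),
        show (2 * k : ℂ) = ((2 * k : ℕ) : ℂ) by push_cast; ring, Complex.cpow_natCast]
      push_cast
      rw [pow_mul, inv_pow]
    simp only [zetaTerm, e1, e3, hR, binomRem]
    have e4 : ∀ x y z : ℂ, ∑ k ∈ Finset.range M, binomCoeff k s * (x * (y * z ^ k))
        = x * (y * ∑ k ∈ Finset.range M, binomCoeff k s * z ^ k) := by
      intro x y z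
      simp only [Finset.mul_sum]
      exact Finset.sum_congr rfl fun k _ => by ring
    rw [e4]
    ring

/-- If `F` has, on every half-plane `{s : Re s > -K}`, a meromorphic continuation that is regular
at `s₀` with value `v`, then every analytic continuation of `F` to `s₀` takes the value `v`. -/
theorem continuation_eq_of_meromorphic {F f : ℂ → ℂ} {c : ℝ} {s₀ v : ℂ}
    (hf : IsContinuationAt F c s₀ f)
    (hG : ∀ K : ℕ, ∃ (G : ℂ → ℂ) (x₀ : ℝ), (∀ s : ℂ, -(K : ℝ) < s.re → MeromorphicAt G s) ∧
      (-(K : ℝ) < s₀.re → ContinuousAt G s₀) ∧ G s₀ = v ∧ ∀ s : ℂ, x₀ < s.re → G s = F s) :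
    f s₀ = v := by
  obtain ⟨U, hUo, hUc, hsU, hcU, hfU, hfF⟩ := hf
  have hjoin : JoinedIn U s₀ ((c + 1 : ℝ) : ℂ) :=
    (hUo.isConnected_iff_isPathConnected.1 hUc).joinedIn _ hsU _ (hcU (by simp))
  obtain ⟨γ, hγ⟩ := hjoin
  have hcomp : IsCompact (range γ) := isCompact_range γ.continuous
  obtain ⟨b, hb⟩ := (hcomp.image Complex.continuous_re).bddBelow
  obtain ⟨K, hK⟩ := exists_nat_gt (max (-b) (-(c + 1)))
  have hKb : -b < K := (le_max_left _ _).trans_lt hK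
  have hKc : -(c + 1) < K := (le_max_right _ _).trans_lt hK
  obtain ⟨G, x₀, hGm, hGc, hGv, hGF⟩ := hG K
  set W : Set ℂ := range γ ∪ {z | c + 1 ≤ z.re} with hW
  have hWc : IsConnected W := by
    refine IsConnected.union ⟨((c + 1 : ℝ) : ℂ), ⟨1, γ.target⟩, by simp⟩
      (isConnected_range γ.continuous)
      ((convex_halfSpace_re_ge _).isConnected ⟨((c + 1 : ℝ) : ℂ), by simp⟩)
  have hWU : W ⊆ U := by
    rintro z (⟨t, rfl⟩ | (hz : c + 1 ≤ z.re))
    · exact hγ t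
    · exact hcU (show c < z.re by linarith)
  have hWK : ∀ z ∈ W, -(K : ℝ) < z.re := by
    rintro z (hz | (hz : c + 1 ≤ z.re))
    · linarith [hb (mem_image_of_mem _ hz)]
    · linarith
  have hs₀ : s₀ ∈ W := Or.inl ⟨0, γ.source⟩
  have hmero : MeromorphicOn (f - G) W := fun z hz =>
    (hfU z (hWU hz)).meromorphicAt.sub (hGm z (hWK z hz))
  have hz₁ : ((max (c + 1) (x₀ + 1) : ℝ) : ℂ) ∈ W := Or.inr (by simp)
  have htop : meromorphicOrderAt (f - G) ((max (c + 1) (x₀ + 1) : ℝ) : ℂ) = ⊤ := by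
    rw [meromorphicOrderAt_eq_top_iff]
    refine eventually_nhdsWithin_of_eventually_nhds ?_
    have ho : IsOpen {z : ℂ | max c x₀ < z.re} := isOpen_lt continuous_const Complex.continuous_re
    filter_upwards [ho.mem_nhds (x := ((max (c + 1) (x₀ + 1) : ℝ) : ℂ))
      (by simp only [mem_ofPred_eq, Complex.ofReal_re, max_add_add_right]; exact lt_add_one _)] with z hz
    have h1 : c < z.re := (le_max_left _ _).trans_lt hz
    have h2 : x₀ < z.re := (le_max_right _ _).trans_lt hz
    simp [hfF z h1, hGF z h2]
  have htop₀ : meromorphicOrderAt (f - G) s₀ = ⊤ := by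
    by_contra hne
    exact (hmero.exists_meromorphicOrderAt_ne_top_iff_forall_mem hWc).1 ⟨s₀, hs₀, hne⟩ _ hz₁ htop
  rw [meromorphicOrderAt_eq_top_iff] at htop₀
  have hlim : Tendsto (f - G) (𝓝[≠] s₀) (𝓝 (f s₀ - G s₀)) :=
    (((hfU s₀ hsU).continuousAt.sub (hGc (hWK s₀ hs₀))).tendsto).mono_left nhdsWithin_le_nhds
  have hlim' : Tendsto (f - G) (𝓝[≠] s₀) (𝓝 0) := tendsto_const_nhds.congr' (by
    filter_upwards [htop₀] with z hz using hz.symm)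
  rw [← hGv]
  exact sub_eq_zero.1 (tendsto_nhds_unique hlim hlim')

end

/-- for `a ≥ 1`, the series defining `Z(s) = ζ(s, Δ_{S³_{1/a}})` converge
absolutely for `Re s > 3`, and every analytic continuation `f` of `Z` to `0` satisfies
`f(0) = −1` (independently of `a`). -/
theorem stmt13 (a : ℝ) (ha : 1 ≤ a) :
    (∀ s : ℂ, 3 < s.re →
      Summable (fun n : ℕ => ‖((n : ℂ) + 2) * (((n : ℂ) + 1) * ((n : ℂ) + 3)) ^ (-s)‖) ∧
      Summable (fun p : ℕ × ℕ =>
        ‖((p.2 : ℂ) + 1) *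
          (((a : ℂ) * (p.1 + 1) + p.2) * ((a : ℂ) * (p.1 + 1) + p.2 + 2)) ^ (-s)‖)) ∧
    ∀ f : ℂ → ℂ, IsContinuationAt (zetaS3 a) 3 0 f → f 0 = -1 := by
  refine ⟨fun s hs => ?_, fun f hf => ?_⟩
  · have h := summable_norm_zetaTerm ha hs
    constructor
    · have hi : Function.Injective fun n : ℕ => ((0, n + 1) : ℕ × ℕ) := fun n n' hn => by
        simpa using hn
      exact (h.comp_injective hi).congr fun n => by
        rw [Function.comp_apply, zetaTerm_zero_succ]
    · have hi : Function.Injective fun p : ℕ × ℕ => (p.1 + 1, p.2) := fun p p' hp => by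
        simpa [Prod.ext_iff] using hp
      refine ((h.comp_injective hi).mul_left (1 / 2)).congr fun p => ?_
      rw [Function.comp_apply, zetaTerm_succ, norm_mul 2, Complex.norm_ofNat]
      ring
  · refine continuation_eq_of_meromorphic hf fun K => ?_
    obtain ⟨G, x₀, h1, h2, h3, h4⟩ := exists_zetaS3_continuation ha K
    exact ⟨G, x₀, h1, fun hK => h2 (by simpa using hK), h3, h4⟩
end
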